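/- arXiv:1309.2000 — 2 statements merged into one kernel-verified Lean document; each statement's English description precedes it below -/
import Mathlib

section
/- Fix 0 < c < 1 and let G_n ∈ G(n, c/n). Then E[β(G_n)] = n e^{−c}( 1 + c − Σ_{k≥3} (c^k/k!)(1 − ((1−(c+1)e^{−c})/(1−c e^{−c}))^k) − Σ_{k≥2} (1/2) c^{k−1} e^{−(k−1)c} )(1+o(1)) as n → ∞. -/
open scoped Classical BigOperators
open Filter Topology

noncomputable section

namespace MetricDimPaper

/-- `R` is a resolving set of `G`: every pair of distinct vertices is distinguished by its
vector of (extended, possibly infinite) distances to the vertices of `R`. -/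
def Resolves {V : Type*} (G : SimpleGraph V) (R : Set V) : Prop :=
  ∀ u v : V, u ≠ v → ∃ w ∈ R, G.edist u w ≠ G.edist v w

/-- The metric dimension of a graph: the least cardinality of a resolving set, with the
convention that a single isolated vertex has metric dimension 1. -/
def metricDim {V : Type*} (G : SimpleGraph V) : ℕ :=
  if Nat.card V = 1 then 1
  else sInf {m : ℕ | ∃ R : Set V, R.ncard = m ∧ Resolves G R}

/-- A tree: a connected acyclic graph. -/
def IsTree {V : Type*} (G : SimpleGraph V) : Prop := G.Connected ∧ G.IsAcyclic

/-- degree of a vertex (as `Nat.card` of the neighbor set). -/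
def ndeg {V : Type*} (G : SimpleGraph V) (v : V) : ℕ := (G.neighborSet v).ncard

/-- metric dimension as a real number -/
def betaR {n : ℕ} (G : SimpleGraph (Fin n)) : ℝ := (metricDim G : ℝ)

def treeSet (n : ℕ) : Set (SimpleGraph (Fin n)) := {G | IsTree G}

def forestSet (n : ℕ) : Set (SimpleGraph (Fin n)) := {G | G.IsAcyclic}

/-- Expectation of `f` under the uniform distribution on the (finite) set `S` of graphs. -/
def unifExp {n : ℕ} (S : Set (SimpleGraph (Fin n))) (f : SimpleGraph (Fin n) → ℝ) : ℝ :=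
  (∑ᶠ G ∈ S, f G) / (Nat.card ↥S)

/-- Variance of `f` under the uniform distribution on `S`. -/
def unifVar {n : ℕ} (S : Set (SimpleGraph (Fin n))) (f : SimpleGraph (Fin n) → ℝ) : ℝ :=
  unifExp S (fun G => (f G - unifExp S f) ^ 2)

/-- Probability of the event `A` under the uniform distribution on `S`. -/
def unifPr {n : ℕ} (S A : Set (SimpleGraph (Fin n))) : ℝ :=
  (Nat.card ↥(S ∩ A) : ℝ) / (Nat.card ↥S)

/-- The probability weight of an individual graph in the Erdős–Rényi model `G(n,p)`. -/
def erWeight (n : ℕ) (p : ℝ) (G : SimpleGraph (Fin n)) : ℝ :=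
  p ^ (Nat.card ↥G.edgeSet) * (1 - p) ^ (n.choose 2 - Nat.card ↥G.edgeSet)

/-- Expectation of `f` in the Erdős–Rényi model `G(n,p)`. -/
def erExp (n : ℕ) (p : ℝ) (f : SimpleGraph (Fin n) → ℝ) : ℝ :=
  ∑ᶠ G : SimpleGraph (Fin n), erWeight n p G * f G

/-- Variance of `f` in the Erdős–Rényi model `G(n,p)`. -/
def erVar (n : ℕ) (p : ℝ) (f : SimpleGraph (Fin n) → ℝ) : ℝ :=
  erExp n p (fun G => (f G - erExp n p f) ^ 2)

/-- Probability of the event `A` in the Erdős–Rényi model `G(n,p)`. -/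
def erPr (n : ℕ) (p : ℝ) (A : Set (SimpleGraph (Fin n))) : ℝ :=
  ∑ᶠ G ∈ A, erWeight n p G

/-- The cumulative distribution function of the standard normal law. -/
def stdGaussianCDF (x : ℝ) : ℝ :=
  (Real.sqrt (2 * Real.pi))⁻¹ * ∫ t in Set.Iic x, Real.exp (-(t ^ 2) / 2)

/-- The normalized metric dimension `(β - E β)/sqrt (Var β)` for the uniform model on `S`. -/
def normβ {n : ℕ} (S : Set (SimpleGraph (Fin n))) (G : SimpleGraph (Fin n)) : ℝ :=
  (betaR G - unifExp S betaR) / Real.sqrt (unifVar S betaR)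

/-- The normalized metric dimension `(β - E β)/sqrt (Var β)` for the `G(n,p)` model. -/
def erNormβ (n : ℕ) (p : ℝ) (G : SimpleGraph (Fin n)) : ℝ :=
  (betaR G - erExp n p betaR) / Real.sqrt (erVar n p betaR)


/-- The connected component of `v` contains a cycle. -/
def CyclicAt {V : Type*} (G : SimpleGraph V) (v : V) : Prop :=
  ∃ (x : V) (c : G.Walk x x), G.Reachable v x ∧ c.IsCycle

/-- The vertices lying beyond the edge `va`, as seen from `v`. -/
def branch {V : Type*} (G : SimpleGraph V) (v a : V) : Set V :=
  {x | G.Reachable x a ∧ G.dist x v = G.dist x a + 1}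

/-- The edge `va` starts a pendant path of `G` which ends at the leaf `l`. -/
inductive Leg {V : Type*} (G : SimpleGraph V) : V → V → V → Prop
  | leaf {v a : V} : G.Adj v a → (∀ y, G.Adj a y → y = v) → Leg G v a a
  | step {v a w l : V} : G.Adj v a → G.Adj a w → w ≠ v →
      (∀ y, G.Adj a y → y = v ∨ y = w) → Leg G a w l → Leg G v a l

section Trees

variable {V : Type*} {G : SimpleGraph V}

lemma CyclicAt.congr {u v : V} (h : G.Reachable u v) : CyclicAt G u ↔ CyclicAt G v :=
  ⟨fun ⟨x, c, hx, hc⟩ => ⟨x, c, h.symm.trans hx, hc⟩, fun ⟨x, c, hx, hc⟩ => ⟨x, c, h.trans hx, hc⟩⟩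

lemma isBridge_of_not_cyclicAt {v a : V} (hv : ¬ CyclicAt G v) (h : G.Adj v a) :
    G.IsBridge s(v, a) := by
  rw [SimpleGraph.isBridge_iff_forall_cycle_notMem h]
  intro u p hp he
  exact hv ⟨u, p, ⟨(p.takeUntil v (p.fst_mem_support_of_mem_edges he)).reverse⟩, hp⟩

lemma dist_succ_cases {v a x : V} (hv : ¬ CyclicAt G v) (h : G.Adj v a) (hx : G.Reachable x v) :
    x ∈ branch G v a ∨ x ∈ branch G a v := by
  have hxa : G.Reachable x a := hx.trans h.reachable
  have h1 : G.dist v a = 1 := SimpleGraph.dist_eq_one_iff_adj.2 h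
  have h2 : G.dist a v = 1 := SimpleGraph.dist_eq_one_iff_adj.2 h.symm
  have h3 := hx.dist_triangle_left a
  have h4 := hxa.dist_triangle_left v
  have h5 : G.dist x v ≠ G.dist x a := by
    intro he
    obtain ⟨p, hp⟩ := hx.exists_walk_length_eq_dist
    obtain ⟨q, hq⟩ := hxa.exists_walk_length_eq_dist
    have hb := SimpleGraph.isBridge_iff_forall_walk_mem_edges.1 (isBridge_of_not_cyclicAt hv h)
      (p.reverse.append q)
    rw [SimpleGraph.Walk.edges_append, List.mem_append, SimpleGraph.Walk.edges_reverse,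
      List.mem_reverse] at hb
    rcases hb with hb | hb
    · have hs := p.snd_mem_support_of_mem_edges hb
      have := congrArg SimpleGraph.Walk.length (p.take_spec hs)
      rw [SimpleGraph.Walk.length_append] at this
      have := SimpleGraph.dist_le (p.takeUntil a hs)
      have := SimpleGraph.dist_le (p.dropUntil a hs)
      omega
    · have hs := q.fst_mem_support_of_mem_edges hb
      have := congrArg SimpleGraph.Walk.length (q.take_spec hs)
      rw [SimpleGraph.Walk.length_append] at this
      have := SimpleGraph.dist_le (q.takeUntil v hs)
      have := SimpleGraph.dist_le (q.dropUntil v hs)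
      omega
  simp only [branch, Set.mem_ofPred_eq, hx, hxa, true_and]
  omega

lemma not_mem_both_branches {v a x : V} (h : x ∈ branch G v a) : x ∉ branch G a v := by
  simp only [branch, Set.mem_ofPred_eq] at *
  omega

lemma dist_across {v a x y : V} (hv : ¬ CyclicAt G v) (h : G.Adj v a) (hx : x ∈ branch G v a)
    (hy : y ∈ branch G a v) : G.dist x y = G.dist x a + 1 + G.dist v y := by
  obtain ⟨hxa, hx⟩ := hx
  obtain ⟨hyv, hy⟩ := hy
  have h2 : G.dist a v = 1 := SimpleGraph.dist_eq_one_iff_adj.2 h.symm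
  have hxy : G.Reachable x y := hxa.trans (h.symm.reachable.trans hyv.symm)
  obtain ⟨p, hp⟩ := hxa.exists_walk_length_eq_dist
  obtain ⟨q, hq⟩ := hyv.exists_walk_length_eq_dist
  obtain ⟨r, hr⟩ := hxy.exists_walk_length_eq_dist
  have hb := SimpleGraph.isBridge_iff_forall_walk_mem_edges.1 (isBridge_of_not_cyclicAt hv h)
      ((p.reverse.append (r.append q)).reverse)
  have hvr : v ∈ r.support := by
    simp only [SimpleGraph.Walk.edges_append, List.mem_append, SimpleGraph.Walk.edges_reverse,
      List.mem_reverse] at hb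
    rcases hb with hb | hb | hb
    · exfalso
      have hs := p.fst_mem_support_of_mem_edges hb
      have := congrArg SimpleGraph.Walk.length (p.take_spec hs)
      rw [SimpleGraph.Walk.length_append] at this
      have := SimpleGraph.dist_le (p.takeUntil v hs)
      omega
    · exact r.fst_mem_support_of_mem_edges hb
    · exfalso
      have hs := q.snd_mem_support_of_mem_edges hb
      have := congrArg SimpleGraph.Walk.length (q.take_spec hs)
      rw [SimpleGraph.Walk.length_append] at this
      have := SimpleGraph.dist_le (q.takeUntil a hs)
      omega
  have := congrArg SimpleGraph.Walk.length (r.take_spec hvr)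
  rw [SimpleGraph.Walk.length_append] at this
  have := SimpleGraph.dist_le (r.takeUntil v hvr)
  have := SimpleGraph.dist_le (r.dropUntil v hvr)
  have := hxa.dist_triangle_left y
  have := h.symm.reachable.dist_triangle_left y
  omega

lemma mem_branch_self {v a : V} (h : G.Adj v a) : a ∈ branch G v a :=
  ⟨.rfl, by simp [h.symm]⟩

lemma branch_reachable {v a x : V} (h : G.Adj v a) (hx : x ∈ branch G v a) : G.Reachable v x :=
  h.reachable.trans hx.1.symm

/-- The first edge of a geodesic. -/
lemma exists_adj_mem_branch {u x : V} (h : G.Reachable x u) (hne : x ≠ u) :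
    ∃ a, G.Adj u a ∧ x ∈ branch G u a := by
  obtain ⟨p, hp⟩ := h.symm.exists_walk_length_eq_dist
  cases p with
  | nil => exact absurd rfl hne
  | @cons _ a _ hadj p =>
    refine ⟨a, hadj, ⟨p.reverse⟩, ?_⟩
    rw [SimpleGraph.Walk.length_cons] at hp
    have h1 := SimpleGraph.dist_le p
    have h2 := (hadj.reachable).dist_triangle_left x
    rw [SimpleGraph.dist_eq_one_iff_adj.2 hadj] at h2
    rw [SimpleGraph.dist_comm, SimpleGraph.dist_comm (u := x)]
    omega

lemma branch_cases {v a x : V} (hx : x ∈ branch G v a) :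
    x = a ∨ ∃ w, G.Adj a w ∧ w ≠ v ∧ x ∈ branch G a w := by
  by_cases hxa : x = a
  · exact .inl hxa
  obtain ⟨w, hw, hxw⟩ := exists_adj_mem_branch hx.1 hxa
  refine .inr ⟨w, hw, ?_, hxw⟩
  rintro rfl
  exact not_mem_both_branches hx hxw

lemma neighbor_mem_branch {v a b : V} (hv : ¬ CyclicAt G v) (h : G.Adj v a) (hb : G.Adj v b)
    (hab : a ≠ b) : b ∈ branch G a v := by
  rcases dist_succ_cases hv h hb.symm.reachable with ⟨hr, h1⟩ | h1
  · rw [SimpleGraph.dist_eq_one_iff_adj.2 hb.symm] at h1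
    exact absurd (hr.dist_eq_zero_iff.1 (by omega)) hab.symm
  · exact h1

lemma branch_subset {v a w : V} (hv : ¬ CyclicAt G v) (h : G.Adj v a) (hw : G.Adj a w)
    (hwv : w ≠ v) : branch G a w ⊆ branch G v a := by
  intro x hx
  have ha : ¬ CyclicAt G a := by rwa [← CyclicAt.congr h.reachable]
  have hvw := neighbor_mem_branch ha hw h.symm hwv
  have h1 := dist_across ha hw hx hvw
  rw [SimpleGraph.dist_eq_one_iff_adj.2 h.symm] at h1
  exact ⟨hx.1.trans hw.symm.reachable, by have := hx.2; omega⟩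

lemma not_mem_branch_tail {a w : V} : a ∉ branch G a w := by
  rintro ⟨-, h1⟩
  simp at h1

lemma branch_disjoint {v a b x : V} (hv : ¬ CyclicAt G v) (h : G.Adj v a) (hb : G.Adj v b)
    (hab : a ≠ b) (hx : x ∈ branch G v a) : x ∉ branch G v b := by
  intro hxb
  have h1 := dist_across hv h hx (neighbor_mem_branch hv h hb hab)
  rw [SimpleGraph.dist_eq_one_iff_adj.2 hb] at h1
  have := hxb.2
  have := hx.2
  omega

namespace Leg

lemma adj {v a l : V} (h : Leg G v a l) : G.Adj v a := by cases h <;> assumption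

lemma reachable {v a l : V} (h : Leg G v a l) : G.Reachable v l := by
  induction h with
  | leaf h1 h2 => exact h1.reachable
  | step h1 h2 h3 h4 h5 ih => exact h1.reachable.trans ih

lemma eq_or_step {v a l : V} (h : Leg G v a l) : (l = a ∧ ∀ y, G.Adj a y → y = v) ∨
    ∃ w, G.Adj a w ∧ w ≠ v ∧ (∀ y, G.Adj a y → y = v ∨ y = w) ∧ Leg G a w l := by
  cases h with
  | leaf h1 h2 => exact .inl ⟨rfl, h2⟩
  | step h1 h2 h3 h4 h5 => exact .inr ⟨_, h2, h3, h4, h5⟩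

lemma unique {v a l l' : V} (h : Leg G v a l) (h' : Leg G v a l') : l = l' := by
  induction h with
  | leaf h1 h2 =>
    rcases h'.eq_or_step with ⟨h3, -⟩ | ⟨w, hw, hne, -⟩
    · exact h3.symm
    · exact absurd (h2 w hw) hne
  | step h1 h2 h3 h4 h5 ih =>
    rcases h'.eq_or_step with ⟨-, h6⟩ | ⟨w, hw, hne, -, h7⟩
    · exact absurd (h6 _ h2) h3
    · obtain rfl := (h4 w hw).resolve_left hne
      exact ih h7

lemma mem_branch {v a l : V} (hv : ¬ CyclicAt G v) (h : Leg G v a l) : l ∈ branch G v a := by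
  induction h with
  | leaf h1 h2 => exact mem_branch_self h1
  | step h1 h2 h3 h4 h5 ih =>
    exact branch_subset hv h1 h2 h3 (ih (by rwa [← CyclicAt.congr h1.reachable]))

/-- The end of a leg is a leaf. -/
lemma end_leaf {v a l : V} (h : Leg G v a l) : ∃ b, G.Adj l b ∧ ∀ y, G.Adj l y → y = b := by
  induction h with
  | leaf h1 h2 => exact ⟨_, h1.symm, h2⟩
  | step h1 h2 h3 h4 h5 ih => exact ih

/-- If both directions of an edge start a leg, the component is a path. -/
lemma reverse {v a l l' : V} (h : Leg G v a l) (h' : Leg G a v l') :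
    ∃ b, G.Adj l b ∧ (∀ y, G.Adj l y → y = b) ∧ Leg G l b l' := by
  induction h with
  | leaf h1 h2 => exact ⟨_, h1.symm, h2, h'⟩
  | step h1 h2 h3 h4 h5 ih =>
    exact ih (.step h2.symm h1.symm h3.symm (fun y hy => (h4 y hy).symm) h')

lemma of_mem_branch {v a l x : V} (h : Leg G v a l) (hx : x ∈ branch G v a) :
    ∃ u, Leg G u x l := by
  induction h with
  | @leaf v a h1 h2 =>
    rcases branch_cases hx with rfl | ⟨w, hw, hne, -⟩
    · exact ⟨v, .leaf h1 h2⟩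
    · exact absurd (h2 w hw) hne
  | @step v a w l h1 h2 h3 h4 h5 ih =>
    rcases branch_cases hx with rfl | ⟨w', hw, hne, hx'⟩
    · exact ⟨v, .step h1 h2 h3 h4 h5⟩
    · obtain rfl := (h4 w' hw).resolve_left hne
      exact ih hx'

lemma ndeg_le {v a l : V} (h : Leg G v a l) : ndeg G a ≤ 2 := by
  unfold ndeg
  rcases h.eq_or_step with ⟨-, h1⟩ | ⟨w, -, -, h1, -⟩
  · have : G.neighborSet a ⊆ {v} := fun y hy => h1 y hy
    exact (Set.ncard_le_ncard this).trans (by simp)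
  · have : G.neighborSet a ⊆ {v, w} := fun y hy => h1 y hy
    exact (Set.ncard_le_ncard this).trans ((Set.ncard_insert_le v {w}).trans (by simp))

end Leg

/-- `v` is the start of some leg. -/
def HasLeg (G : SimpleGraph V) (v : V) : Prop := ∃ a l, Leg G v a l

lemma ndeg_eq_one {v : V} (h : ndeg G v = 1) : ∃ a, G.Adj v a ∧ ∀ y, G.Adj v y → y = a := by
  obtain ⟨a, ha⟩ := Set.ncard_eq_one.1 h
  have h1 : ∀ y, G.Adj v y ↔ y = a := fun y => by
    rw [← SimpleGraph.mem_neighborSet, ha, Set.mem_singleton_iff]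
  exact ⟨a, (h1 a).2 rfl, fun y hy => (h1 y).1 hy⟩

lemma ndeg_eq_one_of {v a : V} (h : G.Adj v a) (h' : ∀ y, G.Adj v y → y = a) : ndeg G v = 1 := by
  refine Set.ncard_eq_one.2 ⟨a, ?_⟩
  ext y
  exact ⟨fun hy => h' y hy, fun hy => hy ▸ h⟩

/-- `l` and `l'` are the two ends of a component of `G` which is a path. -/
def PathEnds (G : SimpleGraph V) (l l' : V) : Prop :=
  ∃ b, G.Adj l b ∧ (∀ y, G.Adj l y → y = b) ∧ Leg G l b l'

namespace PathEnds

lemma symm {l l' : V} (h : PathEnds G l l') : PathEnds G l' l := by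
  obtain ⟨b, h1, h2, h3⟩ := h
  exact h3.reverse (.leaf h1.symm h2)

lemma unique {l l' l'' : V} (h : PathEnds G l l') (h' : PathEnds G l l'') : l' = l'' := by
  obtain ⟨b, h1, h2, h3⟩ := h
  obtain ⟨b', h1', h2', h3'⟩ := h'
  obtain rfl := h2 b' h1'
  exact h3.unique h3'

lemma ne {l l' : V} (hl : ¬ CyclicAt G l) (h : PathEnds G l l') : l ≠ l' := by
  rintro rfl
  obtain ⟨b, h1, h2, h3⟩ := h
  exact not_mem_branch_tail (h3.mem_branch hl)

lemma ndeg_left {l l' : V} (h : PathEnds G l l') : ndeg G l = 1 := by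
  obtain ⟨b, h1, h2, -⟩ := h
  exact ndeg_eq_one_of h1 h2

lemma hasLeg {l l' : V} (h : PathEnds G l l') : HasLeg G l := by
  obtain ⟨b, -, -, h3⟩ := h
  exact ⟨b, _, h3⟩

lemma reachable {l l' : V} (h : PathEnds G l l') : G.Reachable l l' := by
  obtain ⟨b, h1, h2, h3⟩ := h
  exact h3.reachable

lemma exists_leg {l l' x : V} (h : PathEnds G l l') (hx : G.Reachable x l)
    (hne : x ≠ l) : ∃ u, Leg G u x l' := by
  obtain ⟨b, h1, h2, h3⟩ := h
  obtain ⟨a, ha, hxa⟩ := exists_adj_mem_branch hx hne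
  obtain rfl := h2 a ha
  exact h3.of_mem_branch hxa

lemma ndeg_le {l l' x : V} (h : PathEnds G l l') (hx : G.Reachable x l) :
    ndeg G x ≤ 2 := by
  by_cases hne : x = l
  · subst hne
    rw [h.ndeg_left]; norm_num
  · obtain ⟨u, hu⟩ := h.exists_leg hx hne
    exact hu.ndeg_le

/-- A leaf in a path component is one of its two ends. -/
lemma eq_or_eq {l l' x : V} (h : PathEnds G l l') (hx : G.Reachable x l)
    (hd : ndeg G x = 1) : x = l ∨ x = l' := by
  by_cases hne : x = l
  · exact .inl hne
  obtain ⟨u, hu⟩ := h.exists_leg hx hne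
  rcases hu.eq_or_step with ⟨h1, -⟩ | ⟨w, hw, hwu, -, -⟩
  · exact .inr h1.symm
  · obtain ⟨b, -, hb⟩ := ndeg_eq_one hd
    exact absurd ((hb w hw).trans (hb u hu.adj.symm).symm) hwu

end PathEnds

lemma pathEnds_of_hasLeg {l : V} (h : HasLeg G l) (hd : ndeg G l = 1) : ∃ l', PathEnds G l l' := by
  obtain ⟨a, l', h⟩ := h
  obtain ⟨b, h1, h2⟩ := ndeg_eq_one hd
  obtain rfl := h2 a h.adj
  exact ⟨l', a, h1, h2, h⟩

/-- A vertex lying on the legs of two distinct leaves belongs to a path component. -/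
lemma Leg.pathEnds_of_ne {u u' x l l' : V} (h : Leg G u x l) (h' : Leg G u' x l') (hne : l ≠ l') :
    PathEnds G l l' := by
  have huu : u ≠ u' := by
    rintro rfl
    exact hne (h.unique h')
  have key : ∀ {u u' x l : V}, G.Adj x u' → u ≠ u' → Leg G u x l → Leg G x u' l := by
    intro u u' x l h1 h2 h3
    rcases h3.eq_or_step with ⟨-, h4⟩ | ⟨w, hw, hwu, h4, h5⟩
    · exact absurd (h4 _ h1).symm h2
    · obtain rfl := (h4 u' h1).resolve_left h2.symm
      exact h5
  exact (key h'.adj.symm huu h).reverse h'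

/-- The leaf at the end of a leg determines the branching vertex where the leg starts. -/
lemma Leg.start_unique {v v' a a' l : V} (hl : ¬ CyclicAt G l) (h : Leg G v a l)
    (h' : Leg G v' a' l) (hv : 3 ≤ ndeg G v) (hv' : 3 ≤ ndeg G v') : v = v' := by
  have hr : G.Reachable v l ∧ G.Reachable v' l := ⟨h.reachable, h'.reachable⟩
  have hcv : ¬ CyclicAt G v := by rwa [CyclicAt.congr hr.1]
  have hcv' : ¬ CyclicAt G v' := by rwa [CyclicAt.congr hr.2]
  have h1 : v' ∈ branch G a v := by
    refine (dist_succ_cases hcv h.adj (hr.2.trans hr.1.symm)).resolve_left fun hm => ?_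
    obtain ⟨u, hu⟩ := h.of_mem_branch hm
    have := hu.ndeg_le
    omega
  have h2 : v ∈ branch G a' v' := by
    refine (dist_succ_cases hcv' h'.adj (hr.1.trans hr.2.symm)).resolve_left fun hm => ?_
    obtain ⟨u, hu⟩ := h'.of_mem_branch hm
    have := hu.ndeg_le
    omega
  have e1 := dist_across hcv h.adj (h.mem_branch hcv) h1
  have e2 := dist_across hcv' h'.adj (h'.mem_branch hcv') h2
  have e3 := (h.mem_branch hcv).2
  have e4 := (h'.mem_branch hcv').2
  exact ((hr.1.trans hr.2.symm).dist_eq_zero_iff).1 (by omega)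

end Trees

section Bounds

variable {V : Type*} [Fintype V] {G : SimpleGraph V}

lemma eq_or_eq_of_ndeg_le {v a b : V} (h : ndeg G v ≤ 2) (ha : G.Adj v a) (hb : G.Adj v b)
    (hab : a ≠ b) (y : V) (hy : G.Adj v y) : y = a ∨ y = b := by
  by_contra! hne
  have h1 : ({a, b, y} : Set V) ⊆ G.neighborSet v := by
    rintro z (rfl | rfl | rfl) <;> assumption
  have h2 := Set.ncard_le_ncard h1
  rw [Set.ncard_eq_three.2 ⟨a, b, y, hab, hne.1.symm, hne.2.symm, rfl⟩] at h2
  unfold ndeg at h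
  omega

lemma not_adj_of_ndeg_eq_zero {v : V} (h : ndeg G v = 0) (y : V) : ¬ G.Adj v y := by
  intro hy
  have h1 : G.neighborSet v = ∅ := (Set.ncard_eq_zero (Set.toFinite _)).1 h
  have : y ∈ G.neighborSet v := hy
  simp [h1] at this

lemma eq_of_reachable_of_ndeg_eq_zero {v x : V} (h : ndeg G v = 0) (hx : G.Reachable x v) :
    x = v := by
  by_contra hne
  obtain ⟨a, ha, -⟩ := exists_adj_mem_branch hx hne
  exact not_adj_of_ndeg_eq_zero h a ha

lemma exists_adj_of_ndeg_ne_zero {v : V} (h : ndeg G v ≠ 0) : ∃ y, G.Adj v y := by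
  by_contra! hne
  refine h ((Set.ncard_eq_zero (Set.toFinite _)).2 ?_)
  ext y
  simpa using hne y

/-- In a tree component which is not a path, each leaf ends a leg starting at a branching vertex. -/
lemma exists_leg_start {l : V} (hl : ¬ CyclicAt G l) (hd : ndeg G l = 1) (hn : ¬ HasLeg G l) :
    ∃ v a, Leg G v a l ∧ 3 ≤ ndeg G v := by
  by_contra! hcon
  obtain ⟨u, hu, hu'⟩ := ndeg_eq_one hd
  obtain ⟨⟨v, a⟩, hm, hmax⟩ := Finset.exists_max_image
    (Finset.univ.filter fun q : V × V => Leg G q.1 q.2 l ∧ G.Reachable l q.1)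
    (fun q => G.dist l q.1)
    ⟨(u, l), by simpa using ⟨Leg.leaf hu.symm hu', hu.reachable⟩⟩
  simp only [Finset.mem_filter, Finset.mem_univ, true_and] at hm hmax
  have hdv := hcon v a hm.1
  by_cases hb : ∃ b, G.Adj v b ∧ b ≠ a
  · obtain ⟨b, hb, hba⟩ := hb
    have hleg : Leg G b v l := .step hb.symm hm.1.adj hba.symm
      (fun y hy => (eq_or_eq_of_ndeg_le (by omega) hm.1.adj hb hba.symm y hy).symm) hm.1
    have h1 := hmax (b, v) ⟨hleg, hm.2.trans hb.reachable⟩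
    have hcb : ¬ CyclicAt G b := by
      rwa [← CyclicAt.congr (hm.2.trans hb.reachable)]
    have h2 := (hleg.mem_branch hcb).2
    simp only at h1
    omega
  · push Not at hb
    obtain ⟨b, h1, h2, h3⟩ := hm.1.reverse (.leaf hm.1.adj.symm hb)
    exact hn ⟨b, _, h3⟩

/-- Two pendant directions at a vertex cannot both be missed by a resolving set. -/
lemma Resolves.branch_inter {R : Set V} (hR : Resolves G R) {v a b : V} (hv : ¬ CyclicAt G v)
    (ha : G.Adj v a) (hb : G.Adj v b) (hab : a ≠ b) :
    (∃ r ∈ R, r ∈ branch G v a) ∨ ∃ r ∈ R, r ∈ branch G v b := by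
  by_contra! hcon
  obtain ⟨r, hr, hne⟩ := hR a b hab
  by_cases hrv : G.Reachable r v
  · have h1 := (dist_succ_cases hv ha hrv).resolve_left (hcon.1 r hr)
    have h2 := (dist_succ_cases hv hb hrv).resolve_left (hcon.2 r hr)
    have hra : G.Reachable a r := ha.symm.reachable.trans hrv.symm
    have hrb : G.Reachable b r := hb.symm.reachable.trans hrv.symm
    rw [← hra.coe_dist_eq_edist, ← hrb.coe_dist_eq_edist, SimpleGraph.dist_comm (u := a),
      SimpleGraph.dist_comm (u := b), h1.2, h2.2] at hne
    exact hne rfl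
  · rw [SimpleGraph.edist_eq_top_of_not_reachable fun h => hrv (h.symm.trans ha.symm.reachable),
      SimpleGraph.edist_eq_top_of_not_reachable fun h => hrv (h.symm.trans hb.symm.reachable)] at hne
    exact hne rfl

lemma Resolves.exists_reachable {R : Set V} (hR : Resolves G R) {v a : V} (ha : G.Adj v a) :
    ∃ r ∈ R, G.Reachable v r := by
  obtain ⟨r, hr, hne⟩ := hR v a ha.ne
  refine ⟨r, hr, ?_⟩
  by_contra h
  rw [SimpleGraph.edist_eq_top_of_not_reachable h,
    SimpleGraph.edist_eq_top_of_not_reachable fun h' => h (ha.reachable.trans h')] at hne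
  exact hne rfl

variable (G)

/-- The isolated vertices of `G`. -/
def isolatedVerts : Finset V := Finset.univ.filter fun v => ndeg G v = 0

/-- The leaves of the tree components of `G`. -/
def treeLeaves : Finset V := Finset.univ.filter fun v => ¬ CyclicAt G v ∧ ndeg G v = 1

/-- The leaves of the path components of `G`. -/
def pathLeaves : Finset V :=
  Finset.univ.filter fun v => ¬ CyclicAt G v ∧ ndeg G v = 1 ∧ HasLeg G v

/-- The leaves of the tree components of `G` which are not paths. -/
def properLeaves : Finset V :=
  Finset.univ.filter fun v => ¬ CyclicAt G v ∧ ndeg G v = 1 ∧ ¬ HasLeg G v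

/-- The branching vertices of the tree components of `G` at which some leg starts. -/
def branchVerts : Finset V :=
  Finset.univ.filter fun v => ¬ CyclicAt G v ∧ 3 ≤ ndeg G v ∧ HasLeg G v

/-- The vertices of `G` lying in a component which contains a cycle. -/
def cyclicVerts : Finset V := Finset.univ.filter fun v => CyclicAt G v

lemma card_treeLeaves : (treeLeaves G).card = (pathLeaves G).card + (properLeaves G).card := by
  rw [pathLeaves, properLeaves, ← Finset.card_union_of_disjoint]
  · congr 1
    ext v
    simp only [treeLeaves, Finset.mem_filter, Finset.mem_univ, true_and, Finset.mem_union]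
    tauto
  · rw [Finset.disjoint_filter]
    tauto

variable {G}

lemma Resolves.card_isolated_le {R : Finset V} (hR : Resolves G R) :
    (isolatedVerts G).card ≤ (R ∩ isolatedVerts G).card + 1 := by
  have h1 : (isolatedVerts G \ R).card ≤ 1 := by
    rw [Finset.card_le_one]
    intro u hu w hw
    simp only [isolatedVerts, Finset.mem_sdiff, Finset.mem_filter, Finset.mem_univ,
      true_and] at hu hw
    by_contra hne
    obtain ⟨r, hr, hne'⟩ := hR u w hne
    have key : ∀ {u : V}, ndeg G u = 0 ∧ u ∉ R → G.edist u r = ⊤ := by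
      intro u hu
      refine SimpleGraph.edist_eq_top_of_not_reachable fun h => hu.2 ?_
      rw [← eq_of_reachable_of_ndeg_eq_zero hu.1 h.symm]
      exact hr
    exact hne' (by rw [key hu, key hw])
  have h2 := Finset.card_inter_add_card_sdiff (isolatedVerts G) R
  rw [Finset.inter_comm] at h2
  omega

lemma Resolves.card_pathLeaves_le {R : Finset V} (hR : Resolves G R) :
    (pathLeaves G).card ≤
      2 * (R.filter fun x => ∃ l ∈ pathLeaves G, G.Reachable l x).card := by
  have h1 : ∀ l ∈ pathLeaves G, ∃ r ∈ R, G.Reachable l r := by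
    intro l hl
    simp only [pathLeaves, Finset.mem_filter, Finset.mem_univ, true_and] at hl
    obtain ⟨a, l', h⟩ := hl.2.2
    exact hR.exists_reachable h.adj
  choose! f hf using h1
  refine (Finset.card_le_mul_card_image (f := f) _ 2 ?_).trans
    (Nat.mul_le_mul_left 2 (Finset.card_le_card ?_))
  · intro r _
    rcases Finset.eq_empty_or_nonempty ((pathLeaves G).filter fun x => f x = r) with h | ⟨l, hl⟩
    · simp [h]
    · have hl' := hl
      simp only [pathLeaves, Finset.mem_filter, Finset.mem_univ, true_and] at hl'
      obtain ⟨l', hp⟩ := pathEnds_of_hasLeg hl'.1.2.2 hl'.1.2.1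
      refine (Finset.card_le_card (t := {l, l'}) fun x hx => ?_).trans Finset.card_le_two
      rw [Finset.mem_filter] at hx hl
      have hr : G.Reachable x l := by
        have h1 := (hf x hx.1).2
        have h2 := (hf l hl.1).2
        rw [hx.2] at h1
        rw [hl.2] at h2
        exact h1.trans h2.symm
      have hx1 := hx.1
      simp only [pathLeaves, Finset.mem_filter, Finset.mem_univ, true_and] at hx1
      simpa using hp.eq_or_eq hr hx1.2.1
  · intro r hr
    obtain ⟨l, hl, rfl⟩ := Finset.mem_image.1 hr
    exact Finset.mem_filter.2 ⟨(hf l hl).1, l, hl, (hf l hl).2⟩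

lemma Resolves.card_properLeaves_le {R : Finset V} (hR : Resolves G R) :
    (properLeaves G).card ≤
      (R.filter fun x => ∃ l ∈ properLeaves G, G.Reachable l x).card + (branchVerts G).card := by
  have h1 : ∀ l ∈ properLeaves G, ∃ v a, Leg G v a l ∧ 3 ≤ ndeg G v ∧ ¬ CyclicAt G v ∧
      G.Reachable l v := by
    intro l hl
    simp only [properLeaves, Finset.mem_filter, Finset.mem_univ, true_and] at hl
    obtain ⟨v, a, h, hd⟩ := exists_leg_start hl.1 hl.2.1 hl.2.2
    have hr := h.reachable.symm
    exact ⟨v, a, h, hd, by rw [← CyclicAt.congr hr]; exact hl.1, hr⟩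
  choose! v a hleg hdeg hcyc hreach using h1
  let N₁ := (properLeaves G).filter fun l => ∃ r ∈ R, r ∈ branch G (v l) (a l)
  let N₂ := (properLeaves G).filter fun l => ¬ ∃ r ∈ R, r ∈ branch G (v l) (a l)
  have hN : N₁.card + N₂.card = (properLeaves G).card :=
    Finset.card_filter_add_card_filter_not _
  have hN₂ : N₂.card ≤ (branchVerts G).card := by
    refine Finset.card_le_card_of_injOn v (fun l hl => ?_) ?_
    · have hl := (Finset.mem_filter.1 hl).1
      simpa [branchVerts] using ⟨hcyc l hl, hdeg l hl, ⟨_, _, hleg l hl⟩⟩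
    · intro l hl l' hl' hv
      obtain ⟨hl, h⟩ := Finset.mem_filter.1 hl
      obtain ⟨hl', h'⟩ := Finset.mem_filter.1 hl'
      have e1 := hleg l hl
      have e2 := hleg l' hl'
      by_cases ha : a l = a l'
      · rw [hv, ha] at e1
        exact e1.unique e2
      · rcases hR.branch_inter (hcyc l hl) e1.adj (hv ▸ e2.adj) ha with h3 | h3
        · exact absurd h3 h
        · rw [hv] at h3
          exact absurd h3 h'
  have hN₁ : N₁.card ≤ (R.filter fun x => ∃ l ∈ properLeaves G, G.Reachable l x).card := by
    have h2 : ∀ l ∈ N₁, ∃ r ∈ R, r ∈ branch G (v l) (a l) := fun l hl =>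
      (Finset.mem_filter.1 hl).2
    choose! f hfR hfb using h2
    refine Finset.card_le_card_of_injOn f (fun l hl => ?_) ?_
    · have hl' := (Finset.mem_filter.1 hl).1
      exact Finset.mem_filter.2 ⟨hfR l hl, l, hl', (hreach l hl').trans
        (branch_reachable (hleg l hl').adj (hfb l hl))⟩
    · intro l hl l' hl' hff
      have hl1 := (Finset.mem_filter.1 hl).1
      have hl1' := (Finset.mem_filter.1 hl').1
      obtain ⟨u, hu⟩ := (hleg l hl1).of_mem_branch (hfb l hl)
      obtain ⟨u', hu'⟩ := (hleg l' hl1').of_mem_branch (hfb l' hl')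
      rw [← hff] at hu'
      by_contra hne
      have := (hu.pathEnds_of_ne hu' hne).hasLeg
      simp only [properLeaves, Finset.mem_filter, Finset.mem_univ, true_and] at hl1
      exact hl1.2.2 this
  omega

/-- Lower bound for the size of a resolving set. -/
lemma Resolves.le_card {R : Finset V} (hR : Resolves G R) :
    2 * (isolatedVerts G).card + 2 * (treeLeaves G).card ≤
      2 * R.card + (pathLeaves G).card + 2 * (branchVerts G).card + 2 := by
  have h1 := hR.card_isolated_le
  have h2 := hR.card_pathLeaves_le
  have h3 := hR.card_properLeaves_le
  have h4 := card_treeLeaves G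
  set A := R ∩ isolatedVerts G with hA
  set B := R.filter fun x => ∃ l ∈ pathLeaves G, G.Reachable l x with hB
  set C := R.filter fun x => ∃ l ∈ properLeaves G, G.Reachable l x with hC
  have hBC : Disjoint B C := by
    rw [Finset.disjoint_left]
    intro x hx hx'
    obtain ⟨-, l, hl, hlx⟩ := Finset.mem_filter.1 hx
    obtain ⟨-, l', hl', hlx'⟩ := Finset.mem_filter.1 hx'
    simp only [pathLeaves, properLeaves, Finset.mem_filter, Finset.mem_univ, true_and] at hl hl'
    obtain ⟨m, hp⟩ := pathEnds_of_hasLeg hl.2.2 hl.2.1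
    rcases hp.eq_or_eq (hlx'.trans hlx.symm) hl'.2.1 with rfl | rfl
    · exact hl'.2.2 hl.2.2
    · exact hl'.2.2 hp.symm.hasLeg
  have hABC : Disjoint A (B ∪ C) := by
    rw [Finset.disjoint_left]
    intro x hx hx'
    have hx := (Finset.mem_inter.1 hx).2
    simp only [isolatedVerts, Finset.mem_filter, Finset.mem_univ, true_and] at hx
    have : ∃ l, ndeg G l = 1 ∧ G.Reachable l x := by
      rcases Finset.mem_union.1 hx' with h | h
      · obtain ⟨-, l, hl, hlx⟩ := Finset.mem_filter.1 h
        simp only [pathLeaves, Finset.mem_filter, Finset.mem_univ, true_and] at hl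
        exact ⟨l, hl.2.1, hlx⟩
      · obtain ⟨-, l, hl, hlx⟩ := Finset.mem_filter.1 h
        simp only [properLeaves, Finset.mem_filter, Finset.mem_univ, true_and] at hl
        exact ⟨l, hl.2.1, hlx⟩
    obtain ⟨l, hl, hlx⟩ := this
    rw [eq_of_reachable_of_ndeg_eq_zero hx hlx] at hl
    omega
  have h5 : (A ∪ (B ∪ C)).card ≤ R.card := by
    refine Finset.card_le_card (Finset.union_subset Finset.inter_subset_left
      (Finset.union_subset (Finset.filter_subset _ _) (Finset.filter_subset _ _)))
  rw [Finset.card_union_of_disjoint hABC, Finset.card_union_of_disjoint hBC] at h5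
  omega

end Bounds

section UpperBound

variable {V : Type*} [Fintype V] {G : SimpleGraph V}

/-- Two vertices that a set of vertices `R` does not separate sit in branches avoiding `R`. -/
lemma exists_avoiding_branches {R : Set V} {r₀ : V} (hr₀ : r₀ ∈ R) (d : ℕ) :
    ∀ u w : V, G.dist u w = d → ¬ CyclicAt G u → G.Reachable u w → G.Reachable u r₀ → u ≠ w →
      (∀ r ∈ R, G.dist r u = G.dist r w) →
      ∃ m a b, G.Reachable u m ∧ G.Adj m a ∧ G.Adj m b ∧ a ≠ b ∧
        (∀ x ∈ branch G m a, x ∉ R) ∧ ∀ x ∈ branch G m b, x ∉ R := by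
  induction d using Nat.strong_induction_on with
  | _ d ih =>
    intro u w hd hu huw hur hne hR
    have hw : ¬ CyclicAt G w := by rwa [← CyclicAt.congr huw]
    have step : ∀ {u w : V}, ¬ CyclicAt G u → (∀ r ∈ R, G.dist r u = G.dist r w) → ∀ a,
        G.Adj u a → w ∈ branch G u a → ∀ r ∈ R, G.Reachable r u → r ∈ branch G u a := by
      intro u w hu hR a ha hwa r hr hru
      refine (dist_succ_cases hu ha hru).resolve_right fun h => ?_
      have h1 := dist_across (by rwa [← CyclicAt.congr ha.reachable]) ha.symm h hwa
      have := hR r hr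
      omega
    obtain ⟨u', hu', hwu'⟩ := exists_adj_mem_branch huw.symm hne.symm
    have hRu := step hu hR u' hu' hwu'
    have key : ∀ {u u' : V}, G.Adj u u' →
        (∀ r ∈ R, G.Reachable r u → r ∈ branch G u u') → ∀ x ∈ branch G u' u, x ∉ R :=
      fun had h x hx hxR => not_mem_both_branches (h x hxR hx.1) hx
    have hu'w : u' ≠ w := by
      rintro rfl
      have h1 := hRu _ hr₀ hur.symm
      have := hR _ hr₀
      have := h1.2
      omega
    obtain ⟨w', hw', hu'w'⟩ := exists_adj_mem_branch (hu'.symm.reachable.trans huw) hu'w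
    have hww' : G.dist u w = G.dist u' w' + 2 := by
      have := hu'w'.2
      have := hwu'.2
      rw [SimpleGraph.dist_comm (u := w), SimpleGraph.dist_comm (u := w)] at this
      omega
    have huw' : u ∈ branch G w w' := by
      refine ⟨huw.trans hw'.reachable, ?_⟩
      have h1 := hu'.reachable.dist_triangle_left w'
      rw [SimpleGraph.dist_eq_one_iff_adj.2 hu'] at h1
      have h2 := (hw'.symm.reachable).dist_triangle_right u
      rw [SimpleGraph.dist_eq_one_iff_adj.2 hw'.symm] at h2
      omega
    have hRw := step hw (fun r hr => (hR r hr).symm) w' hw' huw'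
    by_cases heq : u' = w'
    · subst heq
      exact ⟨u', u, w, hu'.reachable, hu'.symm, hw'.symm, hne, key hu' hRu, key hw' hRw⟩
    · obtain ⟨m, a, b, hm, h⟩ := ih (G.dist u' w') (by omega) u' w' rfl
        (by rwa [← CyclicAt.congr hu'.reachable]) (hu'.symm.reachable.trans (huw.trans hw'.reachable))
        (hu'.symm.reachable.trans hur) heq (fun r hr => by
          by_cases hru : G.Reachable r u
          · have h1 := (hRu r hr hru).2
            have h2 := (hRw r hr (hru.trans huw)).2
            have := hR r hr
            omega
          · rw [SimpleGraph.dist_eq_zero_of_not_reachable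
                fun h => hru (h.trans hu'.symm.reachable),
              SimpleGraph.dist_eq_zero_of_not_reachable
                fun h => hru (h.trans (hw'.symm.reachable.trans huw.symm))])
      exact ⟨m, a, b, hu'.reachable.trans hm, h⟩

/-- `R` contains one of the two ends of any two legs starting at a common branching vertex, and one
of the two ends of any path component. -/
def HitsLegs (G : SimpleGraph V) (R : Set V) : Prop :=
  (∀ m a b l l', ¬ CyclicAt G m → 3 ≤ ndeg G m → a ≠ b → Leg G m a l → Leg G m b l' →
    l ∈ R ∨ l' ∈ R) ∧
  ∀ l l', ¬ CyclicAt G l → PathEnds G l l' → l ∈ R ∨ l' ∈ R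

lemma HitsLegs.mem_or_mem {R : Set V} (hR : HitsLegs G R) {m a b l l' : V}
    (hm : ¬ CyclicAt G m) (hab : a ≠ b)
    (ha : Leg G m a l) (hb : Leg G m b l') : l ∈ R ∨ l' ∈ R := by
  by_cases hd : 3 ≤ ndeg G m
  · exact hR.1 m a b l l' hm hd hab ha hb
  · refine hR.2 l l' (by rwa [← CyclicAt.congr ha.reachable]) (ha.reverse
      (.step ha.adj.symm hb.adj hab.symm ?_ hb))
    exact eq_or_eq_of_ndeg_le (by omega) ha.adj hb.adj hab

lemma HitsLegs.exists_leg {R : Set V} (h : HitsLegs G R) (k : ℕ) : ∀ v a,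
    (branch G v a).ncard = k → ¬ CyclicAt G v →
    G.Adj v a → (∀ x ∈ branch G v a, x ∉ R) → ∃ l, Leg G v a l := by
  induction k using Nat.strong_induction_on with
  | _ k ih =>
    intro v a hk hv ha hR
    have hca : ¬ CyclicAt G a := by rwa [← CyclicAt.congr ha.reachable]
    have hsub : ∀ w, G.Adj a w → w ≠ v → ∃ l, Leg G a w l ∧ l ∉ R := by
      intro w hw hwv
      have hs := branch_subset hv ha hw hwv
      obtain ⟨l, hl⟩ := ih (branch G a w).ncard (hk ▸ Set.ncard_lt_ncard
        ⟨hs, fun h => not_mem_branch_tail (h (mem_branch_self ha))⟩) a w rfl hca hw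
        (fun x hx => hR x (hs hx))
      exact ⟨l, hl, hR l (hs (hl.mem_branch hca))⟩
    by_cases hw : ∃ w, G.Adj a w ∧ w ≠ v
    · obtain ⟨w, hw, hwv⟩ := hw
      obtain ⟨l, hl, hlR⟩ := hsub w hw hwv
      refine ⟨l, .step ha hw hwv (fun y hy => ?_) hl⟩
      by_contra! hne
      obtain ⟨l', hl', hlR'⟩ := hsub y hy hne.1
      exact (h.mem_or_mem hca hne.2 hl' hl).elim hlR' hlR
    · push Not at hw
      exact ⟨a, .leaf ha hw⟩

lemma HitsLegs.exists_mem_reachable {R : Set V} (h : HitsLegs G R) {v a : V}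
    (hv : ¬ CyclicAt G v) (ha : G.Adj v a) :
    ∃ r ∈ R, G.Reachable v r := by
  by_contra! hcon
  have hca : ¬ CyclicAt G a := by rwa [← CyclicAt.congr ha.reachable]
  obtain ⟨l, hl⟩ := h.exists_leg _ v a rfl hv ha
    fun x hx hxR => hcon x hxR (branch_reachable ha hx)
  obtain ⟨l', hl'⟩ := h.exists_leg _ a v rfl hca ha.symm
    fun x hx hxR => hcon x hxR hx.1.symm
  rcases h.2 l l' (by rwa [← CyclicAt.congr hl.reachable]) (hl.reverse hl') with h | h
  · exact hcon l h hl.reachable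
  · exact hcon l' h (ha.reachable.trans hl'.reachable)

lemma HitsLegs.resolves {R : Set V} (h : HitsLegs G R) (h₀ : ∀ v, CyclicAt G v → v ∈ R)
    (h₁ : ∀ v, ndeg G v = 0 → v ∈ R) :
    Resolves G R := by
  intro u w hne
  by_contra! hcon
  have huR : u ∉ R := fun h => hne <| by
    have := hcon u h
    rw [SimpleGraph.edist_self] at this
    exact (SimpleGraph.edist_eq_zero_iff.1 this.symm).symm
  have hu : ¬ CyclicAt G u := fun h => huR (h₀ u h)
  obtain ⟨a, ha⟩ := exists_adj_of_ndeg_ne_zero fun h => huR (h₁ u h)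
  obtain ⟨r, hr, hur⟩ := h.exists_mem_reachable hu ha
  have hwr : G.Reachable w r := by
    rw [← SimpleGraph.edist_ne_top_iff_reachable, ← hcon r hr,
      SimpleGraph.edist_ne_top_iff_reachable]
    exact hur
  obtain ⟨m, b, c, hm, hb, hc, hbc, hbR, hcR⟩ := exists_avoiding_branches hr _ u w rfl hu
    (hur.trans hwr.symm) hur hne fun x hx => by
      rw [SimpleGraph.dist_comm, SimpleGraph.dist_comm (v := w)]
      exact congrArg ENat.toNat (hcon x hx)
  have hcm : ¬ CyclicAt G m := by rwa [← CyclicAt.congr hm]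
  obtain ⟨l, hl⟩ := h.exists_leg _ m b rfl hcm hb hbR
  obtain ⟨l', hl'⟩ := h.exists_leg _ m c rfl hcm hc hcR
  exact (h.mem_or_mem hcm hbc hl hl').elim (hbR l (hl.mem_branch hcm))
    (hcR l' (hl'.mem_branch hcm))

lemma exists_small_resolving [LinearOrder V] (G : SimpleGraph V) :
    ∃ R : Finset V, Resolves G R ∧ 2 * R.card + (pathLeaves G).card + 2 * (branchVerts G).card ≤
      2 * (cyclicVerts G).card + 2 * (isolatedVerts G).card + 2 * (treeLeaves G).card := by
  have h1 : ∀ v ∈ branchVerts G, ∃ l a, Leg G v a l := by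
    intro v hv
    simp only [branchVerts, Finset.mem_filter, Finset.mem_univ, true_and] at hv
    obtain ⟨a, l, h⟩ := hv.2.2
    exact ⟨l, a, h⟩
  choose! s b hs using h1
  have hJ : ∀ v, v ∈ branchVerts G ↔ ¬ CyclicAt G v ∧ 3 ≤ ndeg G v ∧ HasLeg G v := fun v => by
    simp [branchVerts]
  have hinj : Set.InjOn s (branchVerts G) := by
    intro v hv v' hv' h
    have h1 := hs v hv
    have h2 := hs v' hv'
    rw [← h] at h2
    have hv := (hJ v).1 hv
    have hv' := (hJ v').1 hv'
    exact h1.start_unique (by rw [← CyclicAt.congr h1.reachable]; exact hv.1) h2 hv.2.1 hv'.2.1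
  have hproper : ∀ {v a l}, ¬ CyclicAt G v → 3 ≤ ndeg G v → Leg G v a l → l ∈ properLeaves G := by
    intro v a l hv hd h
    have hd1 : ndeg G l = 1 := by
      obtain ⟨b, h1, h2⟩ := h.end_leaf
      exact ndeg_eq_one_of h1 h2
    simp only [properLeaves, Finset.mem_filter, Finset.mem_univ, true_and]
    refine ⟨by rwa [← CyclicAt.congr h.reachable], hd1, fun hl => ?_⟩
    obtain ⟨l', hp⟩ := pathEnds_of_hasLeg hl hd1
    have := hp.ndeg_le h.reachable
    omega
  set N := properLeaves G \ (branchVerts G).image s with hN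
  have hNcard : N.card + (branchVerts G).card = (properLeaves G).card := by
    rw [← Finset.card_image_of_injOn hinj, hN]
    refine Finset.card_sdiff_add_card_eq_card fun l hl => ?_
    obtain ⟨v, hv, rfl⟩ := Finset.mem_image.1 hl
    exact hproper ((hJ v).1 hv).1 ((hJ v).1 hv).2.1 (hs v hv)
  set P := (pathLeaves G).filter fun l => ∃ l', PathEnds G l l' ∧ l < l' with hP
  have hPcard : 2 * P.card ≤ (pathLeaves G).card := by
    have h1 : P.card + _ = (pathLeaves G).card := Finset.card_filter_add_card_filter_not _
    have h2 : ∀ l ∈ P, ∃ l', PathEnds G l l' ∧ l < l' := fun l hl => (Finset.mem_filter.1 hl).2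
    choose! f hf using h2
    have h3 : P.card ≤ ((pathLeaves G).filter fun l => ¬ ∃ l', PathEnds G l l' ∧ l < l').card := by
      refine Finset.card_le_card_of_injOn f (fun l hl => ?_) fun l hl l' hl' hff => ?_
      · have hp := (hf l hl).1
        have hl' := (Finset.mem_filter.1 hl).1
        refine Finset.mem_filter.2 ⟨?_, fun ⟨l', hl', hlt⟩ => ?_⟩
        · simp only [pathLeaves, Finset.mem_filter, Finset.mem_univ, true_and] at hl' ⊢
          exact ⟨by rw [← CyclicAt.congr hp.reachable]; exact hl'.1, hp.symm.ndeg_left,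
            hp.symm.hasLeg⟩
        · rw [hl'.unique hp.symm] at hlt
          exact absurd hlt (hf l hl).2.not_gt
      · have h4 := (hf l hl).1.symm
        rw [hff] at h4
        exact h4.unique (hf l' hl').1.symm
    omega
  refine ⟨cyclicVerts G ∪ (isolatedVerts G ∪ (N ∪ P)), ?_, ?_⟩
  · refine HitsLegs.resolves ⟨?_, ?_⟩ ?_ ?_
    · intro m a c l l' hm hd hac hl hl'
      have h4 : ∀ {a l}, Leg G m a l → l ∉ N → a = b m := by
        intro a l hl hlN
        have h5 : l ∈ (branchVerts G).image s := by
          by_contra h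
          exact hlN (Finset.mem_sdiff.2 ⟨hproper hm hd hl, h⟩)
        obtain ⟨v, hv, rfl⟩ := Finset.mem_image.1 h5
        have hv' := (hJ v).1 hv
        obtain rfl := hl.start_unique (by rwa [← CyclicAt.congr hl.reachable]) (hs v hv) hd hv'.2.1
        by_contra hne
        exact branch_disjoint hm hl.adj (hs m hv).adj hne (hl.mem_branch hm)
          ((hs m hv).mem_branch hm)
      by_contra! hcon
      simp only [Finset.coe_union, Set.mem_union, Finset.mem_coe, not_or] at hcon
      exact hac ((h4 hl hcon.1.2.2.1).trans (h4 hl' hcon.2.2.2.1).symm)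
    · intro l l' hl hp
      have h4 : ∀ {l l'}, ¬ CyclicAt G l → PathEnds G l l' → l < l' → l ∈ P := by
        intro l l' hl hp hlt
        refine Finset.mem_filter.2 ⟨?_, l', hp, hlt⟩
        simpa [pathLeaves] using ⟨hl, hp.ndeg_left, hp.hasLeg⟩
      simp only [Finset.coe_union, Set.mem_union, Finset.mem_coe]
      rcases lt_or_gt_of_ne (hp.ne hl) with h | h
      · exact .inl (.inr (.inr (.inr (h4 hl hp h))))
      · exact .inr (.inr (.inr (.inr (h4 (by rwa [← CyclicAt.congr hp.reachable]) hp.symm h))))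
    · intro v hv
      simp [cyclicVerts, hv]
    · intro v hv
      simp [isolatedVerts, hv]
  · have h5 := Finset.card_union_le (cyclicVerts G) (isolatedVerts G ∪ (N ∪ P))
    have h6 := Finset.card_union_le (isolatedVerts G) (N ∪ P)
    have h7 := Finset.card_union_le N P
    have h8 := card_treeLeaves G
    omega

/-- The metric dimension is a sum of local contributions, up to the cyclic components. -/
lemma metricDim_bounds [LinearOrder V] (G : SimpleGraph V) (hV : Nat.card V ≠ 1) :
    2 * (isolatedVerts G).card + 2 * (treeLeaves G).card ≤
        2 * metricDim G + (pathLeaves G).card + 2 * (branchVerts G).card + 2 ∧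
      2 * metricDim G + (pathLeaves G).card + 2 * (branchVerts G).card ≤
      2 * (cyclicVerts G).card + 2 * (isolatedVerts G).card + 2 * (treeLeaves G).card := by
  obtain ⟨R, hR, hle⟩ := exists_small_resolving G
  have hmem : R.card ∈ {m : ℕ | ∃ R : Set V, R.ncard = m ∧ Resolves G R} :=
    ⟨R, Set.ncard_coe_finset R, hR⟩
  have hdim : metricDim G = sInf {m : ℕ | ∃ R : Set V, R.ncard = m ∧ Resolves G R} := by
    rw [metricDim, if_neg hV]
  constructor
  · obtain ⟨S, hS, hSR⟩ := Nat.sInf_mem ⟨_, hmem⟩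
    rw [← hdim, Set.ncard_eq_toFinset_card'] at hS
    rw [← hS]
    exact Resolves.le_card (by simpa using hSR)
  · have := Nat.sInf_le hmem
    rw [← hdim] at this
    omega

end UpperBound

section ErdosRenyi

variable {n : ℕ} {p : ℝ}

lemma erExp_eq_sum (f : SimpleGraph (Fin n) → ℝ) :
    erExp n p f = ∑ G, erWeight n p G * f G := finsum_eq_sum_of_fintype _

lemma erWeight_nonneg (hp₀ : 0 ≤ p) (hp₁ : p ≤ 1) (G : SimpleGraph (Fin n)) :
    0 ≤ erWeight n p G :=
  mul_nonneg (pow_nonneg hp₀ _) (pow_nonneg (by linarith) _)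

lemma erExp_mono (hp₀ : 0 ≤ p) (hp₁ : p ≤ 1) {f g : SimpleGraph (Fin n) → ℝ}
    (h : ∀ G, f G ≤ g G) : erExp n p f ≤ erExp n p g := by
  simp only [erExp_eq_sum]
  exact Finset.sum_le_sum fun G _ => mul_le_mul_of_nonneg_left (h G) (erWeight_nonneg hp₀ hp₁ G)

lemma erExp_add (f g : SimpleGraph (Fin n) → ℝ) :
    erExp n p (fun G => f G + g G) = erExp n p f + erExp n p g := by
  simp only [erExp_eq_sum, mul_add, Finset.sum_add_distrib]

lemma erExp_const_mul (r : ℝ) (f : SimpleGraph (Fin n) → ℝ) :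
    erExp n p (fun G => r * f G) = r * erExp n p f := by
  simp only [erExp_eq_sum, Finset.mul_sum]
  exact Finset.sum_congr rfl fun G _ => by ring

lemma erExp_sum {ι : Type*} (s : Finset ι) (f : ι → SimpleGraph (Fin n) → ℝ) :
    erExp n p (fun G => ∑ i ∈ s, f i G) = ∑ i ∈ s, erExp n p (f i) := by
  simp only [erExp_eq_sum, Finset.mul_sum]
  exact Finset.sum_comm

lemma card_edgeSet (G : SimpleGraph (Fin n)) : Nat.card G.edgeSet = G.edgeFinset.card := by
  rw [Nat.card_eq_fintype_card, SimpleGraph.edgeFinset_card]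

lemma card_edgeSet_le (G : SimpleGraph (Fin n)) : Nat.card G.edgeSet ≤ n.choose 2 := by
  rw [card_edgeSet]
  simpa using G.card_edgeFinset_le_card_choose_two

/-- The probability of the event `P` in the Erdős–Rényi model `G(n,p)`. -/
def prob (p : ℝ) (P : SimpleGraph (Fin n) → Prop) : ℝ :=
  erExp n p fun G => if P G then 1 else 0

lemma prob_eq_sum (P : SimpleGraph (Fin n) → Prop) :
    prob p P = ∑ G with P G, erWeight n p G := by
  rw [prob, erExp_eq_sum, Finset.sum_filter]
  exact Finset.sum_congr rfl fun G _ => by split_ifs <;> simp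

lemma erExp_one : erExp n p (fun _ => 1) = 1 := by
  have key := Finset.sum_pow_mul_eq_add_pow p (1 - p) (⊤ : SimpleGraph (Fin n)).edgeFinset
  have hc : (⊤ : SimpleGraph (Fin n)).edgeFinset.card = n.choose 2 := by
    simpa using SimpleGraph.card_edgeFinset_top_eq_card_choose_two (V := Fin n)
  rw [erExp_eq_sum]
  simp only [mul_one]
  rw [hc, add_sub_cancel, one_pow] at key
  rw [← key]
  refine Finset.sum_bij' (fun G _ => G.edgeFinset)
    (fun s _ => SimpleGraph.fromEdgeSet (s : Set (Sym2 (Fin n)))) ?_ ?_ ?_ ?_ ?_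
  · intro G _
    rw [Finset.mem_powerset]
    exact SimpleGraph.edgeFinset_mono le_top
  · simp
  · intro G _
    simp
  · intro s hs
    rw [Finset.mem_powerset] at hs
    ext e
    have : e ∈ s → ¬ e.IsDiag := fun he => by
      have := hs he
      simpa using this
    simp [SimpleGraph.mem_edgeFinset, SimpleGraph.edgeSet_fromEdgeSet]
    simpa using this
  · intro G _
    rw [erWeight, card_edgeSet]

lemma prob_congr {P Q : SimpleGraph (Fin n) → Prop} (h : ∀ G, P G ↔ Q G) : prob p P = prob p Q := by
  congr 1; ext G; exact h G

lemma prob_nonneg (hp₀ : 0 ≤ p) (hp₁ : p ≤ 1) (P : SimpleGraph (Fin n) → Prop) : 0 ≤ prob p P := by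
  rw [prob_eq_sum]
  exact Finset.sum_nonneg fun G _ => erWeight_nonneg hp₀ hp₁ G

lemma prob_mono (hp₀ : 0 ≤ p) (hp₁ : p ≤ 1) {P Q : SimpleGraph (Fin n) → Prop}
    (h : ∀ G, P G → Q G) : prob p P ≤ prob p Q := by
  refine erExp_mono hp₀ hp₁ fun G => ?_
  have := h G
  split_ifs <;> simp_all

lemma prob_true : prob (n := n) p (fun _ => True) = 1 := by
  simp [prob, erExp_one]

lemma prob_or_le (hp₀ : 0 ≤ p) (hp₁ : p ≤ 1) (P Q : SimpleGraph (Fin n) → Prop) :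
    prob p (fun G => P G ∨ Q G) ≤ prob p P + prob p Q := by
  simp only [prob, ← erExp_add]
  refine erExp_mono hp₀ hp₁ fun G => ?_
  split_ifs <;> simp_all

lemma prob_exists_le (hp₀ : 0 ≤ p) (hp₁ : p ≤ 1) {ι : Type*} (s : Finset ι)
    (P : ι → SimpleGraph (Fin n) → Prop) :
    prob p (fun G => ∃ i ∈ s, P i G) ≤ ∑ i ∈ s, prob p (P i) := by
  simp only [prob, ← erExp_sum]
  refine erExp_mono hp₀ hp₁ fun G => ?_
  split_ifs with h
  · obtain ⟨i, hi, hP⟩ := h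
    refine le_trans ?_ (Finset.single_le_sum (f := fun i => if P i G then (1 : ℝ) else 0)
      (fun i _ => by split_ifs <;> simp) hi)
    simp [hP]
  · exact Finset.sum_nonneg fun i _ => by split_ifs <;> simp

lemma prob_exists_eq {ι : Type*} (s : Finset ι) (P : ι → SimpleGraph (Fin n) → Prop)
    (h : ∀ i ∈ s, ∀ j ∈ s, i ≠ j → ∀ G, P i G → ¬ P j G) :
    prob p (fun G => ∃ i ∈ s, P i G) = ∑ i ∈ s, prob p (P i) := by
  simp only [prob, ← erExp_sum]
  congr 1
  ext G
  split_ifs with h'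
  · obtain ⟨i, hi, hP⟩ := h'
    rw [Finset.sum_eq_single_of_mem i hi]
    · simp [hP]
    · intro j hj hji
      simp [h i hi j hj hji.symm G hP]
  · rw [Finset.sum_eq_zero]
    intro i hi
    rw [if_neg fun hP => h' ⟨i, hi, hP⟩]

lemma prob_add_not (P Q : SimpleGraph (Fin n) → Prop) :
    prob p (fun G => P G ∧ Q G) + prob p (fun G => P G ∧ ¬ Q G) = prob p P := by
  simp only [prob, ← erExp_add]
  congr 1
  ext G
  split_ifs <;> simp_all

lemma erWeight_insert {a x : Fin n} (hax : a ≠ x) {G : SimpleGraph (Fin n)} (h : ¬ G.Adj a x) :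
    (1 - p) * erWeight n p (G ⊔ SimpleGraph.edge a x) = p * erWeight n p G := by
  have hc : Nat.card (G ⊔ SimpleGraph.edge a x).edgeSet = Nat.card G.edgeSet + 1 := by
    rw [card_edgeSet, card_edgeSet]
    convert G.card_edgeFinset_sup_edge h hax
  have hle := card_edgeSet_le (G ⊔ SimpleGraph.edge a x)
  rw [erWeight, erWeight, hc]
  rw [hc] at hle
  obtain ⟨m, hm⟩ := Nat.exists_eq_add_of_le hle
  rw [show n.choose 2 - (Nat.card G.edgeSet + 1) = m by omega,
    show n.choose 2 - Nat.card G.edgeSet = m + 1 by omega]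
  ring

/-- The event `P` is determined by the pairs of vertices satisfying the relation `D`. -/
def DependsOn (D : Fin n → Fin n → Prop) (P : SimpleGraph (Fin n) → Prop) : Prop :=
  ∀ G G', (∀ u v, D u v → (G.Adj u v ↔ G'.Adj u v)) → P G → P G'

lemma DependsOn.mono {D D' : Fin n → Fin n → Prop} {P : SimpleGraph (Fin n) → Prop}
    (hP : DependsOn D P) (h : ∀ u v, D u v → D' u v) : DependsOn D' P :=
  fun G G' hG => hP G G' fun u v huv => hG u v (h u v huv)

lemma DependsOn.and {D : Fin n → Fin n → Prop} {P Q : SimpleGraph (Fin n) → Prop}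
    (hP : DependsOn D P) (hQ : DependsOn D Q) : DependsOn D fun G => P G ∧ Q G :=
  fun G G' hG h => ⟨hP G G' hG h.1, hQ G G' hG h.2⟩

lemma prob_and_adj {a x : Fin n} (hax : a ≠ x) {P : SimpleGraph (Fin n) → Prop}
    (hP : DependsOn (fun u v => s(u, v) ≠ s(a, x)) P) :
    prob p (fun G => P G ∧ G.Adj a x) = p * prob p P := by
  have hbij : ∑ G with P G ∧ G.Adj a x, (1 - p) * erWeight n p G =
      ∑ G with P G ∧ ¬ G.Adj a x, p * erWeight n p G := by
    symm
    have hsup : ∀ G : SimpleGraph (Fin n), ∀ u v, s(u, v) ≠ s(a, x) →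
        (G.Adj u v ↔ (G ⊔ SimpleGraph.edge a x).Adj u v) := by
      intro G u v huv
      simp only [SimpleGraph.sup_adj, SimpleGraph.edge_adj]
      simp only [ne_eq, Sym2.eq_iff] at huv
      tauto
    have hsd : ∀ G : SimpleGraph (Fin n), ∀ u v, s(u, v) ≠ s(a, x) →
        (G.Adj u v ↔ (G \ SimpleGraph.edge a x).Adj u v) := by
      intro G u v huv
      simp only [SimpleGraph.sdiff_adj, SimpleGraph.edge_adj]
      simp only [ne_eq, Sym2.eq_iff] at huv
      tauto
    refine Finset.sum_bij' (fun G _ => G ⊔ SimpleGraph.edge a x)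
      (fun G _ => G \ SimpleGraph.edge a x) ?_ ?_ ?_ ?_ ?_
    · intro G hG
      simp only [Finset.mem_filter, Finset.mem_univ, true_and] at hG ⊢
      refine ⟨hP G _ (hsup G) hG.1, ?_⟩
      simp [SimpleGraph.edge_adj, hax]
    · intro G hG
      simp only [Finset.mem_filter, Finset.mem_univ, true_and] at hG ⊢
      refine ⟨hP G _ (hsd G) hG.1, ?_⟩
      simp [SimpleGraph.edge_adj, hax]
    · intro G hG
      simp only [Finset.mem_filter, Finset.mem_univ, true_and] at hG
      have h1 := hG.2
      have h2 := fun h => h1 (G.adj_symm h)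
      ext u v
      simp only [SimpleGraph.sdiff_adj, SimpleGraph.sup_adj, SimpleGraph.edge_adj]
      constructor
      · tauto
      · intro h
        refine ⟨.inl h, ?_⟩
        rintro ⟨⟨rfl, rfl⟩ | ⟨rfl, rfl⟩, -⟩ <;> contradiction
    · intro G hG
      simp only [Finset.mem_filter, Finset.mem_univ, true_and] at hG
      ext u v
      simp only [SimpleGraph.sdiff_adj, SimpleGraph.sup_adj, SimpleGraph.edge_adj]
      constructor
      · rintro (h | ⟨⟨rfl, rfl⟩ | ⟨rfl, rfl⟩, -⟩)
        exacts [h.1, hG.2, hG.2.symm]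
      · intro h
        have := h.ne
        tauto
    · intro G hG
      simp only [Finset.mem_filter, Finset.mem_univ, true_and] at hG
      exact (erWeight_insert hax hG.2).symm
  have hadd := prob_add_not (p := p) P (fun G => G.Adj a x)
  have h1 : prob p (fun G => P G ∧ G.Adj a x) = ∑ G with P G ∧ G.Adj a x, erWeight n p G := by
    rw [prob_eq_sum]; congr!
  have h2 : prob p (fun G => P G ∧ ¬ G.Adj a x) =
      ∑ G with P G ∧ ¬ G.Adj a x, erWeight n p G := by
    rw [prob_eq_sum]; congr!
  rw [← Finset.mul_sum, ← Finset.mul_sum, ← h1, ← h2] at hbij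
  rw [← hadd]
  linarith

lemma prob_and_not_adj {a x : Fin n} (hax : a ≠ x) {P : SimpleGraph (Fin n) → Prop}
    (hP : DependsOn (fun u v => s(u, v) ≠ s(a, x)) P) :
    prob p (fun G => P G ∧ ¬ G.Adj a x) = (1 - p) * prob p P := by
  have h := prob_add_not (p := p) P (fun G => G.Adj a x)
  rw [prob_and_adj hax hP] at h
  linarith

lemma prob_and_star {a : Fin n} {P : SimpleGraph (Fin n) → Prop}
    (hP : DependsOn (fun u v => u ≠ a ∧ v ≠ a) P) (X T : Finset (Fin n)) (ha : a ∉ X) :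
    prob p (fun G => P G ∧ ∀ y ∈ X, G.Adj a y ↔ y ∈ T) =
      p ^ (X ∩ T).card * (1 - p) ^ (X \ T).card * prob p P := by
  induction X using Finset.induction_on with
  | empty => simp
  | insert x X hx ih =>
    have hax : a ≠ x := fun h => ha (h ▸ Finset.mem_insert_self _ _)
    have haX : a ∉ X := fun h => ha (Finset.mem_insert_of_mem h)
    have hQ : DependsOn (fun u v => s(u, v) ≠ s(a, x))
        fun G => P G ∧ ∀ y ∈ X, G.Adj a y ↔ y ∈ T := by
      refine (hP.mono ?_).and ?_
      · rintro u v ⟨hu, hv⟩ h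
        rcases Sym2.eq_iff.1 h with h | h
        · exact hu h.1
        · exact hv h.2
      · intro G G' h h' y hy
        rw [← h, h' y hy]
        intro h
        rcases Sym2.eq_iff.1 h with h | h
        · exact hx (h.2 ▸ hy)
        · exact hax h.1
    by_cases hxT : x ∈ T
    · rw [prob_congr (Q := fun G => (P G ∧ ∀ y ∈ X, G.Adj a y ↔ y ∈ T) ∧ G.Adj a x),
        prob_and_adj hax hQ, ih haX, Finset.insert_inter_of_mem hxT,
        Finset.insert_sdiff_of_mem _ hxT, Finset.card_insert_of_notMem (by simp [hx])]
      · ring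
      · intro G
        simp [hxT]
        tauto
    · rw [prob_congr (Q := fun G => (P G ∧ ∀ y ∈ X, G.Adj a y ↔ y ∈ T) ∧ ¬ G.Adj a x),
        prob_and_not_adj hax hQ, ih haX, Finset.insert_inter_of_notMem hxT,
        Finset.insert_sdiff_of_notMem _ hxT, Finset.card_insert_of_notMem (by simp [hx])]
      · ring
      · intro G
        simp [hxT]
        tauto

end ErdosRenyi

/-- The spanning subgraph of `G` consisting of the edges inside `X`. -/
def restr {V : Type*} (G : SimpleGraph V) (X : Finset V) : SimpleGraph V where
  Adj u v := u ∈ X ∧ v ∈ X ∧ G.Adj u v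
  symm := ⟨fun _ _ h => ⟨h.2.1, h.1, h.2.2.symm⟩⟩
  loopless := ⟨fun _ h => h.2.2.ne rfl⟩

lemma restr_univ {V : Type*} [Fintype V] {G : SimpleGraph V} : restr G Finset.univ = G := by
  ext u v
  simp [restr]

section Restriction

variable {V : Type*} [DecidableEq V] {G : SimpleGraph V}

lemma edge_mem_restr_erase {X : Finset V} {a u v : V} (q : (restr G X).Walk u v)
    (ha : a ∉ q.support) : ∀ e ∈ q.edges, e ∈ (restr G (X.erase a)).edgeSet := by
  intro e he
  induction e using Sym2.ind with
  | _ y z =>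
    have h := q.adj_of_mem_edges he
    have hy : y ≠ a := fun h => ha (h ▸ q.fst_mem_support_of_mem_edges he)
    have hz : z ≠ a := fun h => ha (h ▸ q.snd_mem_support_of_mem_edges he)
    exact ⟨Finset.mem_erase.2 ⟨hy, h.1⟩, Finset.mem_erase.2 ⟨hz, h.2.1⟩, h.2.2⟩

lemma exists_adj_reachable_restr {X : Finset V} {w x : V} (h : (restr G X).Reachable w x)
    (hwx : w ≠ x) :
    ∃ y ∈ X.erase w, G.Adj w y ∧ (restr G (X.erase w)).Reachable y x := by
  obtain ⟨q, hq⟩ := h.exists_isPath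
  cases q with
  | nil => exact absurd rfl hwx
  | @cons _ y _ hy r =>
    rw [SimpleGraph.Walk.cons_isPath_iff] at hq
    exact ⟨y, Finset.mem_erase.2 ⟨hy.2.2.ne', hy.2.1⟩, hy.2.2,
      ⟨r.transfer _ (edge_mem_restr_erase r hq.2)⟩⟩

lemma CyclicAt.restr_cases {X : Finset V} {a : V} (h : CyclicAt (restr G X) a) :
    (∃ w ∈ X.erase a, ∃ x ∈ (X.erase a).erase w, G.Adj a w ∧ G.Adj a x ∧
      (restr G (X.erase a)).Reachable w x) ∨
    ∃ w ∈ X.erase a, G.Adj a w ∧ CyclicAt (restr G (X.erase a)) w := by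
  obtain ⟨y, c, hy, hc⟩ := h
  by_cases ha : a ∈ c.support
  · left
    obtain ⟨d, hd⟩ : ∃ d : (restr G X).Walk a a, d.IsCycle := ⟨_, hc.rotate ha⟩
    cases d with
    | nil => exact absurd rfl hd.ne_nil
    | @cons _ w _ hw q =>
      rw [SimpleGraph.Walk.cons_isCycle_iff] at hd
      obtain ⟨r, hr⟩ : ∃ r, r = q.reverse := ⟨_, rfl⟩
      have hrp : r.IsPath := hr ▸ hd.1.reverse
      have hre : s(a, w) ∉ r.edges := by simpa [hr] using hd.2
      cases r with
      | nil => exact absurd rfl hw.2.2.ne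
      | @cons _ x _ hx r' =>
        rw [SimpleGraph.Walk.cons_isPath_iff] at hrp
        have hxw : x ≠ w := by
          rintro rfl
          simp at hre
        exact ⟨w, Finset.mem_erase.2 ⟨hw.2.2.ne', hw.2.1⟩, x,
          Finset.mem_erase.2 ⟨hxw, Finset.mem_erase.2 ⟨hx.2.2.ne', hx.2.1⟩⟩, hw.2.2, hx.2.2,
          ⟨(r'.transfer _ (edge_mem_restr_erase r' hrp.2)).reverse⟩⟩
  · right
    have hay : a ≠ y := by
      rintro rfl
      exact ha c.start_mem_support
    obtain ⟨w, hw, haw, hr⟩ := exists_adj_reachable_restr hy hay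
    exact ⟨w, hw, haw, y, _, hr, hc.transfer (edge_mem_restr_erase c ha)⟩

end Restriction

section ErdosRenyi

variable {n : ℕ} {p c : ℝ}

lemma restr_congr {X : Finset (Fin n)} {G G' : SimpleGraph (Fin n)}
    (h : ∀ u v, u ∈ X ∧ v ∈ X → (G.Adj u v ↔ G'.Adj u v)) : restr G X = restr G' X := by
  ext u v
  simp only [restr]
  have := h u v
  tauto

lemma dependsOn_restr (X : Finset (Fin n)) (P : SimpleGraph (Fin n) → Prop) :
    DependsOn (fun u v => u ∈ X ∧ v ∈ X) fun G => P (restr G X) := by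
  intro G G' h hP
  rwa [← restr_congr h]

lemma DependsOn.of_notMem {X : Finset (Fin n)} {a x : Fin n} (ha : a ∉ X)
    {P : SimpleGraph (Fin n) → Prop} (hP : DependsOn (fun u v => u ∈ X ∧ v ∈ X) P) :
    DependsOn (fun u v => s(u, v) ≠ s(a, x)) P := by
  refine hP.mono fun u v huv h => ?_
  rcases Sym2.eq_iff.1 h with h | h
  · exact ha (h.1 ▸ huv.1)
  · exact ha (h.2 ▸ huv.2)

lemma sum_le_of_card_mul_le (hc : n * p ≤ c) {M : ℝ} (hM : 0 ≤ M) (s : Finset (Fin n))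
    (f : Fin n → ℝ) (hp₀ : 0 ≤ p) (hf : ∀ i ∈ s, f i ≤ p * M) : ∑ i ∈ s, f i ≤ c * M := by
  calc ∑ i ∈ s, f i ≤ ∑ i ∈ s, p * M := Finset.sum_le_sum hf
    _ = s.card * (p * M) := by simp
    _ ≤ n * (p * M) := by
        have : (s.card : ℝ) ≤ n := by
          exact_mod_cast (Finset.card_le_univ s).trans (by simp)
        exact mul_le_mul_of_nonneg_right this (mul_nonneg hp₀ hM)
    _ = (n * p) * M := by ring
    _ ≤ c * M := mul_le_mul_of_nonneg_right hc hM

lemma prob_reachable_le (hp₀ : 0 ≤ p) (hp₁ : p ≤ 1) (hc₁ : c < 1) (hc : n * p ≤ c)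
    (X : Finset (Fin n)) :
    ∀ w x, w ≠ x → prob p (fun G => (restr G X).Reachable w x) ≤ p / (1 - c) := by
  induction X using Finset.strongInduction with
  | H X ih =>
    intro w x hwx
    have hcc : 0 < 1 - c := by linarith
    by_cases hw : w ∈ X
    · have hsum : ∑ y ∈ (X.erase w).erase x,
          prob p (fun G => (restr G (X.erase w)).Reachable y x ∧ G.Adj w y) ≤
            c * (p / (1 - c)) := by
        refine sum_le_of_card_mul_le hc (by positivity) _ _ hp₀ fun y hy => ?_
        have hy := Finset.mem_erase.1 hy
        rw [prob_and_adj (Finset.ne_of_mem_erase hy.2).symm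
          ((dependsOn_restr (X.erase w) fun H => H.Reachable y x).of_notMem (by simp))]
        exact mul_le_mul_of_nonneg_left (ih _ (Finset.erase_ssubset hw) y x hy.1) hp₀
      have hadj : prob p (fun G : SimpleGraph (Fin n) => G.Adj w x) = p := by
        have := prob_and_adj (p := p) hwx (P := fun _ : SimpleGraph (Fin n) => True)
          (fun _ _ _ h => h)
        rwa [prob_true, mul_one, prob_congr (Q := fun G => G.Adj w x) (by simp)] at this
      calc prob p (fun G => (restr G X).Reachable w x)
          ≤ prob p (fun G => G.Adj w x ∨ ∃ y ∈ (X.erase w).erase x,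
              (restr G (X.erase w)).Reachable y x ∧ G.Adj w y) := by
            refine prob_mono hp₀ hp₁ fun G hG => ?_
            obtain ⟨y, hy, hwy, hr⟩ := exists_adj_reachable_restr hG hwx
            by_cases hyx : y = x
            · exact .inl (hyx ▸ hwy)
            · exact .inr ⟨y, Finset.mem_erase.2 ⟨hyx, hy⟩, hr, hwy⟩
        _ ≤ p + c * (p / (1 - c)) :=
            (prob_or_le hp₀ hp₁ _ _).trans
              (add_le_add hadj.le ((prob_exists_le hp₀ hp₁ _ _).trans hsum))
        _ = p / (1 - c) := by field_simp; ring
    · have : prob p (fun G => (restr G X).Reachable w x) ≤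
          prob p (fun _ : SimpleGraph (Fin n) => False) := by
        refine prob_mono hp₀ hp₁ fun G hG => hw ?_
        obtain ⟨q⟩ := hG
        cases q with
        | nil => exact absurd rfl hwx
        | cons h _ => exact h.1
      refine this.trans ?_
      simp only [prob_eq_sum, Finset.filter_false, Finset.sum_empty]
      positivity

lemma prob_cyclicAt_restr_le (hp₀ : 0 ≤ p) (hp₁ : p ≤ 1) (hc₀ : 0 ≤ c) (hc₁ : c < 1)
    (hc : n * p ≤ c) (X : Finset (Fin n)) :
    ∀ a ∈ X, prob p (fun G => CyclicAt (restr G X) a) ≤ c ^ 2 * p / (1 - c) ^ 2 := by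
  induction X using Finset.strongInduction with
  | H X ih =>
    intro a ha
    have hcc : 0 < 1 - c := by linarith
    have hna : a ∉ X.erase a := by simp
    have h1 : ∑ w ∈ X.erase a, ∑ x ∈ (X.erase a).erase w,
        prob p (fun G => ((restr G (X.erase a)).Reachable w x ∧ G.Adj a w) ∧ G.Adj a x) ≤
          c * (c * (p / (1 - c))) := by
      refine sum_le_of_card_mul_le hc (by positivity) _ _ hp₀ fun w hw => ?_
      rw [mul_left_comm]
      refine sum_le_of_card_mul_le hc (by positivity) _ _ hp₀ fun x hx => ?_
      have hx := Finset.mem_erase.1 hx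
      have hD := dependsOn_restr (X.erase a) fun H => H.Reachable w x
      rw [prob_and_adj (Finset.ne_of_mem_erase hx.2).symm, prob_and_adj
        (Finset.ne_of_mem_erase hw).symm (hD.of_notMem hna)]
      · exact mul_le_mul_of_nonneg_left (mul_le_mul_of_nonneg_left
          (prob_reachable_le hp₀ hp₁ hc₁ hc _ w x hx.1.symm) hp₀) hp₀
      · refine (hD.of_notMem hna).and fun G G' h h' => (h a w ?_).1 h'
        have := Finset.ne_of_mem_erase hw
        simp [hx.1.symm, this]
    have h2 : ∑ w ∈ X.erase a,
        prob p (fun G => CyclicAt (restr G (X.erase a)) w ∧ G.Adj a w) ≤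
          c * (c ^ 2 * p / (1 - c) ^ 2) := by
      refine sum_le_of_card_mul_le hc (by positivity) _ _ hp₀ fun w hw => ?_
      rw [prob_and_adj (Finset.ne_of_mem_erase hw).symm
        ((dependsOn_restr (X.erase a) fun H => CyclicAt H w).of_notMem hna)]
      exact mul_le_mul_of_nonneg_left (ih _ (Finset.erase_ssubset ha) w hw) hp₀
    calc prob p (fun G => CyclicAt (restr G X) a)
        ≤ prob p (fun G => (∃ w ∈ X.erase a, ∃ x ∈ (X.erase a).erase w,
            ((restr G (X.erase a)).Reachable w x ∧ G.Adj a w) ∧ G.Adj a x) ∨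
            ∃ w ∈ X.erase a, CyclicAt (restr G (X.erase a)) w ∧ G.Adj a w) := by
          refine prob_mono hp₀ hp₁ fun G hG => ?_
          rcases hG.restr_cases with ⟨w, hw, x, hx, h, h', hr⟩ | ⟨w, hw, h, hr⟩
          · exact .inl ⟨w, hw, x, hx, ⟨hr, h⟩, h'⟩
          · exact .inr ⟨w, hw, hr, h⟩
      _ ≤ c * (c * (p / (1 - c))) + c * (c ^ 2 * p / (1 - c) ^ 2) := by
          refine (prob_or_le hp₀ hp₁ _ _).trans (add_le_add ?_ ?_)
          · exact (prob_exists_le hp₀ hp₁ _ _).trans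
              ((Finset.sum_le_sum fun w _ => prob_exists_le hp₀ hp₁ _ _).trans h1)
          · exact (prob_exists_le hp₀ hp₁ _ _).trans h2
      _ = c ^ 2 * p / (1 - c) ^ 2 := by field_simp; ring

lemma prob_cyclicAt_le (hp₀ : 0 ≤ p) (hp₁ : p ≤ 1) (hc₀ : 0 ≤ c) (hc₁ : c < 1)
    (hc : n * p ≤ c) (v : Fin n) :
    prob p (fun G => CyclicAt G v) ≤ c ^ 2 * p / (1 - c) ^ 2 := by
  have := prob_cyclicAt_restr_le hp₀ hp₁ hc₀ hc₁ hc Finset.univ v (Finset.mem_univ v)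
  simpa only [restr_univ] using this

end ErdosRenyi

/-- Starting from each of the vertices in the list `l` one can follow a path of `G` inside `X` to
its end, these paths being disjoint and having no further edges inside `X`. -/
inductive Ends {V : Type*} [DecidableEq V] (G : SimpleGraph V) : Finset V → List V → Prop
  | nil (X : Finset V) : Ends G X []
  | single {X : Finset V} {a : V} {l : List V} : (∀ y ∈ X.erase a, ¬ G.Adj a y) →
      Ends G (X.erase a) l → Ends G X (a :: l)
  | step {X : Finset V} {a w : V} {l : List V} : w ∈ X.erase a → w ∉ l →
      (∀ y ∈ X.erase a, G.Adj a y ↔ y = w) → Ends G (X.erase a) (w :: l) → Ends G X (a :: l)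

lemma exists_leg_iff {V : Type*} {G : SimpleGraph V} {v a : V} :
    (∃ e, Leg G v a e) ↔ G.Adj v a ∧ ((∀ y, G.Adj a y → y = v) ∨
    ∃ w, G.Adj a w ∧ w ≠ v ∧ (∀ y, G.Adj a y → y = v ∨ y = w) ∧ ∃ e, Leg G a w e) := by
  constructor
  · rintro ⟨e, h⟩
    cases h with
    | leaf h1 h2 => exact ⟨h1, .inl h2⟩
    | step h1 h2 h3 h4 h5 => exact ⟨h1, .inr ⟨_, h2, h3, h4, e, h5⟩⟩
  · rintro ⟨h1, h2 | ⟨w, h2, h3, h4, e, h5⟩⟩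
    exacts [⟨_, .leaf h1 h2⟩, ⟨e, .step h1 h2 h3 h4 h5⟩]

section Ends

variable {V : Type*} [DecidableEq V] {G : SimpleGraph V}

lemma ends_cons_iff {X : Finset V} {a : V} {l : List V} :
    Ends G X (a :: l) ↔ ((∀ y ∈ X.erase a, ¬ G.Adj a y) ∧ Ends G (X.erase a) l) ∨
      ∃ w ∈ X.erase a, w ∉ l ∧ (∀ y ∈ X.erase a, G.Adj a y ↔ y = w) ∧
        Ends G (X.erase a) (w :: l) := by
  constructor
  · intro h
    cases h with
    | single h1 h2 => exact .inl ⟨h1, h2⟩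
    | step h1 h2 h3 h4 => exact .inr ⟨_, h1, h2, h3, h4⟩
  · rintro (⟨h1, h2⟩ | ⟨w, h1, h2, h3, h4⟩)
    exacts [.single h1 h2, .step h1 h2 h3 h4]

lemma ends_map_snd_iff (X : Finset V) : ∀ ds : List (V × V),
    (∀ d ∈ ds, G.Adj d.1 d.2 ∧ ¬ CyclicAt G d.1 ∧ branch G d.1 d.2 ⊆ X ∧ d.1 ∉ X) →
    ds.Pairwise (fun d d' => Disjoint (branch G d.1 d.2) (branch G d'.1 d'.2)) →
    (Ends G X (ds.map Prod.snd) ↔ ∀ d ∈ ds, ∃ e, Leg G d.1 d.2 e) := by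
  induction X using Finset.strongInduction with
  | H X ih =>
    intro ds hds hdis
    cases ds with
    | nil => simp [Ends.nil]
    | cons d ds =>
      obtain ⟨u, a⟩ := d
      rw [List.forall_mem_cons] at hds
      rw [List.pairwise_cons] at hdis
      obtain ⟨⟨hua, hu, hX, huX⟩, hds⟩ := hds
      obtain ⟨hdis₁, hdis⟩ := hdis
      simp only at hua hu hX huX hdis₁
      have haX : a ∈ X := hX (mem_branch_self hua)
      have ha : ¬ CyclicAt G a := by rwa [← CyclicAt.congr hua.reachable]
      have hnb : ∀ y, G.Adj a y → y ≠ u → y ∈ branch G u a := fun y hy hyu =>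
        neighbor_mem_branch ha hua.symm hy (Ne.symm hyu)
      have hnbX : ∀ y, G.Adj a y → y ≠ u → y ∈ X.erase a := fun y hy hyu =>
        Finset.mem_erase.2 ⟨hy.ne', hX (hnb y hy hyu)⟩
      have hsub := Finset.erase_ssubset haX
      have hds' : ∀ d ∈ ds, G.Adj d.1 d.2 ∧ ¬ CyclicAt G d.1 ∧
          branch G d.1 d.2 ⊆ ((X.erase a : Finset V) : Set V) ∧ d.1 ∉ X.erase a := by
        intro d hd
        obtain ⟨h1, h2, h3, h4⟩ := hds d hd
        refine ⟨h1, h2, fun x hx => ?_, fun h => h4 (Finset.mem_of_mem_erase h)⟩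
        refine Finset.mem_coe.2 (Finset.mem_erase.2 ⟨?_, h3 hx⟩)
        rintro rfl
        exact Set.disjoint_left.1 (hdis₁ d hd) (mem_branch_self hua) hx
      have htail : ∀ w, G.Adj a w → w ≠ u →
          (Ends G (X.erase a) (w :: ds.map Prod.snd) ↔
            (∃ e, Leg G a w e) ∧ ∀ d ∈ ds, ∃ e, Leg G d.1 d.2 e) := by
        intro w haw hwu
        have hsubw := branch_subset hu hua haw hwu
        have := ih _ hsub ((a, w) :: ds) ?_ ?_
        · simpa only [List.map_cons, List.forall_mem_cons] using this
        · rw [List.forall_mem_cons]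
          refine ⟨⟨haw, ha, fun x hx => ?_, by simp⟩, hds'⟩
          refine Finset.mem_coe.2 (Finset.mem_erase.2 ⟨?_, hX (hsubw hx)⟩)
          rintro rfl
          exact not_mem_branch_tail hx
        · rw [List.pairwise_cons]
          exact ⟨fun d hd => (hdis₁ d hd).mono_left hsubw, hdis⟩
      have hsingle := ih _ hsub ds hds' hdis
      rw [List.map_cons, ends_cons_iff, List.forall_mem_cons, exists_leg_iff]
      constructor
      · rintro (⟨h1, h2⟩ | ⟨w, h1, h2, h3, h4⟩)
        · refine ⟨⟨hua, .inl fun y hy => ?_⟩, hsingle.1 h2⟩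
          by_contra hyu
          exact h1 y (hnbX y hy hyu) hy
        · have haw : G.Adj a w := (h3 w h1).2 rfl
          have hwu : w ≠ u := by
            rintro rfl
            exact huX (Finset.mem_of_mem_erase h1)
          obtain ⟨h5, h6⟩ := (htail w haw hwu).1 h4
          refine ⟨⟨hua, .inr ⟨w, haw, hwu, fun y hy => ?_, h5⟩⟩, h6⟩
          by_cases hyu : y = u
          · exact .inl hyu
          · exact .inr ((h3 y (hnbX y hy hyu)).1 hy)
      · rintro ⟨⟨-, h1 | ⟨w, h1, h2, h3, h4⟩⟩, h5⟩
        · refine .inl ⟨fun y hy hay => ?_, hsingle.2 h5⟩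
          obtain rfl : y = u := h1 y hay
          exact huX (Finset.mem_of_mem_erase hy)
        · refine .inr ⟨w, hnbX w h1 h2, fun hw => ?_, fun y hy => ⟨fun hay => ?_, ?_⟩,
            (htail w h1 h2).2 ⟨h4, h5⟩⟩
          · obtain ⟨d, hd, rfl⟩ := List.mem_map.1 hw
            exact Set.disjoint_left.1 (hdis₁ d hd) (hnb _ h1 h2) (mem_branch_self (hds d hd).1)
          · refine (h3 y hay).resolve_left ?_
            rintro rfl
            exact huX (Finset.mem_of_mem_erase hy)
          · rintro rfl
            exact h1

lemma ends_neighbors_iff [Fintype V] {v : V} (hv : ¬ CyclicAt G v) {l : List V} (hl : l.Nodup)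
    (hadj : ∀ a ∈ l, G.Adj v a) :
    Ends G (Finset.univ.erase v) l ↔ ∀ a ∈ l, ∃ e, Leg G v a e := by
  have := ends_map_snd_iff (G := G) (Finset.univ.erase v) (l.map fun a => (v, a)) ?_ ?_
  · simpa [List.map_map, Function.comp_def] using this
  · intro d hd
    obtain ⟨a, ha, rfl⟩ := List.mem_map.1 hd
    refine ⟨hadj a ha, hv, fun x hx => ?_, by simp⟩
    simp only [Finset.coe_erase, Finset.coe_univ, Set.mem_sdiff, Set.mem_univ, true_and,
      Set.mem_singleton_iff]
    rintro rfl
    have := hx.2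
    simp at this
  · rw [List.pairwise_map]
    exact hl.imp_of_mem fun ha hb hab => Set.disjoint_left.2 fun x hx =>
      branch_disjoint hv (hadj _ ha) (hadj _ hb) hab hx

end Ends

/-- The probability that `j` given vertices among `N` satisfy `Ends` in the Erdős–Rényi model. -/
def legProb (p : ℝ) : ℕ → ℕ → ℝ
  | _, 0 => 1
  | 0, _ + 1 => 0
  | N + 1, j + 1 => (1 - p) ^ N * legProb p N j +
      ((N - j : ℕ) : ℝ) * (p * (1 - p) ^ (N - 1) * legProb p N (j + 1))

section ErdosRenyi

variable {n : ℕ} {p : ℝ}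

lemma Ends.of_agree {X : Finset (Fin n)} {l : List (Fin n)} {G G' : SimpleGraph (Fin n)}
    (h : Ends G X l) (hl : ∀ a ∈ l, a ∈ X)
    (hG : ∀ u v, u ∈ X ∧ v ∈ X → (G.Adj u v ↔ G'.Adj u v)) (hn : l.Nodup) : Ends G' X l := by
  induction h with
  | nil => exact .nil _
  | @single X a l h1 h2 ih =>
    rw [List.nodup_cons] at hn
    rw [List.forall_mem_cons] at hl
    refine .single (fun y hy => ?_) (ih ?_ ?_ hn.2)
    · rw [← hG a y ⟨hl.1, Finset.mem_of_mem_erase hy⟩]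
      exact h1 y hy
    · exact fun b hb => Finset.mem_erase.2 ⟨fun h => hn.1 (h ▸ hb), hl.2 b hb⟩
    · exact fun u v huv => hG u v ⟨Finset.mem_of_mem_erase huv.1, Finset.mem_of_mem_erase huv.2⟩
  | @step X a w l h1 h2 h3 h4 ih =>
    rw [List.nodup_cons] at hn
    rw [List.forall_mem_cons] at hl
    refine .step h1 h2 (fun y hy => ?_) (ih ?_ ?_ (List.nodup_cons.2 ⟨h2, hn.2⟩))
    · rw [← hG a y ⟨hl.1, Finset.mem_of_mem_erase hy⟩]
      exact h3 y hy
    · rw [List.forall_mem_cons]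
      exact ⟨h1, fun b hb => Finset.mem_erase.2 ⟨fun h => hn.1 (h ▸ hb), hl.2 b hb⟩⟩
    · exact fun u v huv => hG u v ⟨Finset.mem_of_mem_erase huv.1, Finset.mem_of_mem_erase huv.2⟩

lemma dependsOn_ends {X : Finset (Fin n)} {l : List (Fin n)} (hl : ∀ a ∈ l, a ∈ X)
    (hn : l.Nodup) : DependsOn (fun u v => u ∈ X ∧ v ∈ X) fun G => Ends G X l :=
  fun _ _ hG h => h.of_agree hl hG hn

lemma DependsOn.erase {X : Finset (Fin n)} {a : Fin n} {P : SimpleGraph (Fin n) → Prop}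
    (hP : DependsOn (fun u v => u ∈ X.erase a ∧ v ∈ X.erase a) P) :
    DependsOn (fun u v => u ≠ a ∧ v ≠ a) P :=
  hP.mono fun _ _ h => ⟨Finset.ne_of_mem_erase h.1, Finset.ne_of_mem_erase h.2⟩

lemma prob_ends (X : Finset (Fin n)) : ∀ l : List (Fin n), l.Nodup → (∀ a ∈ l, a ∈ X) →
    prob p (fun G => Ends G X l) = legProb p X.card l.length := by
  induction X using Finset.strongInduction with
  | H X ih =>
    intro l hn hl
    cases l with
    | nil => simp [Ends.nil, prob_true, legProb]
    | cons a l =>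
      rw [List.nodup_cons] at hn
      rw [List.forall_mem_cons] at hl
      have hcard := Finset.card_erase_add_one hl.1
      have hsub := Finset.erase_ssubset hl.1
      have hl' : ∀ b ∈ l, b ∈ X.erase a := fun b hb =>
        Finset.mem_erase.2 ⟨fun h => hn.1 (h ▸ hb), hl.2 b hb⟩
      set Y := X.erase a with hY
      set W := Y.filter (fun w => w ∉ l) with hW
      have haY : a ∉ Y := by simp [hY]
      have hWcard : W.card = Y.card - l.length := by
        have : W = Y \ l.toFinset := by
          ext w
          simp [hW]
        rw [this, Finset.card_sdiff_of_subset, List.toFinset_card_of_nodup hn.2]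
        intro b hb
        exact hl' b (List.mem_toFinset.1 hb)
      have h1 : prob p (fun G => Ends G Y l ∧ ∀ y ∈ Y, G.Adj a y ↔ y ∈ (∅ : Finset (Fin n))) =
          (1 - p) ^ Y.card * legProb p Y.card l.length := by
        rw [prob_and_star (dependsOn_ends hl' hn.2).erase _ _ haY, ih _ hsub l hn.2 hl']
        simp
      have h2 : ∀ w ∈ W, prob p (fun G => Ends G Y (w :: l) ∧
          ∀ y ∈ Y, G.Adj a y ↔ y ∈ ({w} : Finset (Fin n))) =
            p * (1 - p) ^ (Y.card - 1) * legProb p Y.card (l.length + 1) := by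
        intro w hw
        obtain ⟨hwY, hwl⟩ := Finset.mem_filter.1 hw
        have hn' : (w :: l).Nodup := List.nodup_cons.2 ⟨hwl, hn.2⟩
        have hl'' : ∀ b ∈ w :: l, b ∈ Y := List.forall_mem_cons.2 ⟨hwY, hl'⟩
        rw [prob_and_star (dependsOn_ends hl'' hn').erase _ _ haY, ih _ hsub _ hn' hl'',
          Finset.inter_singleton_of_mem hwY, Finset.card_sdiff_of_subset (by simpa using hwY)]
        simp
      have h3 : prob p (fun G => Ends G X (a :: l)) =
          prob p (fun G => Ends G Y l ∧ ∀ y ∈ Y, G.Adj a y ↔ y ∈ (∅ : Finset (Fin n))) +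
          prob p (fun G => ∃ w ∈ W, Ends G Y (w :: l) ∧
            ∀ y ∈ Y, G.Adj a y ↔ y ∈ ({w} : Finset (Fin n))) := by
        rw [← prob_add_not _ (fun G => ∀ y ∈ Y, ¬ G.Adj a y)]
        congr 1
        · refine prob_congr fun G => ?_
          rw [ends_cons_iff, ← hY]
          simp only [Finset.notMem_empty, iff_false]
          constructor
          · rintro ⟨⟨h, h'⟩ | ⟨w, hw, -, h, -⟩, h0⟩
            · exact ⟨h', h⟩
            · exact absurd ((h w hw).2 rfl) (h0 w hw)
          · exact fun h => ⟨.inl ⟨h.2, h.1⟩, h.2⟩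
        · refine prob_congr fun G => ?_
          rw [ends_cons_iff, ← hY]
          simp only [Finset.mem_singleton, hW, Finset.mem_filter]
          constructor
          · rintro ⟨⟨h, h'⟩ | ⟨w, hw, hw', h, h'⟩, h0⟩
            · exact absurd h h0
            · exact ⟨w, ⟨hw, hw'⟩, h', h⟩
          · rintro ⟨w, ⟨hw, hw'⟩, h', h⟩
            exact ⟨.inr ⟨w, hw, hw', h, h'⟩, fun h0 => h0 w hw ((h w hw).2 rfl)⟩
      rw [h3, h1, prob_exists_eq, Finset.sum_congr rfl h2, Finset.sum_const, hWcard, ← hcard,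
        List.length_cons, legProb, nsmul_eq_mul]
      intro w hw w' hw' hww' G h h'
      have hwY := (Finset.mem_filter.1 hw).1
      exact hww' (by simpa using ((h'.2 w hwY).1 ((h.2 w hwY).2 (by simp))))

end ErdosRenyi

section ErdosRenyi

variable {n : ℕ} {p : ℝ}

lemma abs_erExp_sub_le (hp₀ : 0 ≤ p) (hp₁ : p ≤ 1) {f g h : SimpleGraph (Fin n) → ℝ}
    (hfg : ∀ G, |f G - g G| ≤ h G) : |erExp n p f - erExp n p g| ≤ erExp n p h := by
  have h1 : erExp n p f ≤ erExp n p fun G => g G + h G :=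
    erExp_mono hp₀ hp₁ fun G => by linarith [(abs_le.1 (hfg G)).2]
  have h2 : erExp n p g ≤ erExp n p fun G => f G + h G :=
    erExp_mono hp₀ hp₁ fun G => by linarith [(abs_le.1 (hfg G)).1]
  rw [erExp_add] at h1 h2
  rw [abs_le]
  constructor <;> linarith

/-- The neighbours of `v` as a finite set. -/
def nbrs (G : SimpleGraph (Fin n)) (v : Fin n) : Finset (Fin n) :=
  Finset.univ.filter fun y => G.Adj v y

lemma mem_nbrs {G : SimpleGraph (Fin n)} {v y : Fin n} : y ∈ nbrs G v ↔ G.Adj v y := by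
  simp [nbrs]

lemma card_nbrs (G : SimpleGraph (Fin n)) (v : Fin n) : (nbrs G v).card = ndeg G v := by
  rw [ndeg, ← Set.ncard_coe_finset]
  congr 1
  ext y
  simp [mem_nbrs]

lemma nbrs_subset (G : SimpleGraph (Fin n)) (v : Fin n) : nbrs G v ⊆ Finset.univ.erase v := by
  intro y hy
  simpa using (mem_nbrs.1 hy).ne'

lemma star_iff {G : SimpleGraph (Fin n)} {v : Fin n} {T : Finset (Fin n)}
    (hT : T ⊆ Finset.univ.erase v) :
    (∀ y ∈ Finset.univ.erase v, G.Adj v y ↔ y ∈ T) ↔ T = nbrs G v := by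
  constructor
  · intro h
    ext y
    rw [mem_nbrs]
    by_cases hy : y = v
    · subst hy
      simpa using fun h : y ∈ T => Finset.ne_of_mem_erase (hT h) rfl
    · exact (h y (by simpa using hy)).symm
  · rintro rfl y -
    exact mem_nbrs.symm

lemma prob_and_star_card {v : Fin n} {T : Finset (Fin n)} {P : SimpleGraph (Fin n) → Prop}
    (hP : DependsOn (fun a b => a ≠ v ∧ b ≠ v) P) (hT : T ⊆ Finset.univ.erase v) :
    prob p (fun G => P G ∧ ∀ y ∈ Finset.univ.erase v, G.Adj v y ↔ y ∈ T) =
      p ^ T.card * (1 - p) ^ (n - 1 - T.card) * prob p P := by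
  rw [prob_and_star hP _ _ (by simp), Finset.inter_eq_right.2 hT, Finset.card_sdiff_of_subset hT,
    Finset.card_erase_of_mem (Finset.mem_univ v), Finset.card_univ, Fintype.card_fin]

lemma card_erase_univ (v : Fin n) : (Finset.univ.erase v).card = n - 1 := by
  rw [Finset.card_erase_of_mem (Finset.mem_univ v), Finset.card_univ, Fintype.card_fin]

lemma prob_ndeg_eq (v : Fin n) (k : ℕ) :
    prob p (fun G => ndeg G v = k) = ((n - 1).choose k : ℝ) * p ^ k * (1 - p) ^ (n - 1 - k) := by
  have h : prob p (fun G => ndeg G v = k) = prob p (fun G =>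
      ∃ T ∈ (Finset.univ.erase v).powersetCard k,
        True ∧ ∀ y ∈ Finset.univ.erase v, G.Adj v y ↔ y ∈ T) := by
    refine prob_congr fun G => ?_
    constructor
    · intro h
      exact ⟨nbrs G v, Finset.mem_powersetCard.2 ⟨nbrs_subset G v, by rw [card_nbrs, h]⟩, trivial,
        (star_iff (nbrs_subset G v)).2 rfl⟩
    · rintro ⟨T, hT, -, h⟩
      rw [Finset.mem_powersetCard] at hT
      rw [← card_nbrs, ← (star_iff hT.1).1 h, hT.2]
  rw [h, prob_exists_eq, Finset.sum_congr rfl (g := fun _ => p ^ k * (1 - p) ^ (n - 1 - k))]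
  · rw [Finset.sum_const, Finset.card_powersetCard, card_erase_univ, nsmul_eq_mul, mul_assoc]
  · intro T hT
    rw [Finset.mem_powersetCard] at hT
    rw [prob_and_star_card (fun _ _ _ h => h) hT.1, hT.2, prob_true, mul_one]
  · intro T hT T' hT' hne G h h'
    rw [Finset.mem_powersetCard] at hT hT'
    exact hne (((star_iff hT.1).1 h.2).trans ((star_iff hT'.1).1 h'.2).symm)

/-- The inclusion–exclusion sum for the event that `v` has `k` neighbours, no leg starting at
any of them. -/
def noLegSum (G : SimpleGraph (Fin n)) (v : Fin n) (k : ℕ) : ℝ :=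
  ∑ T ∈ (Finset.univ.erase v).powersetCard k, ∑ S ∈ T.powerset, (-1) ^ S.card *
    if Ends G (Finset.univ.erase v) S.toList ∧ ∀ y ∈ Finset.univ.erase v, G.Adj v y ↔ y ∈ T
      then 1 else 0

lemma noLegSum_eq (G : SimpleGraph (Fin n)) (v : Fin n) (k : ℕ) :
    noLegSum G v k = if ndeg G v = k then ∑ S ∈ (nbrs G v).powerset, (-1) ^ S.card *
      (if Ends G (Finset.univ.erase v) S.toList then (1 : ℝ) else 0) else 0 := by
  split_ifs with h
  · rw [noLegSum, Finset.sum_eq_single_of_mem (nbrs G v)]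
    · refine Finset.sum_congr rfl fun S _ => ?_
      simp only [and_iff_left ((star_iff (nbrs_subset G v)).2 rfl)]
    · exact Finset.mem_powersetCard.2 ⟨nbrs_subset G v, by rw [card_nbrs, h]⟩
    · intro T hT hne
      refine Finset.sum_eq_zero fun S _ => ?_
      rw [if_neg, mul_zero]
      exact fun h => hne ((star_iff (Finset.mem_powersetCard.1 hT).1).1 h.2)
  · refine Finset.sum_eq_zero fun T hT => Finset.sum_eq_zero fun S _ => ?_
    rw [if_neg, mul_zero]
    rw [Finset.mem_powersetCard] at hT
    exact fun h' => h (by rw [← card_nbrs, ← (star_iff hT.1).1 h'.2, hT.2])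

lemma abs_noLeg_sub_le (G : SimpleGraph (Fin n)) (v : Fin n) (k : ℕ) :
    |(if ndeg G v = k ∧ ¬ HasLeg G v then (1 : ℝ) else 0) - noLegSum G v k| ≤
      (2 ^ k + 1) * if CyclicAt G v then 1 else 0 := by
  rw [noLegSum_eq]
  by_cases hk : ndeg G v = k
  swap
  · simp only [hk, false_and, if_false, sub_zero, abs_zero]
    positivity
  simp only [hk, true_and, if_true]
  by_cases hv : CyclicAt G v
  · rw [if_pos hv, mul_one, add_comm]
    refine (abs_sub _ _).trans (add_le_add (by split_ifs <;> simp) ?_)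
    refine (Finset.abs_sum_le_sum_abs _ _).trans ?_
    refine (Finset.sum_le_sum (g := fun _ => 1) fun S _ => ?_).trans ?_
    · rw [abs_mul, abs_pow, abs_neg, abs_one, one_pow, one_mul]
      split_ifs <;> simp
    · rw [Finset.sum_const, Finset.card_powerset, card_nbrs, hk]
      simp
  · have h1 : ∑ S ∈ (nbrs G v).powerset, (-1) ^ S.card *
        (if Ends G (Finset.univ.erase v) S.toList then (1 : ℝ) else 0) =
        ∏ a ∈ nbrs G v, (1 - if ∃ e, Leg G v a e then (1 : ℝ) else 0) := by
      rw [Finset.prod_sub]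
      refine Finset.sum_congr rfl fun S hS => ?_
      rw [Finset.mem_powerset] at hS
      rw [Finset.prod_const_one, mul_one]
      congr 1
      rw [Finset.prod_ite_zero, Finset.prod_const_one]
      congr 1
      rw [ends_neighbors_iff hv S.nodup_toList fun a ha =>
        mem_nbrs.1 (hS (Finset.mem_toList.1 ha))]
      simp only [Finset.mem_toList]
    have h2 : (if ¬ HasLeg G v then (1 : ℝ) else 0) =
        ∏ a ∈ nbrs G v, (1 - if ∃ e, Leg G v a e then (1 : ℝ) else 0) := by
      by_cases h : ¬ HasLeg G v
      · rw [if_pos h]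
        refine (Finset.prod_eq_one fun a _ => ?_).symm
        rw [if_neg fun ⟨e, he⟩ => h ⟨a, e, he⟩, sub_zero]
      · rw [if_neg h]
        obtain ⟨a, e, he⟩ := not_not.1 h
        refine (Finset.prod_eq_zero (mem_nbrs.2 he.adj) ?_).symm
        rw [if_pos ⟨e, he⟩, sub_self]
    rw [h1, h2, sub_self, abs_zero]
    positivity

lemma erExp_noLegSum (v : Fin n) (k : ℕ) :
    erExp n p (fun G => noLegSum G v k) = ((n - 1).choose k : ℝ) * p ^ k * (1 - p) ^ (n - 1 - k) *
      ∑ j ∈ Finset.range (k + 1), (k.choose j : ℝ) * ((-1) ^ j * legProb p (n - 1) j) := by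
  have h : ∀ T ∈ (Finset.univ.erase v).powersetCard k, ∀ S ∈ T.powerset,
      prob p (fun G => Ends G (Finset.univ.erase v) S.toList ∧
        ∀ y ∈ Finset.univ.erase v, G.Adj v y ↔ y ∈ T) =
      p ^ k * (1 - p) ^ (n - 1 - k) * legProb p (n - 1) S.card := by
    intro T hT S hS
    rw [Finset.mem_powersetCard] at hT
    rw [Finset.mem_powerset] at hS
    have hS' : ∀ a ∈ S.toList, a ∈ Finset.univ.erase v := fun a ha =>
      hT.1 (hS (Finset.mem_toList.1 ha))
    rw [prob_and_star_card (dependsOn_ends hS' S.nodup_toList).erase hT.1, hT.2,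
      prob_ends _ _ S.nodup_toList hS', card_erase_univ, Finset.length_toList]
  simp only [noLegSum]
  rw [erExp_sum, Finset.sum_congr rfl (g := fun _ => p ^ k * (1 - p) ^ (n - 1 - k) *
      ∑ j ∈ Finset.range (k + 1), (k.choose j : ℝ) * ((-1) ^ j * legProb p (n - 1) j))]
  · rw [Finset.sum_const, Finset.card_powersetCard, card_erase_univ, nsmul_eq_mul]
    ring
  · intro T hT
    rw [erExp_sum, ← (Finset.mem_powersetCard.1 hT).2]
    have := Finset.sum_powerset_apply_card (fun j => (-1) ^ j * legProb p (n - 1) j) (x := T)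
    simp only [nsmul_eq_mul] at this
    rw [← this, Finset.mul_sum]
    refine Finset.sum_congr rfl fun S hS => ?_
    have hS := h T hT S hS
    rw [prob] at hS
    trans (-1) ^ S.card * (p ^ k * (1 - p) ^ (n - 1 - k) * legProb p (n - 1) S.card)
    · rw [erExp_const_mul]
      congr 1
      convert hS
    · rw [(Finset.mem_powersetCard.1 hT).2]
      ring

lemma abs_prob_noLeg_sub_le (hp₀ : 0 ≤ p) (hp₁ : p ≤ 1) (v : Fin n) (k : ℕ) :
    |prob p (fun G => ndeg G v = k ∧ ¬ HasLeg G v) -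
      ((n - 1).choose k : ℝ) * p ^ k * (1 - p) ^ (n - 1 - k) *
        ∑ j ∈ Finset.range (k + 1), (k.choose j : ℝ) * ((-1) ^ j * legProb p (n - 1) j)| ≤
      (2 ^ k + 1) * prob p (fun G => CyclicAt G v) := by
  rw [← erExp_noLegSum v k, prob, prob, ← erExp_const_mul]
  exact abs_erExp_sub_le hp₀ hp₁ fun G => by convert abs_noLeg_sub_le G v k

end ErdosRenyi

lemma tendsto_of_contraction {a A B : ℕ → ℕ → ℝ} {α b K : ℝ} (hb : |b| < 1)
    (ha : ∀ i, ∀ᶠ n in atTop, a i n = A i n + B i n * a (i + 1) n)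
    (hA : ∀ i, Tendsto (A i) atTop (𝓝 α)) (hB : ∀ i, Tendsto (B i) atTop (𝓝 b))
    (hK : ∀ i, ∀ᶠ n in atTop, |a i n| ≤ K) (i : ℕ) :
    Tendsto (a i) atTop (𝓝 (α / (1 - b))) := by
  set L := α / (1 - b) with hL
  have hbb : 0 < 1 - b := by linarith [le_abs_self b]
  have hfix : L = α + b * L := by
    rw [hL]
    field_simp
    ring
  have key : ∀ M : ℕ, ∀ i, ∀ ε > 0, ∀ᶠ n in atTop, |a i n - L| ≤ |b| ^ M * (K + |L|) + ε := by
    intro M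
    induction M with
    | zero =>
      intro i ε hε
      filter_upwards [hK i] with n hn
      have := abs_sub (a i n) L
      simp only [pow_zero, one_mul]
      linarith
    | succ M ih =>
      intro i ε hε
      have h0 : Tendsto (fun n => |A i n - α| + |B i n - b| * K) atTop (𝓝 0) := by
        have := (((hA i).sub_const α).abs).add ((((hB i).sub_const b).abs).mul_const K)
        simpa using this
      filter_upwards [ha i, hK (i + 1), ih (i + 1) (ε / 2) (by positivity),
        h0.eventually (gt_mem_nhds (show (0 : ℝ) < ε / 2 by positivity))] with n h1 h2 h3 h4
      have h5 : a i n - L = (A i n - α) + (B i n - b) * a (i + 1) n + b * (a (i + 1) n - L) := by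
        rw [h1]
        linear_combination (-1 : ℝ) * hfix
      have h6 : |a i n - L| ≤ |A i n - α| + |B i n - b| * |a (i + 1) n| +
          |b| * |a (i + 1) n - L| := by
        rw [h5, ← abs_mul, ← abs_mul]
        exact abs_add_three _ _ _
      have h7 := mul_le_mul_of_nonneg_left h2 (abs_nonneg (B i n - b))
      have h8 := mul_le_mul_of_nonneg_left h3 (abs_nonneg b)
      have h9 : |b| * (ε / 2) ≤ 1 * (ε / 2) :=
        mul_le_mul_of_nonneg_right hb.le (by positivity)
      rw [pow_succ]
      nlinarith
  rw [Metric.tendsto_atTop']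
  intro ε hε
  have hpow : Tendsto (fun M => |b| ^ M * (K + |L|)) atTop (𝓝 0) := by
    simpa using (tendsto_pow_atTop_nhds_zero_of_lt_one (abs_nonneg b) hb).mul_const (K + |L|)
  obtain ⟨M, hM⟩ := (hpow.eventually (gt_mem_nhds (show (0 : ℝ) < ε / 2 by positivity))).exists
  obtain ⟨N, hN⟩ := eventually_atTop.1 (key M i (ε / 2) (by positivity))
  refine ⟨N, fun n hn => ?_⟩
  rw [Real.dist_eq]
  linarith [hN n hn.le]

section Limits

variable {p c : ℝ}

lemma legProb_zero_right (N : ℕ) : legProb p N 0 = 1 := by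
  cases N <;> rfl

lemma legProb_nonneg (hp₀ : 0 ≤ p) (hp₁ : p ≤ 1) (N j : ℕ) : 0 ≤ legProb p N j := by
  have h1 : 0 ≤ 1 - p := by linarith
  induction N generalizing j with
  | zero => cases j <;> simp [legProb]
  | succ N ih =>
    cases j with
    | zero => simp [legProb]
    | succ j =>
      rw [legProb]
      have := ih j
      have := ih (j + 1)
      positivity

lemma legProb_le (hp₀ : 0 ≤ p) (hp₁ : p ≤ 1) (hc₀ : 0 ≤ c) (hc₁ : c < 1) (N j : ℕ)
    (hN : N * p ≤ c) : legProb p N j ≤ (1 / (1 - c)) ^ j := by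
  have h1 : 0 ≤ 1 - p := by linarith
  have hcc : 0 < 1 - c := by linarith
  induction N generalizing j with
  | zero => cases j <;> simp [legProb]; positivity
  | succ N ih =>
    cases j with
    | zero => simp [legProb]
    | succ j =>
      rw [legProb]
      have hNp : (N : ℝ) * p ≤ c := by
        push_cast at hN
        linarith
      have h2 : (1 - p) ^ N ≤ 1 := pow_le_one₀ h1 (by linarith)
      have h3 : (1 - p) ^ (N - 1) ≤ 1 := pow_le_one₀ h1 (by linarith)
      have h4 : ((N - j : ℕ) : ℝ) * p ≤ c :=
        (mul_le_mul_of_nonneg_right (by exact_mod_cast Nat.sub_le N j) hp₀).trans hNp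
      have h5 := ih j hNp
      have h6 := ih (j + 1) hNp
      have h7 := legProb_nonneg hp₀ hp₁ N j
      have h8 := legProb_nonneg hp₀ hp₁ N (j + 1)
      calc _ = (1 - p) ^ N * legProb p N j +
            ((N - j : ℕ) : ℝ) * p * ((1 - p) ^ (N - 1) * legProb p N (j + 1)) := by ring
        _ ≤ 1 * (1 / (1 - c)) ^ j + c * (1 * (1 / (1 - c)) ^ (j + 1)) := by gcongr
        _ = (1 / (1 - c)) ^ (j + 1) := by
          rw [pow_succ]
          field_simp
          ring

lemma tendsto_one_sub_pow_sub (c : ℝ) (m : ℕ) :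
    Tendsto (fun n : ℕ => (1 - c / n) ^ (n - m)) atTop (𝓝 (Real.exp (-c))) := by
  have h0 : Tendsto (fun n : ℕ => 1 - c / n) atTop (𝓝 1) := by
    simpa using (tendsto_const_div_atTop_nhds_zero_nat c).const_sub 1
  have h1 : Tendsto (fun n : ℕ => (1 - c / n) ^ n) atTop (𝓝 (Real.exp (-c))) := by
    refine (Real.tendsto_one_add_div_pow_exp (-c)).congr fun n => ?_
    rw [neg_div, ← sub_eq_add_neg]
  have h2 := h1.div (h0.pow m) (by simp)
  simp only [one_pow, div_one] at h2
  refine h2.congr' ?_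
  filter_upwards [eventually_ge_atTop m, h0.eventually (lt_mem_nhds (zero_lt_one' ℝ))] with n hn hn'
  rw [Pi.div_apply, div_eq_mul_inv, ← pow_sub₀ _ hn'.ne' hn]

lemma tendsto_sub_mul_div (c : ℝ) (m : ℕ) :
    Tendsto (fun n : ℕ => ((n - m : ℕ) : ℝ) * (c / n)) atTop (𝓝 c) := by
  have : Tendsto (fun n : ℕ => c - m * (c / n)) atTop (𝓝 c) := by
    simpa using ((tendsto_const_div_atTop_nhds_zero_nat c).const_mul (m : ℝ)).const_sub c
  refine this.congr' ?_
  filter_upwards [eventually_ge_atTop m, eventually_gt_atTop 0] with n hn hn0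
  rw [Nat.cast_sub hn]
  field_simp

lemma tendsto_legProb (hc₀ : 0 < c) (hc₁ : c < 1) (j : ℕ) : ∀ i : ℕ,
    Tendsto (fun n : ℕ => legProb (c / n) (n - 1 - i) j) atTop
      (𝓝 ((Real.exp (-c) / (1 - c * Real.exp (-c))) ^ j)) := by
  induction j with
  | zero => simp [legProb_zero_right]
  | succ j ih =>
    have hexp : Real.exp (-c) < 1 := Real.exp_lt_one_iff.2 (by linarith)
    have hexp0 := Real.exp_pos (-c)
    have hb : |c * Real.exp (-c)| < 1 := by
      rw [abs_of_pos (by positivity)]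
      nlinarith
    have hL : (Real.exp (-c) / (1 - c * Real.exp (-c))) ^ (j + 1) =
        Real.exp (-c) * (Real.exp (-c) / (1 - c * Real.exp (-c))) ^ j /
          (1 - c * Real.exp (-c)) := by
      rw [pow_succ]
      ring
    rw [hL]
    refine tendsto_of_contraction (K := (1 / (1 - c)) ^ (j + 1)) hb
      (A := fun i n => (1 - c / n) ^ (n - (i + 2)) * legProb (c / n) (n - 1 - (i + 1)) j)
      (B := fun i n => ((n - (i + 2 + j) : ℕ) : ℝ) * (c / n) * (1 - c / n) ^ (n - (i + 3)))
      ?_ ?_ ?_ ?_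
    · intro i
      filter_upwards [eventually_ge_atTop (i + 2)] with n hn
      rw [show n - 1 - i = (n - (i + 2)) + 1 by omega, legProb,
        show n - 1 - (i + 1) = n - (i + 2) by omega,
        show n - (i + 2) - j = n - (i + 2 + j) by omega,
        show n - (i + 2) - 1 = n - (i + 3) by omega]
      ring
    · exact fun i => (tendsto_one_sub_pow_sub c (i + 2)).mul (ih (i + 1))
    · exact fun i => (tendsto_sub_mul_div c (i + 2 + j)).mul (tendsto_one_sub_pow_sub c (i + 3))
    · intro i
      filter_upwards [eventually_gt_atTop 0] with n hn
      have hn1 : (1 : ℝ) ≤ n := by exact_mod_cast hn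
      have hp₀ : 0 ≤ c / n := by positivity
      have hp₁ : c / n ≤ 1 := (div_le_one (by linarith)).2 (by linarith)
      rw [abs_of_nonneg (legProb_nonneg hp₀ hp₁ _ _)]
      refine legProb_le hp₀ hp₁ hc₀.le hc₁ _ _ ?_
      have : ((n - 1 - i : ℕ) : ℝ) ≤ n := by exact_mod_cast (by omega)
      calc ((n - 1 - i : ℕ) : ℝ) * (c / n) ≤ n * (c / n) := mul_le_mul_of_nonneg_right this hp₀
        _ = c := by field_simp

lemma tendsto_binomial (c : ℝ) (k : ℕ) :
    Tendsto (fun n : ℕ => ((n - 1).choose k : ℝ) * (c / n) ^ k * (1 - c / n) ^ (n - 1 - k)) atTop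
      (𝓝 (Real.exp (-c) * c ^ k / k.factorial)) := by
  have h : Tendsto (fun m : ℕ => (m : ℝ) * (c / ((m + 1 : ℕ) : ℝ))) atTop (𝓝 c) := by
    have := (tendsto_sub_mul_div c 1).comp (tendsto_add_atTop_nat 1)
    simpa [Function.comp_def] using this
  have h2 := (ProbabilityTheory.tendsto_choose_mul_pow_of_tendsto_mul_atTop k h).comp
    (tendsto_sub_atTop_nat 1)
  refine h2.congr' ?_
  filter_upwards [eventually_ge_atTop 1] with n hn
  simp only [Function.comp_apply]
  rw [Nat.sub_add_cancel hn]

lemma tendsto_noLeg (hc₀ : 0 < c) (hc₁ : c < 1) (k : ℕ) :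
    Tendsto (fun n : ℕ => ((n - 1).choose k : ℝ) * (c / n) ^ k * (1 - c / n) ^ (n - 1 - k) *
      ∑ j ∈ Finset.range (k + 1), (k.choose j : ℝ) * ((-1) ^ j * legProb (c / n) (n - 1) j)) atTop
      (𝓝 (Real.exp (-c) * c ^ k / k.factorial *
        (1 - Real.exp (-c) / (1 - c * Real.exp (-c))) ^ k)) := by
  refine (tendsto_binomial c k).mul ?_
  have h : (1 - Real.exp (-c) / (1 - c * Real.exp (-c))) ^ k = ∑ j ∈ Finset.range (k + 1),
      (k.choose j : ℝ) * ((-1) ^ j * (Real.exp (-c) / (1 - c * Real.exp (-c))) ^ j) := by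
    rw [sub_eq_neg_add, add_pow]
    refine Finset.sum_congr rfl fun j _ => ?_
    rw [neg_pow]
    simp
    ring
  rw [h]
  exact tendsto_finsetSum _ fun j _ => ((tendsto_legProb hc₀ hc₁ j 0).const_mul _).const_mul _

end Limits

section Assembly

variable {n : ℕ} {p c : ℝ}

/-- The contribution of the vertex `v` to the metric dimension of a forest. -/
def vertexTerm (G : SimpleGraph (Fin n)) (v : Fin n) : ℝ :=
  (if ndeg G v = 0 then 1 else 0) + (if ndeg G v = 1 then 1 else 0) +
    ((-1 / 2) * (if ndeg G v = 1 ∧ HasLeg G v then 1 else 0) +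
      (-1) * (if 3 ≤ ndeg G v ∧ HasLeg G v then 1 else 0))

lemma abs_betaR_sub_le (hn : n ≠ 1) (G : SimpleGraph (Fin n)) :
    |betaR G - ∑ v, vertexTerm G v| ≤ 3 * (∑ v, if CyclicAt G v then 1 else 0) + 1 := by
  obtain ⟨h1, h2⟩ := metricDim_bounds G (by simpa using hn)
  have h1' : (2 : ℝ) * (isolatedVerts G).card + 2 * (treeLeaves G).card ≤
    2 * betaR G + (pathLeaves G).card + 2 * (branchVerts G).card + 2 := by
      rw [betaR]
      exact_mod_cast h1
  have h2' : (2 : ℝ) * betaR G + (pathLeaves G).card + 2 * (branchVerts G).card ≤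
    2 * (cyclicVerts G).card + 2 * (isolatedVerts G).card + 2 * (treeLeaves G).card := by
      rw [betaR]
      exact_mod_cast h2
  have hcard : ∀ (P : Fin n → Prop) [DecidablePred P],
      (((Finset.univ.filter P).card : ℕ) : ℝ) = ∑ v, if P v then (1 : ℝ) else 0 := by
    intro P _
    simp
  simp only [isolatedVerts, treeLeaves, pathLeaves, branchVerts, cyclicVerts] at h1' h2'
  rw [hcard, hcard, hcard, hcard] at h1'
  rw [hcard, hcard, hcard, hcard, hcard] at h2'
  have hlow : ∑ v, vertexTerm G v ≤ (∑ v, if ndeg G v = 0 then (1 : ℝ) else 0) +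
      (∑ v, if ¬ CyclicAt G v ∧ ndeg G v = 1 then (1 : ℝ) else 0) -
      (1 / 2) * (∑ v, if ¬ CyclicAt G v ∧ ndeg G v = 1 ∧ HasLeg G v then (1 : ℝ) else 0) -
      (∑ v, if ¬ CyclicAt G v ∧ 3 ≤ ndeg G v ∧ HasLeg G v then (1 : ℝ) else 0) +
      ∑ v, if CyclicAt G v then (1 : ℝ) else 0 := by
    rw [Finset.mul_sum, ← Finset.sum_add_distrib, ← Finset.sum_sub_distrib,
      ← Finset.sum_sub_distrib, ← Finset.sum_add_distrib]
    refine Finset.sum_le_sum fun v _ => ?_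
    rw [vertexTerm]
    by_cases h : CyclicAt G v <;> by_cases h' : HasLeg G v <;> simp only [h, h', not_true,
      not_false_iff, true_and, and_true, and_false, false_and, if_true, if_false]
    all_goals split_ifs <;> norm_num
  have hupp : (∑ v, if ndeg G v = 0 then (1 : ℝ) else 0) +
      (∑ v, if ¬ CyclicAt G v ∧ ndeg G v = 1 then (1 : ℝ) else 0) -
      (1 / 2) * (∑ v, if ¬ CyclicAt G v ∧ ndeg G v = 1 ∧ HasLeg G v then (1 : ℝ) else 0) -
      (∑ v, if ¬ CyclicAt G v ∧ 3 ≤ ndeg G v ∧ HasLeg G v then (1 : ℝ) else 0) ≤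
      ∑ v, vertexTerm G v + ∑ v, if CyclicAt G v then (1 : ℝ) else 0 := by
    rw [Finset.mul_sum, ← Finset.sum_add_distrib, ← Finset.sum_sub_distrib,
      ← Finset.sum_sub_distrib, ← Finset.sum_add_distrib]
    refine Finset.sum_le_sum fun v _ => ?_
    rw [vertexTerm]
    by_cases h : CyclicAt G v <;> by_cases h' : HasLeg G v <;> simp only [h, h', not_true,
      not_false_iff, true_and, and_true, and_false, false_and, if_true, if_false]
    all_goals split_ifs <;> norm_num
  have hpos : (0 : ℝ) ≤ ∑ v, if CyclicAt G v then (1 : ℝ) else 0 :=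
    Finset.sum_nonneg fun v _ => by split_ifs <;> simp
  rw [abs_le]
  constructor <;> linarith

lemma prob_eq_zero {P : SimpleGraph (Fin n) → Prop} (h : ∀ G, ¬ P G) : prob p P = 0 := by
  simp [prob, erExp_eq_sum, h]

/-- The expected proportion of vertices of degree `k` at which a leg starts. -/
def legFraction (p : ℝ) (n k : ℕ) : ℝ :=
  (∑ v : Fin n, prob p fun G => ndeg G v = k ∧ HasLeg G v) / n

lemma legFraction_nonneg (hp₀ : 0 ≤ p) (hp₁ : p ≤ 1) (n k : ℕ) : 0 ≤ legFraction p n k :=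
  div_nonneg (Finset.sum_nonneg fun _ _ => prob_nonneg hp₀ hp₁ _) (Nat.cast_nonneg n)

lemma ndeg_lt (G : SimpleGraph (Fin n)) (v : Fin n) : ndeg G v < n := by
  have h := Finset.card_le_card (nbrs_subset G v)
  rw [card_nbrs, card_erase_univ] at h
  have := v.pos
  omega

lemma tsum_legFraction (n : ℕ) : (∑' k, if 3 ≤ k then legFraction p n k else 0) =
    (∑ v : Fin n, prob p fun G => 3 ≤ ndeg G v ∧ HasLeg G v) / n := by
  rw [tsum_eq_sum (s := Finset.range n)]
  · rw [← Finset.sum_filter]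
    simp only [legFraction]
    rw [← Finset.sum_div, Finset.sum_comm]
    congr 1
    refine Finset.sum_congr rfl fun v _ => ?_
    rw [← prob_exists_eq]
    · refine prob_congr fun G => ?_
      constructor
      · rintro ⟨k, hk, rfl, h⟩
        exact ⟨(Finset.mem_filter.1 hk).2, h⟩
      · rintro ⟨h, h'⟩
        exact ⟨ndeg G v, Finset.mem_filter.2 ⟨Finset.mem_range.2 (ndeg_lt G v), h⟩, rfl, h'⟩
    · rintro i - j - hij G ⟨rfl, -⟩ ⟨rfl, -⟩
      exact hij rfl
  · intro k hk
    rw [Finset.mem_range, not_lt] at hk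
    split_ifs
    · rw [legFraction, Finset.sum_eq_zero, zero_div]
      intro v _
      refine prob_eq_zero ?_
      rintro G ⟨h, -⟩
      have := ndeg_lt G v
      omega
    · rfl

lemma abs_erExp_betaR_sub_le (hp₀ : 0 ≤ p) (hp₁ : p ≤ 1) (hc₀ : 0 ≤ c) (hc₁ : c < 1)
    (hc : n * p ≤ c) (hn : 2 ≤ n) :
    |erExp n p betaR / n - (((n - 1).choose 0 : ℝ) * p ^ 0 * (1 - p) ^ (n - 1 - 0) +
      ((n - 1).choose 1 : ℝ) * p ^ 1 * (1 - p) ^ (n - 1 - 1) - (1 / 2) * legFraction p n 1 -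
      ∑' k, if 3 ≤ k then legFraction p n k else 0)| ≤ 3 * (c ^ 2 * p / (1 - c) ^ 2) + 1 / n := by
  have hn0 : (0 : ℝ) < n := by positivity
  have h := abs_erExp_sub_le hp₀ hp₁ (abs_betaR_sub_le (n := n) (by omega))
  have hE : erExp n p (fun G => ∑ v, vertexTerm G v) =
      n * (((n - 1).choose 0 : ℝ) * p ^ 0 * (1 - p) ^ (n - 1 - 0) +
      ((n - 1).choose 1 : ℝ) * p ^ 1 * (1 - p) ^ (n - 1 - 1) - (1 / 2) * legFraction p n 1 -
      ∑' k, if 3 ≤ k then legFraction p n k else 0) := by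
    rw [tsum_legFraction, legFraction, erExp_sum]
    have : ∀ v : Fin n, erExp n p (fun G => vertexTerm G v) =
        ((n - 1).choose 0 : ℝ) * p ^ 0 * (1 - p) ^ (n - 1 - 0) +
        ((n - 1).choose 1 : ℝ) * p ^ 1 * (1 - p) ^ (n - 1 - 1) +
        ((-1 / 2) * prob p (fun G => ndeg G v = 1 ∧ HasLeg G v) +
          (-1) * prob p fun G => 3 ≤ ndeg G v ∧ HasLeg G v) := by
      intro v
      rw [← prob_ndeg_eq v 0, ← prob_ndeg_eq v 1]
      simp only [prob, ← erExp_const_mul, ← erExp_add, vertexTerm]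
      congr!
    rw [Finset.sum_congr rfl fun v _ => this v, Finset.sum_add_distrib, Finset.sum_const,
      Finset.sum_add_distrib, ← Finset.mul_sum, ← Finset.mul_sum, Finset.card_univ, Fintype.card_fin,
      nsmul_eq_mul]
    field_simp
    ring
  have hC : erExp n p (fun G => 3 * (∑ v, if CyclicAt G v then 1 else 0) + 1) ≤
      3 * (n * (c ^ 2 * p / (1 - c) ^ 2)) + 1 := by
    rw [erExp_add, erExp_const_mul, erExp_sum, erExp_one]
    have := Finset.sum_le_card_nsmul Finset.univ _ _
      fun v _ => prob_cyclicAt_le hp₀ hp₁ hc₀ hc₁ hc v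
    rw [Finset.card_univ, Fintype.card_fin, nsmul_eq_mul] at this
    simp only [prob] at this
    linarith
  rw [hE] at h
  have h' := div_le_div_of_nonneg_right (h.trans hC) hn0.le
  rw [← abs_of_pos hn0, ← abs_div, abs_of_pos hn0, sub_div, mul_div_cancel_left₀ _ hn0.ne'] at h'
  refine h'.trans (le_of_eq ?_)
  field_simp

lemma legFraction_le (hc₀ : 0 ≤ c) (hc₁ : c < 1) (hn : 1 ≤ n) (k : ℕ) :
    legFraction (c / n) n k ≤ c ^ k / k.factorial := by
  have hn1 : (1 : ℝ) ≤ n := by exact_mod_cast hn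
  have hp₀ : 0 ≤ c / n := by positivity
  have hp₁ : c / n ≤ 1 := (div_le_one (by linarith)).2 (by linarith)
  have h : ∀ v : Fin n, prob (c / n) (fun G => ndeg G v = k ∧ HasLeg G v) ≤
      c ^ k / k.factorial := by
    intro v
    refine (prob_mono hp₀ hp₁ fun G h => h.1).trans ?_
    rw [prob_ndeg_eq]
    have h1 : (1 - c / n) ^ (n - 1 - k) ≤ 1 := pow_le_one₀ (by linarith) (by linarith)
    have h2 : ((n - 1).choose k : ℝ) ≤ (n : ℝ) ^ k / k.factorial :=
      (Nat.choose_le_pow_div k (n - 1)).trans (by gcongr; simp)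
    calc _ ≤ (n : ℝ) ^ k / k.factorial * (c / n) ^ k * 1 := by gcongr
      _ = c ^ k / k.factorial := by
        rw [div_pow]
        field_simp
  rw [legFraction, div_le_iff₀ (by linarith)]
  refine (Finset.sum_le_card_nsmul _ _ _ fun v _ => h v).trans (le_of_eq ?_)
  rw [Finset.card_univ, Fintype.card_fin, nsmul_eq_mul, mul_comm]

lemma abs_legFraction_sub_le (hp₀ : 0 ≤ p) (hp₁ : p ≤ 1) (hc₀ : 0 ≤ c) (hc₁ : c < 1)
    (hc : n * p ≤ c) (hn : 1 ≤ n) (k : ℕ) :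
    |legFraction p n k - (((n - 1).choose k : ℝ) * p ^ k * (1 - p) ^ (n - 1 - k) -
      ((n - 1).choose k : ℝ) * p ^ k * (1 - p) ^ (n - 1 - k) *
        ∑ j ∈ Finset.range (k + 1), (k.choose j : ℝ) * ((-1) ^ j * legProb p (n - 1) j))| ≤
      (2 ^ k + 1) * (c ^ 2 * p / (1 - c) ^ 2) := by
  have hn0 : (0 : ℝ) < n := by exact_mod_cast hn
  set H := ((n - 1).choose k : ℝ) * p ^ k * (1 - p) ^ (n - 1 - k) -
      ((n - 1).choose k : ℝ) * p ^ k * (1 - p) ^ (n - 1 - k) *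
        ∑ j ∈ Finset.range (k + 1), (k.choose j : ℝ) * ((-1) ^ j * legProb p (n - 1) j) with hH
  have h : ∀ v : Fin n, |prob p (fun G => ndeg G v = k ∧ HasLeg G v) - H| ≤
      (2 ^ k + 1) * (c ^ 2 * p / (1 - c) ^ 2) := by
    intro v
    have h1 := abs_prob_noLeg_sub_le hp₀ hp₁ v k
    have h2 := prob_add_not (p := p) (fun G => ndeg G v = k) (fun G => HasLeg G v)
    have h3 := mul_le_mul_of_nonneg_left (prob_cyclicAt_le hp₀ hp₁ hc₀ hc₁ hc v)
      (show (0 : ℝ) ≤ 2 ^ k + 1 by positivity)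
    rw [prob_ndeg_eq] at h2
    rw [abs_sub_comm] at h1
    refine le_trans (le_of_eq ?_) (h1.trans h3)
    congr 1
    rw [hH, ← h2]
    ring
  have h1 : legFraction p n k - H =
      (∑ v : Fin n, (prob p (fun G => ndeg G v = k ∧ HasLeg G v) - H)) / n := by
    rw [Finset.sum_sub_distrib, Finset.sum_const, Finset.card_univ, Fintype.card_fin,
      nsmul_eq_mul, legFraction]
    field_simp
  rw [h1, abs_div, abs_of_pos hn0, div_le_iff₀ hn0]
  refine (Finset.abs_sum_le_sum_abs _ _).trans
    ((Finset.sum_le_card_nsmul _ _ _ fun v _ => h v).trans (le_of_eq ?_))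
  rw [Finset.card_univ, Fintype.card_fin, nsmul_eq_mul, mul_comm]

lemma tendsto_legFraction (hc₀ : 0 < c) (hc₁ : c < 1) (k : ℕ) :
    Tendsto (fun n : ℕ => legFraction (c / n) n k) atTop
      (𝓝 (Real.exp (-c) * c ^ k / k.factorial -
        Real.exp (-c) * c ^ k / k.factorial *
          (1 - Real.exp (-c) / (1 - c * Real.exp (-c))) ^ k)) := by
  refine ((tendsto_binomial c k).sub (tendsto_noLeg hc₀ hc₁ k)).congr_dist ?_
  have h0 : Tendsto (fun n : ℕ => (2 ^ k + 1) * (c ^ 2 * (c / n) / (1 - c) ^ 2)) atTop (𝓝 0) := by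
    simpa using (((tendsto_const_div_atTop_nhds_zero_nat c).const_mul (c ^ 2)).div_const
      ((1 - c) ^ 2)).const_mul ((2 : ℝ) ^ k + 1)
  refine squeeze_zero' (Eventually.of_forall fun n => dist_nonneg) ?_ h0
  filter_upwards [eventually_ge_atTop 1] with n hn
  have hn1 : (1 : ℝ) ≤ n := by exact_mod_cast hn
  rw [dist_comm, Real.dist_eq]
  exact abs_legFraction_sub_le (by positivity) ((div_le_one (by linarith)).2 (by linarith)) hc₀.le
    hc₁ (by field_simp; rfl) hn k

lemma tendsto_tsum_legFraction (hc₀ : 0 < c) (hc₁ : c < 1) :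
    Tendsto (fun n : ℕ => ∑' k, if 3 ≤ k then legFraction (c / n) n k else 0) atTop
      (𝓝 (∑' k : ℕ, if 3 ≤ k then Real.exp (-c) * c ^ k / k.factorial -
        Real.exp (-c) * c ^ k / k.factorial *
          (1 - Real.exp (-c) / (1 - c * Real.exp (-c))) ^ k else 0)) := by
  refine tendsto_tsum_of_dominated_convergence (Real.summable_pow_div_factorial c) ?_ ?_
  · intro k
    split_ifs
    · exact tendsto_legFraction hc₀ hc₁ k
    · exact tendsto_const_nhds
  · filter_upwards [eventually_ge_atTop 1] with n hn k
    have hn1 : (1 : ℝ) ≤ n := by exact_mod_cast hn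
    split_ifs
    · rw [Real.norm_eq_abs, abs_of_nonneg (legFraction_nonneg (by positivity)
        ((div_le_one (by linarith)).2 (by linarith)) _ _)]
      exact legFraction_le hc₀.le hc₁ hn k
    · rw [norm_zero]
      positivity

lemma tsum_geometric_tail (hc₀ : 0 < c) (hc₁ : c < 1) :
    (∑' k : ℕ, if 2 ≤ k then (1 / 2) * c ^ (k - 1) * Real.exp (-((k : ℝ) - 1) * c) else 0) =
      (1 / 2) * (c * Real.exp (-c) / (1 - c * Real.exp (-c))) := by
  have hexp : Real.exp (-c) < 1 := Real.exp_lt_one_iff.2 (by linarith)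
  have hexp₀ := Real.exp_pos (-c)
  have hx₁ : c * Real.exp (-c) < 1 := by nlinarith
  have h := (hasSum_geometric_of_lt_one (by positivity) hx₁).mul_left (1 / 2 * (c * Real.exp (-c)))
  have h' : HasSum (fun k : ℕ => if 2 ≤ k + 2 then
      (1 / 2) * c ^ (k + 2 - 1) * Real.exp (-(((k + 2 : ℕ) : ℝ) - 1) * c) else 0)
      (1 / 2 * (c * Real.exp (-c)) * (1 - c * Real.exp (-c))⁻¹) := by
    refine h.congr_fun fun k => ?_
    rw [if_pos (by omega), show k + 2 - 1 = k + 1 by omega, mul_pow, ← Real.exp_nat_mul,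
      show -(((k + 2 : ℕ) : ℝ) - 1) * c = (k : ℝ) * -c + -c by push_cast; ring, Real.exp_add]
    ring
  refine ((hasSum_nat_add_iff (f := fun k : ℕ => if 2 ≤ k then
    (1 / 2) * c ^ (k - 1) * Real.exp (-((k : ℝ) - 1) * c) else 0) 2).1 h').tsum_eq.trans ?_
  simp [Finset.sum_range_succ]
  ring

end Assembly

/-- for `G_n ∈ G(n, c/n)` with `0 < c < 1`,
`E[β(G_n)] = n e^{−c}(1 + c − Σ_{k≥3} (c^k/k!)(1 − ((1−(c+1)e^{−c})/(1−ce^{−c}))^k)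
− Σ_{k≥2} (1/2) c^{k−1} e^{−(k−1)c})(1+o(1))`. -/
theorem er_metricDim_expectation_series (c : ℝ) (hc0 : 0 < c) (hc1 : c < 1) :
    Tendsto (fun n : ℕ => erExp n (c / n) betaR / n) atTop
      (𝓝 (Real.exp (-c) * (1 + c -
        (∑' k : ℕ, if 3 ≤ k then
          c ^ k / (Nat.factorial k) *
            (1 - ((1 - (c + 1) * Real.exp (-c)) / (1 - c * Real.exp (-c))) ^ k)
          else 0) -
        (∑' k : ℕ, if 2 ≤ k then
          (1 / 2) * c ^ (k - 1) * Real.exp (-((k : ℝ) - 1) * c) else 0)))) := by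
  have hexp : Real.exp (-c) < 1 := Real.exp_lt_one_iff.2 (by linarith)
  have hexp₀ := Real.exp_pos (-c)
  have hx₁ : c * Real.exp (-c) < 1 := by nlinarith
  have hq : 1 - Real.exp (-c) / (1 - c * Real.exp (-c)) =
      (1 - (c + 1) * Real.exp (-c)) / (1 - c * Real.exp (-c)) := by
    rw [eq_div_iff (by linarith), sub_mul, div_mul_cancel₀ _ (by linarith)]
    ring
  have hmain := (((tendsto_binomial c 0).add (tendsto_binomial c 1)).sub
    ((tendsto_legFraction hc0 hc1 1).const_mul (1 / 2))).sub (tendsto_tsum_legFraction hc0 hc1)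
  have hlim := hmain.congr_dist (f₂ := fun n : ℕ => erExp n (c / n) betaR / n) ?_
  · convert hlim using 2
    have hT : (∑' k : ℕ, if 3 ≤ k then Real.exp (-c) * c ^ k / k.factorial -
        Real.exp (-c) * c ^ k / k.factorial *
          (1 - Real.exp (-c) / (1 - c * Real.exp (-c))) ^ k else 0) =
        Real.exp (-c) * ∑' k : ℕ, if 3 ≤ k then c ^ k / (Nat.factorial k) *
          (1 - ((1 - (c + 1) * Real.exp (-c)) / (1 - c * Real.exp (-c))) ^ k) else 0 := by
      rw [← tsum_mul_left]
      refine tsum_congr fun k => ?_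
      rw [hq]
      split_ifs <;> ring
    rw [hT, tsum_geometric_tail hc0 hc1]
    simp only [Nat.factorial_zero, Nat.factorial_one, Nat.cast_one, pow_zero, pow_one, div_one]
    ring
  · have h0 : Tendsto (fun n : ℕ => 3 * (c ^ 2 * (c / n) / (1 - c) ^ 2) + 1 / (n : ℝ)) atTop
        (𝓝 0) := by
      simpa using ((((tendsto_const_div_atTop_nhds_zero_nat c).const_mul (c ^ 2)).div_const
        ((1 - c) ^ 2)).const_mul (3 : ℝ)).add tendsto_one_div_atTop_nhds_zero_nat
    refine squeeze_zero' (Eventually.of_forall fun n => dist_nonneg) ?_ h0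
    filter_upwards [eventually_ge_atTop 2] with n hn
    have hn1 : (2 : ℝ) ≤ n := by exact_mod_cast hn
    rw [dist_comm, Real.dist_eq]
    exact abs_erExp_betaR_sub_le (by positivity) ((div_le_one (by linarith)).2 (by linarith))
      hc0.le hc1 (by field_simp; rfl) hn

end MetricDimPaper
end
end

section
/- Fix 0 < c < 1 and let G_n ∈ G(n, c/n). Then Var[β(G_n)] = Θ(n); that is, there exist constants 0 < c_1 ≤ c_2 and N such that c_1 n ≤ Var[β(G_n)] ≤ c_2 n for all n ≥ N. -/
open scoped Classical BigOperators
open Filter Topology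

noncomputable section

namespace MetricDimPaper

/-- Expectation of `f` over a random subset of `E` containing each element independently
with probability `p`. -/
def subsetExp {E : Type*} [Fintype E] (p : ℝ) (f : Finset E → ℝ) : ℝ :=
  ∑ s : Finset E, p ^ s.card * (1 - p) ^ (Fintype.card E - s.card) * f s

/-- Average of `f` over the resampling of the coordinate `e`. -/
def resample {E : Type*} [DecidableEq E] (p : ℝ) (e : E) (f : Finset E → ℝ) (s : Finset E) : ℝ :=
  p * f (insert e s) + (1 - p) * f (s.erase e)

/-- Discrete derivative of `f` in the coordinate `e`. -/
def discreteDeriv {E : Type*} [DecidableEq E] (e : E) (f : Finset E → ℝ) (s : Finset E) : ℝ :=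
  f (insert e s) - f (s.erase e)

theorem subsetExp_add {E : Type*} [Fintype E] (p : ℝ) (f g : Finset E → ℝ) :
    subsetExp p (fun s => f s + g s) = subsetExp p f + subsetExp p g := by
  simp [subsetExp, mul_add, Finset.sum_add_distrib]

theorem subsetExp_sub {E : Type*} [Fintype E] (p : ℝ) (f g : Finset E → ℝ) :
    subsetExp p (fun s => f s - g s) = subsetExp p f - subsetExp p g := by
  simp [subsetExp, mul_sub, Finset.sum_sub_distrib]

theorem subsetExp_const_mul {E : Type*} [Fintype E] (p a : ℝ) (f : Finset E → ℝ) :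
    subsetExp p (fun s => a * f s) = a * subsetExp p f := by
  simp only [subsetExp, Finset.mul_sum]
  exact Finset.sum_congr rfl fun s _ => by ring

theorem subsetExp_const {E : Type*} [Fintype E] (p a : ℝ) :
    subsetExp (E := E) p (fun _ => a) = a := by
  have h := Fintype.sum_pow_mul_eq_add_pow E p (1 - p)
  simp only [subsetExp, ← Finset.sum_mul, h]
  simp

theorem subsetExp_sum {E ι : Type*} [Fintype E] (p : ℝ) (t : Finset ι) (f : ι → Finset E → ℝ) :
    subsetExp p (fun s => ∑ i ∈ t, f i s) = ∑ i ∈ t, subsetExp p (f i) := by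
  simp only [subsetExp, Finset.mul_sum]
  exact Finset.sum_comm

theorem subsetExp_mono {E : Type*} [Fintype E] {p : ℝ} (hp0 : 0 ≤ p) (hp1 : p ≤ 1)
    {f g : Finset E → ℝ} (h : ∀ s, f s ≤ g s) : subsetExp p f ≤ subsetExp p g := by
  have : 0 ≤ 1 - p := sub_nonneg.2 hp1
  exact Finset.sum_le_sum fun s _ => mul_le_mul_of_nonneg_left (h s) (by positivity)

theorem subsetExp_nonneg {E : Type*} [Fintype E] {p : ℝ} (hp0 : 0 ≤ p) (hp1 : p ≤ 1)
    {f : Finset E → ℝ} (h : ∀ s, 0 ≤ f s) : 0 ≤ subsetExp p f := by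
  simpa [subsetExp_const] using subsetExp_mono hp0 hp1 h

/-- A permutation of the coordinates preserves the law of the random subset. -/
theorem subsetExp_map_equiv {E : Type*} [Fintype E] (p : ℝ) (σ : E ≃ E) (f : Finset E → ℝ) :
    subsetExp p (fun s => f (s.map σ.toEmbedding)) = subsetExp p f := by
  refine Fintype.sum_equiv σ.finsetCongr _ _ fun s => ?_
  simp

theorem subsetExp_eq_sum_powerset_erase {E : Type*} [Fintype E] [DecidableEq E] (p : ℝ) (e : E)
    (f : Finset E → ℝ) :
    subsetExp p f = ∑ t ∈ (Finset.univ.erase e).powerset,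
      p ^ t.card * (1 - p) ^ (Fintype.card E - 1 - t.card) *
        (p * f (insert e t) + (1 - p) * f t) := by
  have hu : (Finset.univ : Finset (Finset E)) = (insert e (Finset.univ.erase e)).powerset := by
    rw [Finset.insert_erase (Finset.mem_univ e)]; simp
  rw [subsetExp, hu, Finset.sum_powerset_insert (Finset.notMem_erase e _),
    ← Finset.sum_add_distrib]
  refine Finset.sum_congr rfl fun t ht => ?_
  have het : e ∉ t := fun h => Finset.notMem_erase e _ (Finset.mem_powerset.1 ht h)
  have hc : t.card ≤ Fintype.card E - 1 := by
    simpa [Finset.card_erase_of_mem] using Finset.card_le_card (Finset.mem_powerset.1 ht)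
  have hpos : 0 < Fintype.card E := Fintype.card_pos_iff.2 ⟨e⟩
  rw [Finset.card_insert_of_notMem het,
    show Fintype.card E - t.card = (Fintype.card E - 1 - t.card) + 1 by omega,
    show Fintype.card E - (t.card + 1) = Fintype.card E - 1 - t.card by omega]
  ring

theorem subsetExp_resample {E : Type*} [Fintype E] [DecidableEq E] (p : ℝ) (e : E)
    (f : Finset E → ℝ) : subsetExp p (resample p e f) = subsetExp p f := by
  rw [subsetExp_eq_sum_powerset_erase p e, subsetExp_eq_sum_powerset_erase p e f]
  refine Finset.sum_congr rfl fun t ht => ?_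
  have het : e ∉ t := fun h => Finset.notMem_erase e _ (Finset.mem_powerset.1 ht h)
  simp only [resample, Finset.insert_idem, Finset.erase_insert het, Finset.erase_eq_of_notMem het]
  ring

theorem subsetExp_sq_sub_resample_sq {E : Type*} [Fintype E] [DecidableEq E] (p : ℝ) (e : E)
    (f : Finset E → ℝ) :
    subsetExp p (fun s => f s ^ 2) - subsetExp p (fun s => resample p e f s ^ 2) =
      p * (1 - p) * subsetExp p (fun s => discreteDeriv e f s ^ 2) := by
  rw [← subsetExp_resample p e (fun s => f s ^ 2), ← subsetExp_sub, ← subsetExp_const_mul]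
  congr 1
  funext s
  simp only [resample, discreteDeriv]
  ring

theorem subsetExp_resample_sq_le {E : Type*} [Fintype E] [DecidableEq E] {p : ℝ} (hp0 : 0 ≤ p)
    (hp1 : p ≤ 1) (e : E) (f : Finset E → ℝ) :
    subsetExp p (fun s => resample p e f s ^ 2) ≤ subsetExp p (fun s => f s ^ 2) := by
  have h := subsetExp_sq_sub_resample_sq p e f
  have h2 : 0 ≤ subsetExp p (fun s => discreteDeriv e f s ^ 2) :=
    subsetExp_nonneg hp0 hp1 fun s => sq_nonneg _
  have : 0 ≤ p * (1 - p) * subsetExp p (fun s => discreteDeriv e f s ^ 2) :=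
    mul_nonneg (mul_nonneg hp0 (sub_nonneg.2 hp1)) h2
  linarith

theorem discreteDeriv_resample {E : Type*} [DecidableEq E] (p : ℝ) {d e : E} (h : d ≠ e)
    (f : Finset E → ℝ) :
    discreteDeriv d (resample p e f) = resample p e (discreteDeriv d f) := by
  funext s
  simp only [discreteDeriv, resample, Finset.insert_comm d e s,
    Finset.erase_insert_of_ne h, Finset.erase_right_comm (a := e) (b := d),
    Finset.erase_insert_of_ne h.symm]
  ring

theorem exists_average_over {E : Type*} [Fintype E] [DecidableEq E] {p : ℝ} (hp0 : 0 ≤ p)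
    (hp1 : p ≤ 1) (f : Finset E → ℝ) (T : Finset E) :
    ∃ g : Finset E → ℝ, (∀ e ∈ T, ∀ s, g (insert e s) = g (s.erase e)) ∧
      subsetExp p g = subsetExp p f ∧
      subsetExp p (fun s => f s ^ 2) - subsetExp p (fun s => g s ^ 2) ≤
        ∑ e ∈ T, p * (1 - p) * subsetExp p (fun s => discreteDeriv e f s ^ 2) ∧
      ∀ e ∉ T, subsetExp p (fun s => discreteDeriv e g s ^ 2) ≤
        subsetExp p (fun s => discreteDeriv e f s ^ 2) := by
  induction T using Finset.induction_on with
  | empty => exact ⟨f, by simp, rfl, by simp, fun _ _ => le_rfl⟩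
  | insert e T he ih =>
    obtain ⟨g, hg, hexp, hvar, hder⟩ := ih
    refine ⟨resample p e g, ?_, ?_, ?_, ?_⟩
    · intro d hd s
      by_cases hde : d = e
      · subst hde
        have : insert d (s.erase d) = insert d s := by
          ext x
          by_cases hx : x = d <;> simp [hx]
        simp [resample, this]
      · have hdT : d ∈ T := (Finset.mem_insert.1 hd).resolve_left hde
        simp only [resample, Finset.insert_comm e d s, hg d hdT,
          Finset.erase_insert_of_ne hde, Finset.erase_insert_of_ne (Ne.symm hde),
          Finset.erase_right_comm (a := d) (b := e)]
    · rw [subsetExp_resample, hexp]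
    · rw [Finset.sum_insert he]
      have h1 := subsetExp_sq_sub_resample_sq p e g
      have h2 := mul_le_mul_of_nonneg_left (hder e he) (mul_nonneg hp0 (sub_nonneg.2 hp1))
      linarith
    · intro d hd
      rw [Finset.mem_insert, not_or] at hd
      rw [discreteDeriv_resample p hd.1]
      exact (subsetExp_resample_sq_le hp0 hp1 e _).trans (hder d hd.2)

/-- The Efron–Stein inequality for functions of a random subset. -/
theorem subsetExp_variance_le {E : Type*} [Fintype E] [DecidableEq E] {p : ℝ} (hp0 : 0 ≤ p)
    (hp1 : p ≤ 1) (f : Finset E → ℝ) :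
    subsetExp p (fun s => (f s - subsetExp p f) ^ 2) ≤
      ∑ e, p * (1 - p) * subsetExp p (fun s => discreteDeriv e f s ^ 2) := by
  obtain ⟨g, hg, hexp, hvar, -⟩ := exists_average_over hp0 hp1 f Finset.univ
  have hconst : g = fun _ => g ∅ := by
    funext s
    induction s using Finset.induction_on with
    | empty => rfl
    | insert e s he ih => rw [hg e (Finset.mem_univ e), Finset.erase_eq_of_notMem he, ih]
  rw [hconst, subsetExp_const] at hexp
  rw [hconst, subsetExp_const, hexp] at hvar
  set μ := subsetExp p f with hμ
  have : (fun s => (f s - μ) ^ 2) = fun s => (f s ^ 2 - 2 * μ * f s) + μ ^ 2 := by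
    funext s; ring
  rw [this, subsetExp_add, subsetExp_sub, subsetExp_const_mul, subsetExp_const, ← hμ]
  linarith

theorem subsetExp_eq_of_split {E : Type*} [Fintype E] [DecidableEq E] {p : ℝ} (e : E)
    {f f₀ f₁ : Finset E → ℝ} (h₁ : ∀ s, f (insert e s) = f₁ s)
    (h₀ : ∀ s, f (s.erase e) = f₀ s) :
    subsetExp p f = p * subsetExp p f₁ + (1 - p) * subsetExp p f₀ := by
  rw [← subsetExp_resample p e f, ← subsetExp_const_mul, ← subsetExp_const_mul, ← subsetExp_add]
  congr 1
  funext s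
  rw [resample, h₁, h₀]

/-- The probability that the random subset has a prescribed trace on `I`. -/
theorem subsetExp_trace {E : Type*} [Fintype E] [DecidableEq E] (p : ℝ) (K I : Finset E) :
    subsetExp p (fun s => if ∀ e ∈ I, e ∈ s ↔ e ∈ K then 1 else 0) =
      p ^ (I.filter (· ∈ K)).card * (1 - p) ^ (I.filter (· ∉ K)).card := by
  induction I using Finset.induction_on with
  | empty => simp [subsetExp_const]
  | insert e I he ih =>
    have hins : ∀ s : Finset E, (∀ d ∈ I, d ∈ insert e s ↔ d ∈ K) ↔ ∀ d ∈ I, d ∈ s ↔ d ∈ K :=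
      fun s => forall₂_congr fun d hd => by
        have : d ≠ e := fun h => he (h ▸ hd)
        simp [this]
    have hers : ∀ s : Finset E, (∀ d ∈ I, d ∈ s.erase e ↔ d ∈ K) ↔ ∀ d ∈ I, d ∈ s ↔ d ∈ K :=
      fun s => forall₂_congr fun d hd => by
        have : d ≠ e := fun h => he (h ▸ hd)
        simp [this]
    by_cases hK : e ∈ K
    · rw [subsetExp_eq_of_split e
        (f₁ := fun s => if ∀ e ∈ I, e ∈ s ↔ e ∈ K then 1 else 0) (f₀ := fun _ => 0), ih,
        subsetExp_const, Finset.filter_insert, if_pos hK, Finset.filter_insert, if_neg (by simpa),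
        Finset.card_insert_of_notMem (by simp [he])]
      · ring
      · intro s
        simp only [Finset.forall_mem_insert, hins]
        simp [hK]
      · intro s
        simp [hK]
    · rw [subsetExp_eq_of_split e
        (f₀ := fun s => if ∀ e ∈ I, e ∈ s ↔ e ∈ K then 1 else 0) (f₁ := fun _ => 0), ih,
        subsetExp_const, Finset.filter_insert, if_neg hK, Finset.filter_insert, if_pos hK,
        Finset.card_insert_of_notMem (by simp [he])]
      · ring
      · intro s
        simp [hK]
      · intro s
        simp only [Finset.forall_mem_insert, hers]
        simp [hK]

/-- Every edge of `G` leaving a vertex outside `D` stays outside `D` and is an edge of `H`. -/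
def EmbedsOff {V : Type*} (D : Set V) (G H : SimpleGraph V) : Prop :=
  ∀ x ∉ D, ∀ y, G.Adj x y → y ∉ D ∧ H.Adj x y

theorem EmbedsOff.exists_walk {V : Type*} {D : Set V} {G H : SimpleGraph V} (h : EmbedsOff D G H)
    {x y : V} (p : G.Walk x y) (hx : x ∉ D) : y ∉ D ∧ ∃ q : H.Walk x y, q.length = p.length := by
  induction p with
  | nil => exact ⟨hx, .nil, rfl⟩
  | cons hadj p ih =>
    obtain ⟨hz, hH⟩ := h _ hx _ hadj
    obtain ⟨hy, q, hq⟩ := ih hz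
    exact ⟨hy, .cons hH q, by simp [hq]⟩

theorem EmbedsOff.edist_le {V : Type*} {D : Set V} {G H : SimpleGraph V} (h : EmbedsOff D G H)
    {x : V} (hx : x ∉ D) (y : V) : H.edist x y ≤ G.edist x y := by
  by_cases hr : G.edist x y = ⊤
  · simp [hr]
  · obtain ⟨p, hp⟩ := SimpleGraph.exists_walk_of_edist_ne_top hr
    obtain ⟨-, q, hq⟩ := h.exists_walk p hx
    rw [← hp, ← hq]
    exact SimpleGraph.edist_le q

theorem EmbedsOff.edist_eq_top {V : Type*} {D : Set V} {G H : SimpleGraph V}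
    (h : EmbedsOff D G H) {x y : V} (hx : x ∉ D) (hy : y ∈ D) : G.edist x y = ⊤ := by
  by_contra hr
  obtain ⟨p, -⟩ := SimpleGraph.exists_walk_of_edist_ne_top hr
  exact (h.exists_walk p hx).1 hy

/-- A resolving set can be transferred between graphs that agree off `D`, provided the vertices
of `D` get resolved separately. -/
theorem Resolves.of_embedsOff {V : Type*} {D : Set V} {G H : SimpleGraph V} {R R' : Set V}
    (hR : Resolves G R) (hGH : EmbedsOff D G H) (hHG : EmbedsOff D H G) (hRR' : R \ D ⊆ R')
    (hD : ∀ u ∈ D, ∀ v, u ≠ v → ∃ w ∈ R', H.edist u w ≠ H.edist v w) : Resolves H R' := by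
  intro u v huv
  by_cases hu : u ∈ D
  · exact hD u hu v huv
  by_cases hv : v ∈ D
  · obtain ⟨w, hw, hne⟩ := hD v hv u huv.symm
    exact ⟨w, hw, hne.symm⟩
  obtain ⟨w, hw, hne⟩ := hR u v huv
  by_cases hwD : w ∈ D
  · exact absurd ((hGH.edist_eq_top hu hwD).trans (hGH.edist_eq_top hv hwD).symm) hne
  · refine ⟨w, hRR' ⟨hw, hwD⟩, ?_⟩
    rwa [le_antisymm (hGH.edist_le hu w) (hHG.edist_le hu w),
      le_antisymm (hGH.edist_le hv w) (hHG.edist_le hv w)]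

theorem resolves_univ {V : Type*} (G : SimpleGraph V) : Resolves G Set.univ := fun u v huv =>
  ⟨u, trivial, fun h => huv (by
    rw [SimpleGraph.edist_self] at h
    exact (SimpleGraph.edist_eq_zero_iff.1 h.symm).symm)⟩

theorem exists_resolves_ncard_eq {V : Type*} (hV : Nat.card V ≠ 1) (G : SimpleGraph V) :
    ∃ R : Set V, R.ncard = metricDim G ∧ Resolves G R := by
  rw [metricDim, if_neg hV]
  exact Nat.sInf_mem (s := {m : ℕ | ∃ R : Set V, R.ncard = m ∧ Resolves G R})
    ⟨_, Set.univ, rfl, resolves_univ G⟩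

theorem metricDim_le {V : Type*} (hV : Nat.card V ≠ 1) {G : SimpleGraph V} {R : Set V}
    (hR : Resolves G R) : metricDim G ≤ R.ncard := by
  rw [metricDim, if_neg hV]
  exact Nat.sInf_le ⟨R, rfl, hR⟩

theorem EmbedsOff.metricDim_le_add {V : Type*} [Finite V] (hV : Nat.card V ≠ 1) {D : Set V}
    {G H : SimpleGraph V} (hGH : EmbedsOff D G H) (hHG : EmbedsOff D H G) :
    metricDim H ≤ metricDim G + D.ncard := by
  obtain ⟨R, hRc, hR⟩ := exists_resolves_ncard_eq hV G
  have : Resolves H (R ∪ D) := hR.of_embedsOff hGH hHG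
    (Set.sdiff_subset.trans Set.subset_union_left) fun u hu v huv => ⟨u, Or.inr hu, fun h => huv (by
      rw [SimpleGraph.edist_self] at h
      exact (SimpleGraph.edist_eq_zero_iff.1 h.symm).symm)⟩
  calc metricDim H ≤ (R ∪ D).ncard := metricDim_le hV this
    _ ≤ R.ncard + D.ncard := Set.ncard_union_le _ _
    _ = _ := by rw [hRc]

theorem edist_le_of_twins {V : Type*} {G : SimpleGraph V} {x y : V}
    (h : ∀ z, G.Adj x z → G.Adj y z) {w : V} (hw : w ≠ x) : G.edist y w ≤ G.edist x w := by
  by_cases hr : G.edist x w = ⊤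
  · simp [hr]
  · obtain ⟨p, hp⟩ := SimpleGraph.exists_walk_of_edist_ne_top hr
    rw [← hp]
    cases p with
    | nil => exact absurd rfl hw
    | cons hadj p => simpa using SimpleGraph.edist_le (.cons (h _ hadj) p)

theorem Resolves.mem_or_mem_of_twins {V : Type*} {G : SimpleGraph V} {R : Set V}
    (hR : Resolves G R) {x y : V} (hxy : x ≠ y) (h : ∀ z, G.Adj x z ↔ G.Adj y z) :
    x ∈ R ∨ y ∈ R := by
  obtain ⟨w, hw, hne⟩ := hR x y hxy
  by_contra! hc
  have hwx : w ≠ x := fun e => hc.1 (e ▸ hw)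
  have hwy : w ≠ y := fun e => hc.2 (e ▸ hw)
  exact hne (le_antisymm (edist_le_of_twins (fun z => (h z).2) hwy)
    (edist_le_of_twins (fun z => (h z).1) hwx))

/-- `v` spans a component of `G` which is the path `v 0 - v 1 - v 2 - v 3`. -/
def IsPathComponent {V : Type*} (G : SimpleGraph V) (v : Fin 4 → V) : Prop :=
  ∀ i z, G.Adj (v i) z ↔ ∃ j, z = v j ∧ ((i : ℕ) + 1 = j ∨ (j : ℕ) + 1 = i)

/-- `v` spans a component of `G` which is a star centered at `v 1`. -/
def IsStarComponent {V : Type*} (G : SimpleGraph V) (v : Fin 4 → V) : Prop :=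
  ∀ i z, G.Adj (v i) z ↔ ∃ j, z = v j ∧ i ≠ j ∧ (i = 1 ∨ j = 1)

theorem IsPathComponent.edist_eq {V : Type*} {G : SimpleGraph V} {v : Fin 4 → V}
    (h : IsPathComponent G v) (hv : Function.Injective v) (i : Fin 4) :
    G.edist (v i) (v 0) = (i : ℕ) := by
  have hadj : ∀ i j : Fin 4, (i : ℕ) + 1 = j ∨ (j : ℕ) + 1 = i → G.Adj (v i) (v j) :=
    fun i j hij => (h i _).2 ⟨j, rfl, hij⟩
  apply le_antisymm
  · fin_cases i
    · simp
    · exact SimpleGraph.edist_le (.cons (hadj 1 0 (by decide)) .nil)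
    · exact SimpleGraph.edist_le (.cons (hadj 2 1 (by decide)) (.cons (hadj 1 0 (by decide)) .nil))
    · exact SimpleGraph.edist_le (.cons (hadj 3 2 (by decide))
        (.cons (hadj 2 1 (by decide)) (.cons (hadj 1 0 (by decide)) .nil)))
  · have key : ∀ x y (p : G.Walk x y) (i : Fin 4), x = v i → y = v 0 → (i : ℕ) ≤ p.length := by
      intro x y p
      induction p with
      | nil =>
        intro i hi h0
        simp [hv (hi.symm.trans h0)]
      | cons hxz p ih =>
        intro i hi h0
        subst hi
        obtain ⟨j, hj, hij⟩ := (h i _).1 hxz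
        have := ih j hj h0
        rw [SimpleGraph.Walk.length_cons]
        omega
    refine le_iInf fun p => ?_
    exact_mod_cast key _ _ p i rfl rfl

/-- Turning a star component into a path component lowers the metric dimension. -/
theorem metricDim_add_one_le {V : Type*} [Finite V] (hV : Nat.card V ≠ 1) {G H : SimpleGraph V}
    {v : Fin 4 → V} (hv : Function.Injective v) (hG : IsStarComponent G v)
    (hH : IsPathComponent H v) (hGH : ∀ x ∉ Set.range v, ∀ y, G.Adj x y ↔ H.Adj x y) :
    metricDim H + 1 ≤ metricDim G := by
  obtain ⟨R, hRc, hR⟩ := exists_resolves_ncard_eq hV G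
  have hoffG : EmbedsOff (Set.range v) G H := fun x hx y hxy => ⟨by
    rintro ⟨i, rfl⟩
    obtain ⟨j, rfl, -⟩ := (hG i x).1 hxy.symm
    exact hx ⟨j, rfl⟩, (hGH x hx y).1 hxy⟩
  have hoffH : EmbedsOff (Set.range v) H G := fun x hx y hxy => ⟨by
    rintro ⟨i, rfl⟩
    obtain ⟨j, rfl, -⟩ := (hH i x).1 hxy.symm
    exact hx ⟨j, rfl⟩, (hGH x hx y).2 hxy⟩
  have hres : Resolves H (insert (v 0) (R \ Set.range v)) := by
    refine hR.of_embedsOff hoffG hoffH (Set.subset_insert _ _) ?_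
    rintro _ ⟨i, rfl⟩ y hy
    refine ⟨v 0, Set.mem_insert _ _, ?_⟩
    rw [hH.edist_eq hv]
    by_cases hyv : y ∈ Set.range v
    · obtain ⟨j, rfl⟩ := hyv
      rw [hH.edist_eq hv]
      intro hij
      exact hy (congrArg v (Fin.ext (by exact_mod_cast hij)))
    · rw [hoffH.edist_eq_top hyv ⟨0, rfl⟩]
      simp
  have htwin : ∀ i j : Fin 4, i ≠ j → i ≠ 1 → j ≠ 1 → v i ∈ R ∨ v j ∈ R := by
    intro i j hij hi hj
    refine hR.mem_or_mem_of_twins (hv.ne hij) fun z => ?_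
    rw [hG, hG]
    refine exists_congr fun k => and_congr_right fun _ => ?_
    constructor <;> rintro ⟨-, h⟩ <;> rcases h with h | h <;> first | contradiction | skip
    · exact ⟨h ▸ hj, Or.inr h⟩
    · exact ⟨h ▸ hi, Or.inr h⟩
  obtain ⟨i, j, hij, hi, hj⟩ : ∃ i j, i ≠ j ∧ v i ∈ R ∧ v j ∈ R := by
    have h02 := htwin 0 2 (by decide) (by decide) (by decide)
    have h03 := htwin 0 3 (by decide) (by decide) (by decide)
    have h23 := htwin 2 3 (by decide) (by decide) (by decide)
    by_cases h0 : v 0 ∈ R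
    · rcases h23 with h | h
      · exact ⟨0, 2, by decide, h0, h⟩
      · exact ⟨0, 3, by decide, h0, h⟩
    · exact ⟨2, 3, by decide, h02.resolve_left h0, h03.resolve_left h0⟩
  have hsub : {v i, v j} ⊆ R ∩ Set.range v := by
    rintro x (rfl | rfl)
    · exact ⟨hi, i, rfl⟩
    · exact ⟨hj, j, rfl⟩
  have h2 := Set.ncard_le_ncard hsub (Set.toFinite _)
  rw [Set.ncard_pair (hv.ne hij)] at h2
  have h3 := Set.ncard_inter_add_ncard_sdiff_eq_ncard R (Set.range v) (Set.toFinite _)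
  have h4 := metricDim_le hV hres
  have h5 := Set.ncard_insert_le (v 0) (R \ Set.range v)
  omega

/-- The possible edges of a graph on `Fin n`. -/
abbrev PotentialEdge (n : ℕ) : Type := {e : Sym2 (Fin n) // ¬ e.IsDiag}

/-- The graph with a given set of edges. -/
def graphOf {n : ℕ} (s : Finset (PotentialEdge n)) : SimpleGraph (Fin n) where
  Adj u v := ∃ e ∈ s, e.1 = s(u, v)
  symm := ⟨fun _ _ ⟨e, he, h⟩ => ⟨e, he, h.trans Sym2.eq_swap⟩⟩
  loopless := ⟨fun _ ⟨e, _, h⟩ => e.2 (by simp [h])⟩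

theorem graphOf_adj {n : ℕ} {s : Finset (PotentialEdge n)} {u v : Fin n} :
    (graphOf s).Adj u v ↔ ∃ e ∈ s, e.1 = s(u, v) := Iff.rfl

theorem mem_iff_adj {n : ℕ} {s : Finset (PotentialEdge n)} {u v : Fin n}
    (h : ¬ s(u, v).IsDiag) : (⟨s(u, v), h⟩ : PotentialEdge n) ∈ s ↔ (graphOf s).Adj u v := by
  refine ⟨fun hs => ⟨_, hs, rfl⟩, ?_⟩
  rintro ⟨⟨e, he⟩, hs, rfl⟩
  exact hs

theorem graphOf_insert_adj {n : ℕ} {s : Finset (PotentialEdge n)} {e : PotentialEdge n}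
    {u v : Fin n} : (graphOf (insert e s)).Adj u v ↔ e.1 = s(u, v) ∨ (graphOf s).Adj u v := by
  simp [graphOf_adj]

theorem graphOf_erase_adj {n : ℕ} {s : Finset (PotentialEdge n)} {e : PotentialEdge n}
    {u v : Fin n} : (graphOf (s.erase e)).Adj u v ↔ e.1 ≠ s(u, v) ∧ (graphOf s).Adj u v := by
  constructor
  · rintro ⟨d, hd, hdu⟩
    rw [Finset.mem_erase] at hd
    exact ⟨fun he => hd.1 (Subtype.ext (hdu.trans he.symm)), d, hd.2, hdu⟩
  · rintro ⟨hne, d, hd, hdu⟩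
    exact ⟨d, Finset.mem_erase.2 ⟨fun h => hne (h ▸ hdu), hd⟩, hdu⟩

theorem edgeSet_graphOf {n : ℕ} (s : Finset (PotentialEdge n)) :
    (graphOf s).edgeSet = Subtype.val '' (s : Set (PotentialEdge n)) := by
  ext e
  induction e with
  | h u v => rw [SimpleGraph.mem_edgeSet, graphOf_adj]; simp

theorem graphOf_bijective (n : ℕ) : Function.Bijective (graphOf (n := n)) := by
  constructor
  · intro s t hst
    have h := edgeSet_graphOf s
    rw [hst, edgeSet_graphOf] at h
    exact_mod_cast (Subtype.val_injective.image_injective h).symm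
  · intro G
    refine ⟨Finset.univ.filter fun e => e.1 ∈ G.edgeSet, ?_⟩
    ext u v
    rw [graphOf_adj]
    constructor
    · rintro ⟨e, he, hu⟩
      rw [Finset.mem_filter, hu] at he
      exact he.2
    · intro h
      exact ⟨⟨s(u, v), by simpa using h.ne⟩, by simpa using h, rfl⟩

theorem erExp_eq_subsetExp (n : ℕ) (p : ℝ) (f : SimpleGraph (Fin n) → ℝ) :
    erExp n p f = subsetExp p (fun s : Finset (PotentialEdge n) => f (graphOf s)) := by
  rw [erExp, finsum_eq_sum_of_fintype, subsetExp]
  symm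
  refine Fintype.sum_bijective graphOf (graphOf_bijective n) _ _ fun s => ?_
  have hcard : Nat.card (graphOf s).edgeSet = s.card := by
    rw [edgeSet_graphOf, Nat.card_coe_set_eq, Set.ncard_image_of_injective _ Subtype.val_injective,
      Set.ncard_coe_finset]
  have hE : Fintype.card (PotentialEdge n) = n.choose 2 := by
    rw [Sym2.card_subtype_not_diag, Fintype.card_fin]
  rw [erWeight, hcard, hE]

theorem erVar_eq_subsetExp (n : ℕ) (p : ℝ) (f : SimpleGraph (Fin n) → ℝ) :
    erVar n p f = subsetExp p (fun s : Finset (PotentialEdge n) =>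
      (f (graphOf s) - subsetExp p (fun s : Finset (PotentialEdge n) => f (graphOf s))) ^ 2) := by
  rw [erVar, erExp_eq_subsetExp, erExp_eq_subsetExp]

/-- The subgraph of `G` formed by the edges with both ends in `U`. -/
def edgesWithin {V : Type*} (G : SimpleGraph V) (U : Finset V) : SimpleGraph V where
  Adj x y := G.Adj x y ∧ x ∈ U ∧ y ∈ U
  symm := ⟨fun _ _ ⟨h, hx, hy⟩ => ⟨h.symm, hy, hx⟩⟩
  loopless := ⟨fun _ h => h.1.ne rfl⟩

/-- The vertices that can be reached from `A` along edges of `G` inside `U`. -/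
def cluster {V : Type*} (G : SimpleGraph V) (U A : Finset V) : Set V :=
  {x | ∃ a ∈ A, (edgesWithin G U).Reachable a x}

theorem mem_of_reachable {V : Type*} {G : SimpleGraph V} {S : Set V}
    (hS : ∀ x ∈ S, ∀ y, G.Adj x y → y ∈ S) {x y : V} (hx : x ∈ S) (h : G.Reachable x y) :
    y ∈ S := by
  obtain ⟨p⟩ := h
  induction p with
  | nil => exact hx
  | cons hxz p ih => exact ih (hS _ hx _ hxz)

theorem cluster_subset_insert {V : Type*} [DecidableEq V] (G : SimpleGraph V) {U A : Finset V}
    {a : V} (ha : a ∈ A) :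
    cluster G U A ⊆
      insert a (cluster G (U.erase a) (A.erase a ∪ (U.erase a).filter (G.Adj a))) := by
  rintro x ⟨b, hb, hbx⟩
  refine mem_of_reachable (S := insert a (cluster G (U.erase a)
    (A.erase a ∪ (U.erase a).filter (G.Adj a)))) ?_ ?_ hbx
  · intro x hx y hxy
    obtain ⟨hadj, hxU, hyU⟩ := hxy
    by_cases hya : y = a
    · exact Or.inl hya
    refine Or.inr ?_
    have hy' : y ∈ U.erase a := Finset.mem_erase.2 ⟨hya, hyU⟩
    rcases eq_or_ne x a with rfl | hxa
    · exact ⟨y, Finset.mem_union_right _ (Finset.mem_filter.2 ⟨hy', hadj⟩),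
        SimpleGraph.Reachable.refl _⟩
    · obtain ⟨b, hb, hbx⟩ := hx.resolve_left hxa
      exact ⟨b, hb, hbx.trans
        (SimpleGraph.Adj.reachable ⟨hadj, Finset.mem_erase.2 ⟨hxa, hxU⟩, hy'⟩)⟩
  · rcases eq_or_ne b a with rfl | hba
    · exact Or.inl rfl
    · exact Or.inr ⟨b, Finset.mem_union_left _ (Finset.mem_erase.2 ⟨hba, hb⟩),
        SimpleGraph.Reachable.refl _⟩

theorem edgesWithin_graphOf_congr {n : ℕ} {s t : Finset (PotentialEdge n)} {U : Finset (Fin n)}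
    (h : ∀ x ∈ U, ∀ y ∈ U, (graphOf s).Adj x y ↔ (graphOf t).Adj x y) :
    edgesWithin (graphOf s) U = edgesWithin (graphOf t) U := by
  ext x y
  simp only [edgesWithin]
  constructor
  · rintro ⟨hxy, hx, hy⟩; exact ⟨(h x hx y hy).1 hxy, hx, hy⟩
  · rintro ⟨hxy, hx, hy⟩; exact ⟨(h x hx y hy).2 hxy, hx, hy⟩

/-- Revealing the edges from `a` to `B` one at a time. -/
theorem subsetExp_cluster_reveal {n : ℕ} {p y z : ℝ} (hp0 : 0 ≤ p) (hp1 : p ≤ 1) (hy : 1 ≤ y)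
    {U : Finset (Fin n)} {a : Fin n} (ha : a ∉ U)
    (hU : ∀ A ⊆ U, subsetExp p (fun s : Finset (PotentialEdge n) =>
      z ^ (cluster (graphOf s) U A).ncard) ≤ y ^ A.card) (B : Finset (Fin n)) :
    ∀ A ⊆ U, B ⊆ U → subsetExp p (fun s : Finset (PotentialEdge n) =>
      z ^ (cluster (graphOf s) U (A ∪ B.filter ((graphOf s).Adj a))).ncard) ≤
        y ^ A.card * (1 + p * (y - 1)) ^ B.card := by
  induction B using Finset.induction_on with
  | empty =>
    intro A hA _
    simpa using hU A hA
  | insert b B hb ih =>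
    intro A hA hB
    rw [Finset.insert_subset_iff] at hB
    have hba : a ≠ b := fun h => ha (h ▸ hB.1)
    let e : PotentialEdge n := ⟨s(a, b), by simpa using hba⟩
    have hins : ∀ x y, x ∈ U → ∀ s, (graphOf (insert e s)).Adj x y →
        y ∈ U → (graphOf s).Adj x y := by
      intro x y hx s h hy
      refine (graphOf_insert_adj.1 h).resolve_left fun h => ?_
      have : a ∈ s(x, y) := h ▸ Sym2.mem_mk_left a b
      rcases Sym2.mem_iff.1 this with rfl | rfl <;> contradiction
    have hW₁ : ∀ s, edgesWithin (graphOf (insert e s)) U = edgesWithin (graphOf s) U := fun s =>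
      edgesWithin_graphOf_congr fun x hx y hy => ⟨fun h => hins x y hx s h hy,
        fun h => graphOf_insert_adj.2 (Or.inr h)⟩
    have hW₀ : ∀ s, edgesWithin (graphOf (s.erase e)) U = edgesWithin (graphOf s) U := fun s =>
      edgesWithin_graphOf_congr fun x hx y hy => ⟨fun h => (graphOf_erase_adj.1 h).2, fun h => by
        refine graphOf_erase_adj.2 ⟨fun h => ?_, h⟩
        have : a ∈ s(x, y) := h ▸ Sym2.mem_mk_left a b
        rcases Sym2.mem_iff.1 this with rfl | rfl <;> contradiction⟩
    have hne : ∀ x ∈ B, e.1 ≠ s(a, x) := by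
      intro x hx h
      rcases Sym2.eq_iff.1 h with ⟨-, rfl⟩ | ⟨-, h2⟩
      · exact hb hx
      · exact hba h2.symm
    have hF₁ : ∀ s, (insert b B).filter ((graphOf (insert e s)).Adj a) =
        insert b (B.filter ((graphOf s).Adj a)) := by
      intro s
      rw [Finset.filter_insert, if_pos (graphOf_insert_adj.2 (Or.inl rfl))]
      congr 1
      refine Finset.filter_congr fun x hx => ?_
      simp [graphOf_insert_adj, hne x hx]
    have hF₀ : ∀ s, (insert b B).filter ((graphOf (s.erase e)).Adj a) =
        B.filter ((graphOf s).Adj a) := by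
      intro s
      rw [Finset.filter_insert, if_neg fun h => (graphOf_erase_adj.1 h).1 rfl]
      refine Finset.filter_congr fun x hx => ?_
      simp [graphOf_erase_adj, hne x hx]
    rw [subsetExp_eq_of_split e
      (f₁ := fun s => z ^ (cluster (graphOf s) U
        (insert b A ∪ B.filter ((graphOf s).Adj a))).ncard)
      (f₀ := fun s => z ^ (cluster (graphOf s) U (A ∪ B.filter ((graphOf s).Adj a))).ncard)]
    · have h₁ := ih (insert b A) (Finset.insert_subset hB.1 hA) hB.2
      have h₀ := ih A hA hB.2
      have hc : y ^ (insert b A).card ≤ y ^ (A.card + 1) :=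
        pow_le_pow_right₀ hy (Finset.card_insert_le b A)
      have hq : 0 ≤ (1 + p * (y - 1)) ^ B.card := by
        have : 0 ≤ p * (y - 1) := mul_nonneg hp0 (sub_nonneg.2 hy)
        positivity
      rw [Finset.card_insert_of_notMem hb]
      calc _ ≤ p * (y ^ (A.card + 1) * (1 + p * (y - 1)) ^ B.card) +
            (1 - p) * (y ^ A.card * (1 + p * (y - 1)) ^ B.card) :=
            add_le_add (mul_le_mul_of_nonneg_left
              (h₁.trans (mul_le_mul_of_nonneg_right hc hq)) hp0)
              (mul_le_mul_of_nonneg_left h₀ (sub_nonneg.2 hp1))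
        _ = _ := by ring
    · intro s
      simp only [cluster, hW₁, hF₁, Finset.insert_union, Finset.union_insert]
    · intro s
      simp only [cluster, hW₀, hF₀]

/-- Exponential moments of clusters are bounded by those of a subcritical branching process. -/
theorem subsetExp_pow_ncard_cluster_le {n : ℕ} {p y z : ℝ} (hp0 : 0 ≤ p) (hp1 : p ≤ 1)
    (hy : 1 ≤ y) (hz : 1 ≤ z) (hyz : z * (1 + p * (y - 1)) ^ n ≤ y) (U : Finset (Fin n)) :
    ∀ A ⊆ U, subsetExp p (fun s : Finset (PotentialEdge n) =>
      z ^ (cluster (graphOf s) U A).ncard) ≤ y ^ A.card := by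
  induction U using Finset.strongInduction with
  | H U ih =>
    intro A hA
    rcases A.eq_empty_or_nonempty with rfl | ⟨a, ha⟩
    · simp [cluster, subsetExp_const]
    have hU' := ih (U.erase a) (Finset.erase_ssubset (hA ha))
    have hrev := subsetExp_cluster_reveal hp0 hp1 hy (Finset.notMem_erase a U) hU' (U.erase a)
      (A.erase a) (Finset.erase_subset_erase a hA) subset_rfl
    have h1 : 1 ≤ 1 + p * (y - 1) := by
      have : 0 ≤ p * (y - 1) := mul_nonneg hp0 (sub_nonneg.2 hy)
      linarith
    have hpow : (1 + p * (y - 1)) ^ (U.erase a).card ≤ (1 + p * (y - 1)) ^ n :=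
      pow_le_pow_right₀ h1 (by simpa using Finset.card_le_univ (U.erase a))
    calc _ ≤ subsetExp p (fun s : Finset (PotentialEdge n) => z * z ^ (cluster (graphOf s)
          (U.erase a) (A.erase a ∪ (U.erase a).filter ((graphOf s).Adj a))).ncard) := by
          refine subsetExp_mono hp0 hp1 fun s => ?_
          rw [← pow_succ']
          exact pow_le_pow_right₀ hz ((Set.ncard_le_ncard
            (cluster_subset_insert (graphOf s) ha) (Set.toFinite _)).trans
            (Set.ncard_insert_le _ _))
      _ ≤ z * (y ^ (A.erase a).card * (1 + p * (y - 1)) ^ n) := by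
          rw [subsetExp_const_mul]
          gcongr
          exact hrev.trans (by gcongr)
      _ = y ^ (A.erase a).card * (z * (1 + p * (y - 1)) ^ n) := by ring
      _ ≤ y ^ (A.erase a).card * y := by gcongr
      _ = y ^ A.card := by rw [← pow_succ, Finset.card_erase_add_one ha]

theorem reachable_subset_cluster {V : Type*} [Fintype V] {G H : SimpleGraph V} (h : G ≤ H)
    (u : V) : {x | G.Reachable u x} ⊆ cluster H Finset.univ {u} := fun _ hx =>
  ⟨u, Finset.mem_singleton_self u, hx.mono fun _ _ hab =>
    ⟨h hab, Finset.mem_univ _, Finset.mem_univ _⟩⟩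

/-- Toggling an edge changes the metric dimension by at most the sizes of the clusters of its
endpoints. -/
theorem discreteDeriv_betaR_sq_le {n : ℕ} (hn : n ≠ 1) {u v : Fin n} (huv : ¬ s(u, v).IsDiag)
    (s : Finset (PotentialEdge n)) :
    discreteDeriv ⟨s(u, v), huv⟩ (fun s => betaR (graphOf s)) s ^ 2 ≤
      2 * ((cluster (graphOf s) Finset.univ {u}).ncard : ℝ) ^ 2 +
        2 * ((cluster (graphOf s) Finset.univ {v}).ncard : ℝ) ^ 2 := by
  set e : PotentialEdge n := ⟨s(u, v), huv⟩ with he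
  set G := graphOf (s.erase e) with hG
  set H := graphOf (insert e s) with hH
  have hV : Nat.card (Fin n) ≠ 1 := by simpa using hn
  have hle : G ≤ graphOf s := fun x y h => (graphOf_erase_adj.1 h).2
  have hadj : ∀ x y, H.Adj x y ↔ e.1 = s(x, y) ∨ G.Adj x y := fun x y => by
    rw [hH, hG, graphOf_insert_adj, graphOf_erase_adj]
    tauto
  set D : Set (Fin n) := {x | G.Reachable u x} ∪ {x | G.Reachable v x} with hD
  have hclosed : ∀ x ∉ D, ∀ y, G.Adj x y → y ∉ D := by
    rintro x hx y hxy (hy | hy)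
    · exact hx (Or.inl (hy.trans hxy.symm.reachable))
    · exact hx (Or.inr (hy.trans hxy.symm.reachable))
  have hGH : EmbedsOff D G H := fun x hx y hxy => ⟨hclosed x hx y hxy, (hadj x y).2 (Or.inr hxy)⟩
  have hHG : EmbedsOff D H G := fun x hx y hxy => by
    have hxy' : G.Adj x y := by
      refine ((hadj x y).1 hxy).resolve_left fun h => hx ?_
      have : x ∈ s(u, v) := by
        have h' : s(u, v) = s(x, y) := h
        rw [h']
        exact Sym2.mem_mk_left x y
      rcases Sym2.mem_iff.1 this with rfl | rfl
      · exact Or.inl (SimpleGraph.Reachable.refl _)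
      · exact Or.inr (SimpleGraph.Reachable.refl _)
    exact ⟨hclosed x hx y hxy', hxy'⟩
  have h1 := hGH.metricDim_le_add hV hHG
  have h2 := hHG.metricDim_le_add hV hGH
  have hDc : D.ncard ≤ (cluster (graphOf s) Finset.univ {u}).ncard +
      (cluster (graphOf s) Finset.univ {v}).ncard :=
    (Set.ncard_union_le _ _).trans (add_le_add
      (Set.ncard_le_ncard (reachable_subset_cluster hle u) (Set.toFinite _))
      (Set.ncard_le_ncard (reachable_subset_cluster hle v) (Set.toFinite _)))
  set a : ℝ := ((cluster (graphOf s) Finset.univ {u}).ncard : ℝ)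
  set b : ℝ := ((cluster (graphOf s) Finset.univ {v}).ncard : ℝ)
  have hDc' : (D.ncard : ℝ) ≤ a + b := (Nat.cast_le.2 hDc).trans_eq (Nat.cast_add _ _)
  have h1' : (metricDim H : ℝ) ≤ metricDim G + D.ncard := by exact_mod_cast h1
  have h2' : (metricDim G : ℝ) ≤ metricDim H + D.ncard := by exact_mod_cast h2
  have habs : |(metricDim H : ℝ) - metricDim G| ≤ a + b := abs_le.2 ⟨by linarith, by linarith⟩
  have hsq := sq_le_sq' (abs_le.1 habs).1 (abs_le.1 habs).2
  change ((metricDim H : ℝ) - metricDim G) ^ 2 ≤ _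
  nlinarith [sq_nonneg (a - b)]

theorem exists_sq_le_mul_pow {z : ℝ} (hz : 1 < z) :
    ∃ M : ℝ, 0 < M ∧ ∀ k : ℕ, (k : ℝ) ^ 2 ≤ M * z ^ k := by
  obtain ⟨M, hM⟩ := (tendsto_pow_const_div_const_pow_of_one_lt 2 hz).bddAbove_range
  refine ⟨max M 1, by positivity, fun k => ?_⟩
  have h : (k : ℝ) ^ 2 / z ^ k ≤ M := hM ⟨k, rfl⟩
  have hzk : 0 < z ^ k := by positivity
  rw [div_le_iff₀ hzk] at h
  exact h.trans (mul_le_mul_of_nonneg_right (le_max_left _ _) hzk.le)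

theorem exists_erVar_betaR_le {c : ℝ} (hc0 : 0 < c) (hc1 : c < 1) :
    ∃ K : ℝ, 0 < K ∧ ∀ n : ℕ, 2 ≤ n → erVar n (c / n) betaR ≤ K * n := by
  have hexp : Real.exp (1 - c) < c⁻¹ := by
    rw [← Real.lt_log_iff_exp_lt (by positivity), Real.log_inv]
    linarith [Real.log_lt_sub_one_of_pos hc0 hc1.ne]
  have hz : 1 < c⁻¹ / Real.exp (1 - c) := (one_lt_div (Real.exp_pos _)).2 hexp
  set z := c⁻¹ / Real.exp (1 - c) with hzdef
  have hy : 1 ≤ c⁻¹ := (one_le_inv₀ hc0).2 hc1.le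
  obtain ⟨M, hM0, hM⟩ := exists_sq_le_mul_pow hz
  refine ⟨2 * c * (M * c⁻¹), by positivity, fun n hn => ?_⟩
  have hn0 : (0 : ℝ) < n := by exact_mod_cast (by omega : 0 < n)
  have hn1 : (1 : ℝ) ≤ n := by exact_mod_cast (by omega : 1 ≤ n)
  set p := c / n with hp
  have hp0 : 0 ≤ p := by positivity
  have hp1 : p ≤ 1 := (div_le_one hn0).2 (hc1.le.trans hn1)
  have hyz : z * (1 + p * (c⁻¹ - 1)) ^ n ≤ c⁻¹ := by
    have h1 : 1 + p * (c⁻¹ - 1) ≤ Real.exp ((1 - c) / n) := by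
      have : p * (c⁻¹ - 1) = (1 - c) / n := by rw [hp]; field_simp
      rw [this, add_comm]
      exact Real.add_one_le_exp _
    have h2 : (1 + p * (c⁻¹ - 1)) ^ n ≤ Real.exp (1 - c) := by
      have h0 : 0 ≤ 1 + p * (c⁻¹ - 1) := by
        have : 0 ≤ p * (c⁻¹ - 1) := mul_nonneg hp0 (sub_nonneg.2 hy)
        linarith
      calc _ ≤ Real.exp ((1 - c) / n) ^ n := pow_le_pow_left₀ h0 h1 n
        _ = Real.exp (1 - c) := by rw [← Real.exp_nat_mul]; congr 1; field_simp
    calc _ ≤ z * Real.exp (1 - c) := mul_le_mul_of_nonneg_left h2 (by positivity)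
      _ = c⁻¹ := div_mul_cancel₀ _ (Real.exp_pos _).ne'
  have hcl : ∀ u : Fin n, subsetExp p (fun s : Finset (PotentialEdge n) =>
      ((cluster (graphOf s) Finset.univ {u}).ncard : ℝ) ^ 2) ≤ M * c⁻¹ := fun u => by
    have h := subsetExp_pow_ncard_cluster_le hp0 hp1 hy hz.le hyz Finset.univ {u}
      (Finset.subset_univ _)
    rw [Finset.card_singleton, pow_one] at h
    refine (subsetExp_mono hp0 hp1 fun s => hM _).trans ?_
    rw [subsetExp_const_mul]
    exact mul_le_mul_of_nonneg_left h hM0.le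
  have hder : ∀ e : PotentialEdge n, subsetExp p (fun s : Finset (PotentialEdge n) =>
      discreteDeriv e (fun s => betaR (graphOf s)) s ^ 2) ≤ 4 * (M * c⁻¹) := by
    rintro ⟨e, he⟩
    induction e with
    | h u v =>
      refine (subsetExp_mono hp0 hp1 fun s => discreteDeriv_betaR_sq_le (by omega) he s).trans ?_
      rw [subsetExp_add, subsetExp_const_mul, subsetExp_const_mul]
      linarith [hcl u, hcl v]
  rw [erVar_eq_subsetExp]
  refine (subsetExp_variance_le hp0 hp1 _).trans ?_
  have hterm : ∀ e : PotentialEdge n, p * (1 - p) * subsetExp p (fun s =>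
      discreteDeriv e (fun s => betaR (graphOf s)) s ^ 2) ≤ p * (4 * (M * c⁻¹)) := fun e => by
    have h1 : p * (1 - p) ≤ p := by nlinarith
    have hB : 0 ≤ 4 * (M * c⁻¹) := by positivity
    exact (mul_le_mul_of_nonneg_left (hder e) (mul_nonneg hp0 (sub_nonneg.2 hp1))).trans
      (mul_le_mul_of_nonneg_right h1 hB)
  refine (Finset.sum_le_sum fun e _ => hterm e).trans ?_
  rw [Finset.sum_const, Finset.card_univ, Sym2.card_subtype_not_diag, Fintype.card_fin,
    nsmul_eq_mul, Nat.cast_choose_two]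
  have hB : 0 ≤ M * c⁻¹ := by positivity
  calc (n : ℝ) * (n - 1) / 2 * (p * (4 * (M * c⁻¹)))
      = 2 * (n - 1) * (n * p) * (M * c⁻¹) := by ring
    _ = 2 * (n - 1) * c * (M * c⁻¹) := by rw [hp, mul_div_cancel₀ _ hn0.ne']
    _ ≤ 2 * n * c * (M * c⁻¹) := by gcongr; linarith
    _ = _ := by ring

/-- The transposition of the potential edges `v 1 - v 3` and `v 2 - v 3`, which exchanges star
components and path components on `v`. -/
def edgeSwap {n : ℕ} (v : Fin 4 → Fin n) (hv : Function.Injective v) :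
    PotentialEdge n ≃ PotentialEdge n :=
  Equiv.swap ⟨s(v 1, v 3), fun h => absurd (hv h) (by decide)⟩
    ⟨s(v 2, v 3), fun h => absurd (hv h) (by decide)⟩

theorem graphOf_edgeSwap_adj {n : ℕ} {v : Fin 4 → Fin n} (hv : Function.Injective v)
    (s : Finset (PotentialEdge n)) (x y : Fin n) :
    (graphOf (s.map (edgeSwap v hv).toEmbedding)).Adj x y ↔
      if s(x, y) = s(v 1, v 3) then (graphOf s).Adj (v 2) (v 3)
      else if s(x, y) = s(v 2, v 3) then (graphOf s).Adj (v 1) (v 3)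
      else (graphOf s).Adj x y := by
  have h13 : ¬ s(v 1, v 3).IsDiag := fun h => absurd (hv h) (by decide)
  have h23 : ¬ s(v 2, v 3).IsDiag := fun h => absurd (hv h) (by decide)
  by_cases hxy : s(x, y).IsDiag
  · have h1 : s(x, y) ≠ s(v 1, v 3) := fun h => h13 (h ▸ hxy)
    have h2 : s(x, y) ≠ s(v 2, v 3) := fun h => h23 (h ▸ hxy)
    rw [if_neg h1, if_neg h2]
    have : x = y := hxy
    subst this
    simp
  · rw [← mem_iff_adj hxy, ← mem_iff_adj h13, ← mem_iff_adj h23,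
      Finset.mem_map_equiv, edgeSwap, Equiv.symm_swap, Equiv.swap_apply_def]
    simp only [Subtype.mk.injEq]
    split_ifs <;> first | rfl | exact mem_iff_adj hxy

theorem graphOf_edgeSwap_adj_of_notMem {n : ℕ} {v : Fin 4 → Fin n} (hv : Function.Injective v)
    (s : Finset (PotentialEdge n)) {x : Fin n} (hx : x ∉ Set.range v) (y : Fin n) :
    (graphOf (s.map (edgeSwap v hv).toEmbedding)).Adj x y ↔ (graphOf s).Adj x y := by
  have h : ∀ i j, s(x, y) ≠ s(v i, v j) := fun i j h => by
    have : x ∈ s(v i, v j) := h ▸ Sym2.mem_mk_left x y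
    rcases Sym2.mem_iff.1 this with rfl | rfl <;> exact hx ⟨_, rfl⟩
  rw [graphOf_edgeSwap_adj, if_neg (h _ _), if_neg (h _ _)]

theorem map_edgeSwap_map_edgeSwap {n : ℕ} {v : Fin 4 → Fin n} (hv : Function.Injective v)
    (s : Finset (PotentialEdge n)) :
    (s.map (edgeSwap v hv).toEmbedding).map (edgeSwap v hv).toEmbedding = s := by
  ext e
  simp [edgeSwap, Finset.mem_map_equiv]

theorem adj_iff_of_forall_fin {V : Type*} {G : SimpleGraph V} {v : Fin 4 → V}
    (hv : Function.Injective v) (P : Fin 4 → Fin 4 → Prop) :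
    (∀ i z, G.Adj (v i) z ↔ ∃ j, z = v j ∧ P i j) ↔
      (∀ i, ∀ z ∉ Set.range v, ¬ G.Adj (v i) z) ∧ ∀ i j, G.Adj (v i) (v j) ↔ P i j := by
  constructor
  · intro h
    refine ⟨fun i z hz hadj => ?_, fun i j => ?_⟩
    · obtain ⟨j, rfl, -⟩ := (h i z).1 hadj
      exact hz ⟨j, rfl⟩
    · rw [h]
      constructor
      · rintro ⟨k, hk, hP⟩
        rwa [hv hk]
      · exact fun hP => ⟨j, rfl, hP⟩
  · rintro ⟨hout, hin⟩ i z
    constructor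
    · intro hadj
      by_cases hz : z ∈ Set.range v
      · obtain ⟨j, rfl⟩ := hz
        exact ⟨j, rfl, (hin i j).1 hadj⟩
      · exact absurd hadj (hout i z hz)
    · rintro ⟨j, rfl, hP⟩
      exact (hin i j).2 hP

theorem isPathComponent_edgeSwap {n : ℕ} {v : Fin 4 → Fin n} (hv : Function.Injective v)
    (s : Finset (PotentialEdge n)) :
    IsPathComponent (graphOf (s.map (edgeSwap v hv).toEmbedding)) v ↔
      IsStarComponent (graphOf s) v := by
  have hinj : ∀ i j k l, s(v i, v j) = s(v k, v l) ↔ s(i, j) = s(k, l) := fun i j k l =>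
    (Sym2.map.injective hv).eq_iff (a := s(i, j)) (b := s(k, l))
  rw [IsPathComponent, IsStarComponent, adj_iff_of_forall_fin hv
    (fun i j => (i : ℕ) + 1 = j ∨ (j : ℕ) + 1 = i), adj_iff_of_forall_fin hv
    (fun i j => i ≠ j ∧ (i = 1 ∨ j = 1))]
  refine and_congr (forall_congr' fun i => forall₂_congr fun z hz => ?_) ?_
  · rw [SimpleGraph.adj_comm, graphOf_edgeSwap_adj_of_notMem hv s hz, SimpleGraph.adj_comm]
  · simp only [graphOf_edgeSwap_adj, hinj]
    have hc := (graphOf s).adj_comm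
    constructor
    · intro h i j
      have h13 := h 1 3
      have h23 := h 2 3
      have hij := h i j
      fin_cases i <;> fin_cases j <;> simp_all [hc (v 3)]
    · intro h i j
      have h13 := h 1 3
      have h23 := h 2 3
      have hij := h i j
      fin_cases i <;> fin_cases j <;> simp_all [hc (v 3)]

theorem isStarComponent_edgeSwap {n : ℕ} {v : Fin 4 → Fin n} (hv : Function.Injective v)
    (s : Finset (PotentialEdge n)) :
    IsStarComponent (graphOf (s.map (edgeSwap v hv).toEmbedding)) v ↔
      IsPathComponent (graphOf s) v := by
  rw [← isPathComponent_edgeSwap hv, map_edgeSwap_map_edgeSwap]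

/-- The signed indicator of star and path components on `v`. -/
def starPathSign {n : ℕ} (v : Fin 4 → Fin n) (s : Finset (PotentialEdge n)) : ℝ :=
  (if IsStarComponent (graphOf s) v then 1 else 0) -
    (if IsPathComponent (graphOf s) v then 1 else 0)

/-- The probability of a star component on `v`. -/
def starProb {n : ℕ} (p : ℝ) (v : Fin 4 → Fin n) : ℝ :=
  subsetExp p (fun s : Finset (PotentialEdge n) =>
    if IsStarComponent (graphOf s) v then 1 else 0)

theorem subsetExp_isPathComponent {n : ℕ} (p : ℝ) {v : Fin 4 → Fin n}
    (hv : Function.Injective v) (f : Finset (PotentialEdge n) → ℝ) :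
    subsetExp p (fun s => f s * if IsPathComponent (graphOf s) v then 1 else 0) =
      subsetExp p (fun s => f (s.map (edgeSwap v hv).toEmbedding) *
        if IsStarComponent (graphOf s) v then 1 else 0) := by
  rw [← subsetExp_map_equiv p (edgeSwap v hv)]
  simp only [isPathComponent_edgeSwap]

theorem subsetExp_starPathSign_sq_le {n : ℕ} {p : ℝ} (hp0 : 0 ≤ p) (hp1 : p ≤ 1)
    {v : Fin 4 → Fin n} (hv : Function.Injective v) :
    subsetExp p (fun s => starPathSign v s * starPathSign v s) ≤ 2 * starProb p v := by
  have h := subsetExp_isPathComponent p hv fun _ => 1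
  simp only [one_mul] at h
  calc _ ≤ subsetExp p (fun s : Finset (PotentialEdge n) =>
        (if IsStarComponent (graphOf s) v then (1 : ℝ) else 0) +
          if IsPathComponent (graphOf s) v then 1 else 0) := by
        refine subsetExp_mono hp0 hp1 fun s => ?_
        rw [starPathSign]
        split_ifs <;> norm_num
    _ = _ := by rw [subsetExp_add, h, starProb]; ring

theorem subsetExp_starPathSign {n : ℕ} (p : ℝ) {v : Fin 4 → Fin n}
    (hv : Function.Injective v) : subsetExp p (starPathSign v) = 0 := by
  have h := subsetExp_isPathComponent p hv fun _ => 1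
  simp only [one_mul] at h
  change subsetExp p (fun s => starPathSign v s) = 0
  simp only [starPathSign]
  rw [subsetExp_sub, h, sub_self]

theorem starProb_le_subsetExp_betaR_mul {n : ℕ} (hn : n ≠ 1) {p : ℝ} (hp0 : 0 ≤ p) (hp1 : p ≤ 1)
    {v : Fin 4 → Fin n} (hv : Function.Injective v) :
    starProb p v ≤ subsetExp p (fun s => betaR (graphOf s) * starPathSign v s) := by
  simp only [starPathSign, mul_sub]
  rw [subsetExp_sub, subsetExp_isPathComponent p hv, ← subsetExp_sub, starProb]
  refine subsetExp_mono hp0 hp1 fun s => ?_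
  split_ifs with h
  · have := metricDim_add_one_le (by simpa using hn) hv h
      ((isPathComponent_edgeSwap hv s).2 h) fun x hx y =>
        (graphOf_edgeSwap_adj_of_notMem hv s hx y).symm
    have h2 : (metricDim (graphOf (s.map (edgeSwap v hv).toEmbedding)) : ℝ) + 1 ≤
      metricDim (graphOf s) := by exact_mod_cast this
    simp only [betaR]
    linarith
  · simp

theorem IsStarComponent.reachable {V : Type*} {G : SimpleGraph V} {v : Fin 4 → V}
    (h : IsStarComponent G v) (j : Fin 4) : G.Reachable (v 1) (v j) := by
  rcases eq_or_ne 1 j with rfl | hj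
  · exact SimpleGraph.Reachable.refl _
  · exact SimpleGraph.Adj.reachable ((h 1 _).2 ⟨j, rfl, hj, Or.inl rfl⟩)

theorem IsPathComponent.reachable {V : Type*} {G : SimpleGraph V} {v : Fin 4 → V}
    (h : IsPathComponent G v) (j : Fin 4) : G.Reachable (v 1) (v j) := by
  have hadj : ∀ i j : Fin 4, (i : ℕ) + 1 = j ∨ (j : ℕ) + 1 = i → G.Reachable (v i) (v j) :=
    fun i j hij => SimpleGraph.Adj.reachable ((h i _).2 ⟨j, rfl, hij⟩)
  fin_cases j
  · exact hadj 1 0 (by decide)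
  · exact SimpleGraph.Reachable.refl _
  · exact hadj 1 2 (by decide)
  · exact (hadj 1 2 (by decide)).trans (hadj 2 3 (by decide))

theorem range_subset_of_components {V : Type*} {G : SimpleGraph V} {v w : Fin 4 → V}
    (hv : IsStarComponent G v ∨ IsPathComponent G v)
    (hw : IsStarComponent G w ∨ IsPathComponent G w) {i j : Fin 4} (hij : v i = w j) :
    Set.range v ⊆ Set.range w := by
  have hclosed : ∀ x ∈ Set.range w, ∀ y, G.Adj x y → y ∈ Set.range w := by
    rintro _ ⟨k, rfl⟩ y hy
    rcases hw with hw | hw <;> obtain ⟨l, rfl, -⟩ := (hw k y).1 hy <;> exact ⟨l, rfl⟩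
  have hreach : ∀ k, G.Reachable (v 1) (v k) := fun k => hv.elim (·.reachable k) (·.reachable k)
  rintro _ ⟨k, rfl⟩
  exact mem_of_reachable hclosed ⟨j, hij.symm⟩ ((hreach i).symm.trans (hreach k))

theorem subsetExp_starPathSign_mul {n : ℕ} (p : ℝ) {v w : Fin 4 → Fin n}
    (hv : Function.Injective v) (hne : Set.range v ≠ Set.range w) :
    subsetExp p (fun s => starPathSign v s * starPathSign w s) = 0 := by
  by_cases hdisj : ∃ i j, v i = w j
  · obtain ⟨i, j, hij⟩ := hdisj
    have : ∀ s, starPathSign v s * starPathSign w s = 0 := by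
      intro s
      by_contra h0
      have hcomp : ∀ u : Fin 4 → Fin n, starPathSign u s ≠ 0 →
          IsStarComponent (graphOf s) u ∨ IsPathComponent (graphOf s) u := by
        intro u hu
        by_contra! hc
        exact hu (by simp [starPathSign, hc.1, hc.2])
      have hv' := hcomp v (left_ne_zero_of_mul h0)
      have hw' := hcomp w (right_ne_zero_of_mul h0)
      exact hne ((range_subset_of_components hv' hw' hij).antisymm
        (range_subset_of_components hw' hv' hij.symm))
    simp [this, subsetExp_const]
  · push Not at hdisj
    have hadj : ∀ s i z, (graphOf (s.map (edgeSwap v hv).toEmbedding)).Adj (w i) z ↔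
        (graphOf s).Adj (w i) z := fun s i z =>
      graphOf_edgeSwap_adj_of_notMem hv s (by rintro ⟨j, hj⟩; exact hdisj j i hj) z
    have hw : ∀ s, starPathSign w (s.map (edgeSwap v hv).toEmbedding) = starPathSign w s := by
      intro s
      have h1 : IsStarComponent (graphOf (s.map (edgeSwap v hv).toEmbedding)) w ↔
          IsStarComponent (graphOf s) w := forall₂_congr fun i z => by rw [hadj]
      have h2 : IsPathComponent (graphOf (s.map (edgeSwap v hv).toEmbedding)) w ↔
          IsPathComponent (graphOf s) w := forall₂_congr fun i z => by rw [hadj]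
      simp only [starPathSign, h1, h2]
    have hv' : ∀ s, starPathSign v (s.map (edgeSwap v hv).toEmbedding) = - starPathSign v s := by
      intro s
      simp only [starPathSign, isStarComponent_edgeSwap, isPathComponent_edgeSwap]
      ring
    have h := subsetExp_map_equiv p (edgeSwap v hv) fun s => starPathSign v s * starPathSign w s
    simp only [hw, hv', neg_mul] at h
    have h2 := subsetExp_const_mul p (-1) fun s => starPathSign v s * starPathSign w s
    simp only [neg_one_mul] at h2
    linarith

/-- Lower bound on the variance through the projection on signed counts of components. -/
theorem sum_starProb_le_erVar {n : ℕ} (hn : n ≠ 1) {p : ℝ} (hp0 : 0 ≤ p) (hp1 : p ≤ 1)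
    {ι : Type*} (t : Finset ι) (v : ι → Fin 4 → Fin n) (hv : ∀ i, Function.Injective (v i))
    (hrange : ∀ i j, Set.range (v i) = Set.range (v j) → i = j) :
    (∑ i ∈ t, starProb p (v i)) / 2 ≤ erVar n p betaR := by
  rw [erVar_eq_subsetExp]
  set μ := subsetExp p (fun s : Finset (PotentialEdge n) => betaR (graphOf s))
  set X : Finset (PotentialEdge n) → ℝ := fun s => ∑ i ∈ t, starPathSign (v i) s with hX
  have h0 : 0 ≤ subsetExp p (fun s => (betaR (graphOf s) - μ - 1 / 2 * X s) ^ 2) :=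
    subsetExp_nonneg hp0 hp1 fun s => sq_nonneg _
  have hexpand : (fun s => (betaR (graphOf s) - μ - 1 / 2 * X s) ^ 2) = fun s =>
      ((betaR (graphOf s) - μ) ^ 2 - betaR (graphOf s) * X s) + (μ * X s + 1 / 4 * (X s * X s)) := by
    funext s; ring
  rw [hexpand, subsetExp_add, subsetExp_sub, subsetExp_add, subsetExp_const_mul,
    subsetExp_const_mul] at h0
  have hXexp : subsetExp p X = 0 := by
    rw [hX, subsetExp_sum]
    exact Finset.sum_eq_zero fun i _ => subsetExp_starPathSign p (hv i)
  have hcov : ∑ i ∈ t, starProb p (v i) ≤ subsetExp p (fun s => betaR (graphOf s) * X s) := by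
    simp only [hX, Finset.mul_sum]
    rw [subsetExp_sum]
    exact Finset.sum_le_sum fun i _ => starProb_le_subsetExp_betaR_mul hn hp0 hp1 (hv i)
  have hsq : subsetExp p (fun s => X s * X s) ≤ 2 * ∑ i ∈ t, starProb p (v i) := by
    simp only [hX, Finset.sum_mul_sum]
    rw [subsetExp_sum, Finset.mul_sum]
    refine Finset.sum_le_sum fun i hi => ?_
    rw [subsetExp_sum, Finset.sum_eq_single i]
    · exact subsetExp_starPathSign_sq_le hp0 hp1 (hv i)
    · exact fun j _ hji => subsetExp_starPathSign_mul p (hv i) fun h => hji (hrange i j h).symm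
    · exact fun h => absurd hi h
  rw [hXexp] at h0
  linarith

theorem le_starProb {n : ℕ} {p : ℝ} (hp0 : 0 ≤ p) (hp1 : p ≤ 1) {v : Fin 4 → Fin n}
    (hv : Function.Injective v) : p ^ 3 * (1 - p) ^ (4 * n) ≤ starProb p v := by
  set K : Finset (PotentialEdge n) := Finset.univ.filter fun e =>
    e.1 ∈ ({s(v 1, v 0), s(v 1, v 2), s(v 1, v 3)} : Finset (Sym2 (Fin n))) with hK
  set I : Finset (PotentialEdge n) := Finset.univ.filter fun e => ∃ i, v i ∈ e.1 with hI
  have hcardK : (I.filter (· ∈ K)).card ≤ 3 := by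
    refine (Finset.card_le_card_of_injOn Subtype.val (fun e he => ?_)
      Subtype.val_injective.injOn).trans
      (Finset.card_le_three (a := s(v 1, v 0)) (b := s(v 1, v 2)) (c := s(v 1, v 3)))
    exact (Finset.mem_filter.1 (Finset.mem_filter.1 he).2).2
  have hcardI : (I.filter (· ∉ K)).card ≤ 4 * n := by
    calc _ ≤ I.card := Finset.card_filter_le _ _
      _ ≤ (Finset.univ.image fun x : Fin 4 × Fin n => s(v x.1, x.2)).card := by
        refine Finset.card_le_card_of_injOn Subtype.val (fun e he => ?_)
          Subtype.val_injective.injOn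
        obtain ⟨i, z, hz⟩ := (Finset.mem_filter.1 he).2
        exact Finset.mem_image.2 ⟨(i, z), Finset.mem_univ _, hz.symm⟩
      _ ≤ (Finset.univ : Finset (Fin 4 × Fin n)).card := Finset.card_image_le
      _ = 4 * n := by simp
  have hp1' : 0 ≤ 1 - p := sub_nonneg.2 hp1
  calc _ ≤ p ^ (I.filter (· ∈ K)).card * (1 - p) ^ (I.filter (· ∉ K)).card :=
        mul_le_mul (pow_le_pow_of_le_one hp0 hp1 hcardK)
          (pow_le_pow_of_le_one hp1' (by linarith) hcardI) (by positivity) (by positivity)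
    _ = _ := (subsetExp_trace p K I).symm
    _ ≤ _ := by
      refine subsetExp_mono hp0 hp1 fun s => ?_
      have himp : (∀ e ∈ I, e ∈ s ↔ e ∈ K) → IsStarComponent (graphOf s) v := by
        intro h
        have hadj : ∀ i z, (hd : ¬ s(v i, z).IsDiag) → ((graphOf s).Adj (v i) z ↔
            s(v i, z) = s(v 1, v 0) ∨ s(v i, z) = s(v 1, v 2) ∨ s(v i, z) = s(v 1, v 3)) := by
          intro i z hd
          rw [← mem_iff_adj hd, h _ (Finset.mem_filter.2 ⟨Finset.mem_univ _, i, Sym2.mem_mk_left _ _⟩)]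
          simp [hK]
        have hinj : ∀ i j k l, s(v i, v j) = s(v k, v l) ↔ s(i, j) = s(k, l) := fun i j k l =>
          (Sym2.map.injective hv).eq_iff (a := s(i, j)) (b := s(k, l))
        rw [IsStarComponent, adj_iff_of_forall_fin hv (fun i j => i ≠ j ∧ (i = 1 ∨ j = 1))]
        constructor
        · intro i z hz hiz
          have hz' : ∀ j, s(v i, z) ≠ s(v 1, v j) := fun j hj => by
            have : z ∈ s(v 1, v j) := hj ▸ Sym2.mem_mk_right _ _
            rcases Sym2.mem_iff.1 this with rfl | rfl <;> exact hz ⟨_, rfl⟩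
          rcases (hadj i z hiz.ne).1 hiz with h | h | h <;> exact hz' _ h
        · intro i j
          rcases eq_or_ne i j with rfl | hij
          · simp
          · rw [hadj i (v j) (hv.ne hij), hinj, hinj, hinj]
            revert i j
            decide
      split_ifs with h1 h2
      · exact le_rfl
      · exact absurd (himp h1) h2
      · exact zero_le_one
      · exact le_rfl

theorem exists_le_erVar_betaR {c : ℝ} (hc0 : 0 < c) (hc1 : c < 1) :
    ∃ k : ℝ, 0 < k ∧ ∀ n : ℕ, 6 ≤ n → k * n ≤ erVar n (c / n) betaR := by
  refine ⟨c ^ 3 * (1 - c) ^ 4 / 768, ?_, fun n hn => ?_⟩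
  · have := sub_pos.2 hc1
    positivity
  have hn6 : (6 : ℝ) ≤ n := by exact_mod_cast hn
  have hn0 : (0 : ℝ) < n := by linarith
  set p := c / n with hp
  have hp0 : 0 ≤ p := by positivity
  have hp1 : p ≤ 1 := (div_le_one hn0).2 (by linarith)
  have hc1' : 0 ≤ 1 - c := by linarith
  let ι := {S : Finset (Fin n) // S ∈ Finset.powersetCard 4 Finset.univ}
  have hS : ∀ S : ι, S.1.card = 4 := fun S => (Finset.mem_powersetCard.1 S.2).2
  have hsum := sum_starProb_le_erVar (n := n) (by omega) hp0 hp1 (Finset.univ : Finset ι)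
    (fun S => S.1.orderEmbOfFin (hS S)) (fun S => (S.1.orderEmbOfFin (hS S)).injective)
    (fun S T h => by
      rw [Finset.range_orderEmbOfFin, Finset.range_orderEmbOfFin] at h
      exact Subtype.ext (by exact_mod_cast h))
  refine le_trans ?_ hsum
  have hlow : (Fintype.card ι : ℝ) * (p ^ 3 * (1 - p) ^ (4 * n)) ≤
      ∑ S : ι, starProb p (S.1.orderEmbOfFin (hS S)) := by
    rw [← nsmul_eq_mul, ← Finset.card_univ]
    exact Finset.card_nsmul_le_sum _ _ _ fun S _ => le_starProb hp0 hp1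
      (S.1.orderEmbOfFin (hS S)).injective
  have hcard : Fintype.card ι = n.choose 4 := by
    rw [Fintype.card_coe, Finset.card_powersetCard, Finset.card_univ, Fintype.card_fin]
  have hchoose : (n : ℝ) ^ 4 / 384 ≤ n.choose 4 := by
    have h := Nat.pow_le_choose (α := ℝ) 4 n
    have h4 : (n : ℝ) / 2 ≤ ((n + 1 - 4 : ℕ) : ℝ) := by
      rw [Nat.cast_sub (by omega)]
      push_cast
      linarith
    have h5 : ((n : ℝ) / 2) ^ 4 ≤ ((n + 1 - 4 : ℕ) : ℝ) ^ 4 :=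
      pow_le_pow_left₀ (by positivity) h4 4
    have h6 : ((Nat.factorial 4 : ℕ) : ℝ) = 24 := by norm_num [Nat.factorial]
    rw [h6] at h
    linarith
  have hpow : (1 - c) ^ 4 ≤ (1 - p) ^ (4 * n) := by
    have hb := one_add_mul_le_pow (a := -p) (by linarith) n
    have : 1 + (n : ℝ) * -p = 1 - c := by rw [hp]; field_simp; ring
    rw [this, ← sub_eq_add_neg] at hb
    rw [mul_comm, pow_mul]
    exact pow_le_pow_left₀ hc1' hb 4
  have hmul : (n : ℝ) ^ 4 / 384 * (p ^ 3 * (1 - c) ^ 4) ≤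
      (Fintype.card ι : ℝ) * (p ^ 3 * (1 - p) ^ (4 * n)) := by
    rw [hcard]
    gcongr
  have hid : (n : ℝ) ^ 4 / 384 * (p ^ 3 * (1 - c) ^ 4) = 2 * (c ^ 3 * (1 - c) ^ 4 / 768 * n) := by
    rw [hp]
    field_simp
    ring
  linarith

/-- for `G_n ∈ G(n, c/n)` with `0 < c < 1`, `Var[β(G_n)] = Θ(n)`. -/
theorem er_metricDim_variance_linear (c : ℝ) (hc0 : 0 < c) (hc1 : c < 1) :
    ∃ c₁ c₂ : ℝ, 0 < c₁ ∧ c₁ ≤ c₂ ∧ ∃ N : ℕ, ∀ n : ℕ, N ≤ n →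
      c₁ * n ≤ erVar n (c / n) betaR ∧ erVar n (c / n) betaR ≤ c₂ * n := by
  obtain ⟨k, hk0, hk⟩ := exists_le_erVar_betaR hc0 hc1
  obtain ⟨K, -, hK⟩ := exists_erVar_betaR_le hc0 hc1
  refine ⟨k, max K k, hk0, le_max_right _ _, 6, fun n hn => ⟨hk n hn, ?_⟩⟩
  exact (hK n (by omega)).trans (mul_le_mul_of_nonneg_right (le_max_left _ _) n.cast_nonneg)

end MetricDimPaper
end
end
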